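/- There exists a constant η₀ > 0 (depending only on the target dimension K) with the following property. Let L = 3, let l₂ < l₁ be integers, let Σ = {x ∈ ℝ⁴ : e^{−l₁L} ≤ |x| ≤ e^{−(l₂−1)L}}, and let u : Σ → ℝ^K be an η₀-approximate biharmonic function whose mean value over every sphere {|x| = r} vanishes for all r ∈ [e^{−l₁L}, e^{−(l₂−1)L}]. Then for every integer i with l₂ < i < l₁: (a) if F_{i+1}(u) ≤ e^{−L} F_i(u), then F_i(u) ≤ e^{−L} F_{i−1}(u); (b) if F_{i−1}(u) ≤ e^{−L} F_i(u), then F_i(u) ≤ e^{−L} F_{i+1}(u); and (c) either F_i(u) ≤ e^{−L} F_{i−1}(u) or F_i(u) ≤ e^{−L} F_{i+1}(u). -/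

import Mathlib

open MeasureTheory Metric

noncomputable section

/-- Helper instances so that operator norms of the higher-order coefficient spaces are found. -/
noncomputable instance (K : ℕ) : SeminormedAddCommGroup
    (EuclideanSpace ℝ (Fin 4) →L[ℝ] EuclideanSpace ℝ (Fin 4) →L[ℝ] EuclideanSpace ℝ (Fin K)) :=
  inferInstance

noncomputable instance (K : ℕ) : NormedSpace ℝ
    (EuclideanSpace ℝ (Fin 4) →L[ℝ] EuclideanSpace ℝ (Fin 4) →L[ℝ] EuclideanSpace ℝ (Fin K)) :=
  inferInstance

/-- The Euclidean Laplacian of a map on ℝ⁴ (as trace of the second derivative). -/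
noncomputable def lap {V : Type*} [NormedAddCommGroup V] [NormedSpace ℝ V]
    (f : EuclideanSpace ℝ (Fin 4) → V) (x : EuclideanSpace ℝ (Fin 4)) : V :=
  ∑ i : Fin 4,
    iteratedFDeriv ℝ 2 f x ![EuclideanSpace.single i (1 : ℝ), EuclideanSpace.single i (1 : ℝ)]

/-- Average of `g` over the sphere of radius `r` centered at `0` in ℝ⁴ with respect to the
3-dimensional Hausdorff (surface) measure. -/
noncomputable def sphereAvg {V : Type*} [NormedAddCommGroup V] [NormedSpace ℝ V]
    (r : ℝ) (g : EuclideanSpace ℝ (Fin 4) → V) : V :=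
  (μH[3] (Metric.sphere (0 : EuclideanSpace ℝ (Fin 4)) r)).toReal⁻¹ •
    ∫ y in Metric.sphere (0 : EuclideanSpace ℝ (Fin 4)) r, g y ∂(μH[3])

/-- The approximate biharmonic equation
`Δ²u = a₁(∇Δu) + a₂(∇²u) + a₃(∇u) + a₄(u) + avg_{∂B_{|x|}}[b₁(∇Δu) + b₂(∇²u) + b₃(∇u) + b₄(u)]`
holding at every point of `S`. -/
def ApproxBiharmonicEqOn {K : ℕ} (S : Set (EuclideanSpace ℝ (Fin 4)))
    (u : EuclideanSpace ℝ (Fin 4) → EuclideanSpace ℝ (Fin K))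
    (a₁ : EuclideanSpace ℝ (Fin 4) →
      (EuclideanSpace ℝ (Fin 4) →L[ℝ] EuclideanSpace ℝ (Fin K)) →L[ℝ] EuclideanSpace ℝ (Fin K))
    (a₂ : EuclideanSpace ℝ (Fin 4) →
      (EuclideanSpace ℝ (Fin 4) →L[ℝ] EuclideanSpace ℝ (Fin 4) →L[ℝ] EuclideanSpace ℝ (Fin K))
        →L[ℝ] EuclideanSpace ℝ (Fin K))
    (a₃ : EuclideanSpace ℝ (Fin 4) →
      (EuclideanSpace ℝ (Fin 4) →L[ℝ] EuclideanSpace ℝ (Fin K)) →L[ℝ] EuclideanSpace ℝ (Fin K))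
    (a₄ : EuclideanSpace ℝ (Fin 4) →
      EuclideanSpace ℝ (Fin K) →L[ℝ] EuclideanSpace ℝ (Fin K))
    (b₁ : EuclideanSpace ℝ (Fin 4) →
      (EuclideanSpace ℝ (Fin 4) →L[ℝ] EuclideanSpace ℝ (Fin K)) →L[ℝ] EuclideanSpace ℝ (Fin K))
    (b₂ : EuclideanSpace ℝ (Fin 4) →
      (EuclideanSpace ℝ (Fin 4) →L[ℝ] EuclideanSpace ℝ (Fin 4) →L[ℝ] EuclideanSpace ℝ (Fin K))
        →L[ℝ] EuclideanSpace ℝ (Fin K))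
    (b₃ : EuclideanSpace ℝ (Fin 4) →
      (EuclideanSpace ℝ (Fin 4) →L[ℝ] EuclideanSpace ℝ (Fin K)) →L[ℝ] EuclideanSpace ℝ (Fin K))
    (b₄ : EuclideanSpace ℝ (Fin 4) →
      EuclideanSpace ℝ (Fin K) →L[ℝ] EuclideanSpace ℝ (Fin K)) : Prop :=
  ∀ x ∈ S,
    lap (lap u) x =
      a₁ x (fderiv ℝ (lap u) x) + a₂ x (fderiv ℝ (fderiv ℝ u) x) + a₃ x (fderiv ℝ u x) +
        a₄ x (u x) +
      sphereAvg ‖x‖ (fun y =>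
        b₁ y (fderiv ℝ (lap u) y) + b₂ y (fderiv ℝ (fderiv ℝ u) y) + b₃ y (fderiv ℝ u y) +
          b₄ y (u y))

/-- `u` is an `η`-approximate biharmonic function on `S`: it is smooth on `S` and satisfies the
approximate biharmonic equation with coefficients bounded by `|a_j(x)| + |b_j(x)| ≤ η |x|^{-j}`. -/
def IsApproxBiharmonicOn {K : ℕ} (η : ℝ) (S : Set (EuclideanSpace ℝ (Fin 4)))
    (u : EuclideanSpace ℝ (Fin 4) → EuclideanSpace ℝ (Fin K)) : Prop :=
  ContDiffOn ℝ (⊤ : ℕ∞) u S ∧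
  ∃ (a₁ : EuclideanSpace ℝ (Fin 4) →
      (EuclideanSpace ℝ (Fin 4) →L[ℝ] EuclideanSpace ℝ (Fin K)) →L[ℝ] EuclideanSpace ℝ (Fin K))
    (a₂ : EuclideanSpace ℝ (Fin 4) →
      (EuclideanSpace ℝ (Fin 4) →L[ℝ] EuclideanSpace ℝ (Fin 4) →L[ℝ] EuclideanSpace ℝ (Fin K))
        →L[ℝ] EuclideanSpace ℝ (Fin K))
    (a₃ : EuclideanSpace ℝ (Fin 4) →
      (EuclideanSpace ℝ (Fin 4) →L[ℝ] EuclideanSpace ℝ (Fin K)) →L[ℝ] EuclideanSpace ℝ (Fin K))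
    (a₄ : EuclideanSpace ℝ (Fin 4) →
      EuclideanSpace ℝ (Fin K) →L[ℝ] EuclideanSpace ℝ (Fin K))
    (b₁ : EuclideanSpace ℝ (Fin 4) →
      (EuclideanSpace ℝ (Fin 4) →L[ℝ] EuclideanSpace ℝ (Fin K)) →L[ℝ] EuclideanSpace ℝ (Fin K))
    (b₂ : EuclideanSpace ℝ (Fin 4) →
      (EuclideanSpace ℝ (Fin 4) →L[ℝ] EuclideanSpace ℝ (Fin 4) →L[ℝ] EuclideanSpace ℝ (Fin K))
        →L[ℝ] EuclideanSpace ℝ (Fin K))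
    (b₃ : EuclideanSpace ℝ (Fin 4) →
      (EuclideanSpace ℝ (Fin 4) →L[ℝ] EuclideanSpace ℝ (Fin K)) →L[ℝ] EuclideanSpace ℝ (Fin K))
    (b₄ : EuclideanSpace ℝ (Fin 4) →
      EuclideanSpace ℝ (Fin K) →L[ℝ] EuclideanSpace ℝ (Fin K)),
    ApproxBiharmonicEqOn S u a₁ a₂ a₃ a₄ b₁ b₂ b₃ b₄ ∧
    ∀ x ∈ S,
      ‖a₁ x‖ + ‖b₁ x‖ ≤ η / ‖x‖ ∧
      ‖a₂ x‖ + ‖b₂ x‖ ≤ η / ‖x‖ ^ 2 ∧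
      ‖a₃ x‖ + ‖b₃ x‖ ≤ η / ‖x‖ ^ 3 ∧
      ‖a₄ x‖ + ‖b₄ x‖ ≤ η / ‖x‖ ^ 4

/-- `FF L i u = ∫_{A_i} |u|² |x|⁻⁴ dx` over the annulus `A_i = {e^{-iL} ≤ |x| ≤ e^{-(i-1)L}}`. -/
noncomputable def FF {K : ℕ} (L : ℝ) (i : ℤ)
    (u : EuclideanSpace ℝ (Fin 4) → EuclideanSpace ℝ (Fin K)) : ℝ :=
  ∫ x in {x : EuclideanSpace ℝ (Fin 4) |
      Real.exp (-(i : ℝ) * L) ≤ ‖x‖ ∧ ‖x‖ ≤ Real.exp (-((i : ℝ) - 1) * L)},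
    ‖u x‖ ^ 2 / ‖x‖ ^ 4

namespace ThreeCircle

section LinearODE

open Real intervalIntegral

/-- A nonnegative discriminant condition makes a binary quadratic form nonnegative. -/
lemma quadForm_nonneg {P B R : ℝ} (hP : 0 ≤ P) (hR : 0 ≤ R) (h : B ^ 2 ≤ P * R) (A C : ℝ) :
    0 ≤ A ^ 2 * P + 2 * (A * C) * B + C ^ 2 * R := by
  rcases hP.eq_or_lt with rfl | hP
  · have : B = 0 := by nlinarith [sq_nonneg B]
    subst this
    nlinarith [mul_nonneg (sq_nonneg C) hR]
  · have : 0 ≤ P * (A ^ 2 * P + 2 * (A * C) * B + C ^ 2 * R) := by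
      nlinarith [sq_nonneg (A * P + C * B), mul_nonneg (sq_nonneg C) (sub_nonneg.2 h)]
    exact nonneg_of_mul_nonneg_right this hP

/-- `2 ∫₀ˣ cosh² (n t) dt = sinhc n x + x`. -/
def sinhc (n x : ℝ) : ℝ := sinh (2 * n * x) / (2 * n)

/-- Twice the integral over `[0, x]` of the square of `A cosh (k t) + C cosh ((k+2) t)`
(for `s = 1`) or of `A sinh (k t) + C sinh ((k+2) t)` (for `s = -1`). -/
def modeForm (s k x A C : ℝ) : ℝ :=
  A ^ 2 * (sinhc k x + s * x) + 2 * (A * C) * (sinhc (k + 1) x + s * sinhc 1 x)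
    + C ^ 2 * (sinhc (k + 2) x + s * x)

lemma hasDerivAt_sinhc {n : ℝ} (hn : n ≠ 0) (x : ℝ) :
    HasDerivAt (sinhc n) (cosh (2 * n * x)) x := by
  have h := ((hasDerivAt_id x).const_mul (2 * n)).sinh.div_const (2 * n)
  refine h.congr_deriv ?_
  simp only [id, mul_one]
  field_simp

lemma integral_cosh_form {k : ℝ} (hk : 0 < k) (a b A C : ℝ) :
    ∫ t in a..b, 2 * (A * cosh (k * t) + C * cosh ((k + 2) * t)) ^ 2 =
      modeForm 1 k b A C - modeForm 1 k a A C := by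
  apply integral_eq_sub_of_hasDerivAt
  · intro x _
    have h0 := hasDerivAt_sinhc hk.ne' x
    have h1 := hasDerivAt_sinhc (show k + 1 ≠ 0 by positivity) x
    have h2 := hasDerivAt_sinhc (show k + 2 ≠ 0 by positivity) x
    have h3 := hasDerivAt_sinhc one_ne_zero x
    have hid := hasDerivAt_id x
    have := (((h0.add (hid.const_mul 1)).const_mul (A ^ 2)).add
      ((h1.add (h3.const_mul 1)).const_mul (2 * (A * C)))).add
      ((h2.add (hid.const_mul 1)).const_mul (C ^ 2))
    refine this.congr_deriv ?_
    have e0 : 2 * k * x = k * x + k * x := by ring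
    have e1 : 2 * (k + 1) * x = (k + 2) * x + k * x := by ring
    have e2 : 2 * (k + 2) * x = (k + 2) * x + (k + 2) * x := by ring
    have e3 : 2 * 1 * x = (k + 2) * x - k * x := by ring
    rw [e0, e1, e2, e3, cosh_add, cosh_add, cosh_add, cosh_sub]
    have p := cosh_sq (k * x)
    have q := cosh_sq ((k + 2) * x)
    linear_combination (-A ^ 2) * p - C ^ 2 * q
  · exact (by fun_prop : Continuous _).intervalIntegrable _ _

lemma integral_sinh_form {k : ℝ} (hk : 0 < k) (a b A C : ℝ) :
    ∫ t in a..b, 2 * (A * sinh (k * t) + C * sinh ((k + 2) * t)) ^ 2 =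
      modeForm (-1) k b A C - modeForm (-1) k a A C := by
  apply integral_eq_sub_of_hasDerivAt
  · intro x _
    have h0 := hasDerivAt_sinhc hk.ne' x
    have h1 := hasDerivAt_sinhc (show k + 1 ≠ 0 by positivity) x
    have h2 := hasDerivAt_sinhc (show k + 2 ≠ 0 by positivity) x
    have h3 := hasDerivAt_sinhc one_ne_zero x
    have hid := hasDerivAt_id x
    have := (((h0.add (hid.const_mul (-1))).const_mul (A ^ 2)).add
      ((h1.add (h3.const_mul (-1))).const_mul (2 * (A * C)))).add
      ((h2.add (hid.const_mul (-1))).const_mul (C ^ 2))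
    refine this.congr_deriv ?_
    have e0 : 2 * k * x = k * x + k * x := by ring
    have e1 : 2 * (k + 1) * x = (k + 2) * x + k * x := by ring
    have e2 : 2 * (k + 2) * x = (k + 2) * x + (k + 2) * x := by ring
    have e3 : 2 * 1 * x = (k + 2) * x - k * x := by ring
    rw [e0, e1, e2, e3, cosh_add, cosh_add, cosh_add, cosh_sub]
    have p := cosh_sq (k * x)
    have q := cosh_sq ((k + 2) * x)
    linear_combination (A ^ 2) * p + C ^ 2 * q
  · exact (by fun_prop : Continuous _).intervalIntegrable _ _

lemma modeForm_zero (s k A C : ℝ) : modeForm s k 0 A C = 0 := by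
  simp [modeForm, sinhc]

lemma modeForm_nonneg {s k x : ℝ} (hs : s = 1 ∨ s = -1) (hk : 0 < k) (hx : 0 ≤ x) (A C : ℝ) :
    0 ≤ modeForm s k x A C := by
  rcases hs with rfl | rfl
  · have h := integral_cosh_form hk 0 x A C
    rw [modeForm_zero, sub_zero] at h
    rw [← h]
    exact integral_nonneg hx fun t _ => by positivity
  · have h := integral_sinh_form hk 0 x A C
    rw [modeForm_zero, sub_zero] at h
    rw [← h]
    exact integral_nonneg hx fun t _ => by positivity

lemma self_le_sinhc {n x : ℝ} (hn : 0 < n) (hx : 0 ≤ x) : x ≤ sinhc n x := by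
  rw [sinhc, le_div_iff₀ (by positivity)]
  have := self_le_sinh_iff.2 (show 0 ≤ 2 * n * x by positivity)
  linarith

lemma sinh_mul_exp_le {x y : ℝ} (hxy : x ≤ y) : sinh x * exp (y - x) ≤ sinh y := by
  rw [sinh_eq, sinh_eq, show exp y = exp x * exp (y - x) by rw [← exp_add]; ring_nf,
    show exp (-y) = exp (-x) * exp (x - y) by rw [← exp_add]; ring_nf]
  have h1 : exp (x - y) ≤ 1 := exp_le_one_iff.2 (by linarith)
  have h2 : 1 ≤ exp (y - x) := one_le_exp (by linarith)
  nlinarith [exp_pos (-x)]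

lemma sinhc_mul_sinhc {k : ℝ} (hk : 0 < k) (x : ℝ) :
    sinhc k x * sinhc (k + 2) x * (k * (k + 2)) =
      (k + 1) ^ 2 * sinhc (k + 1) x ^ 2 - sinhc 1 x ^ 2 := by
  have h : sinh (2 * k * x) * sinh (2 * (k + 2) * x) =
      sinh (2 * (k + 1) * x) ^ 2 - sinh (2 * 1 * x) ^ 2 := by
    have e0 : 2 * k * x = 2 * (k + 1) * x - 2 * 1 * x := by ring
    have e1 : 2 * (k + 2) * x = 2 * (k + 1) * x + 2 * 1 * x := by ring
    rw [e0, e1, sinh_add, sinh_sub]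
    linear_combination sinh (2 * (k + 1) * x) ^ 2 * cosh_sq (2 * 1 * x)
      - sinh (2 * 1 * x) ^ 2 * cosh_sq (2 * (k + 1) * x)
  simp only [sinhc]
  generalize sinh (2 * k * x) = S0 at *
  generalize sinh (2 * (k + 2) * x) = S1 at *
  generalize sinh (2 * (k + 1) * x) = S2 at *
  generalize sinh (2 * 1 * x) = S3 at *
  field_simp
  linear_combination h

lemma exp_lower (k : ℕ) (hk : 2 ≤ k) :
    2040 * ((k : ℝ) + 1) ^ 2 ≤ exp (5.8 * k) ∧ 20 * ((k : ℝ) + 1) ^ 3 ≤ exp (5.8 * k) := by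
  have h300 : (300 : ℝ) ≤ exp 5.8 := by
    have h1 : exp 5.8 ^ 5 = exp 1 ^ 29 := by
      rw [← exp_nat_mul, ← exp_nat_mul]; norm_num
    have h2 : (2.718 : ℝ) ^ 29 ≤ exp 1 ^ 29 :=
      pow_le_pow_left₀ (by norm_num) (by linarith [exp_one_gt_d9]) _
    by_contra! h
    have h3 : exp 5.8 ^ 5 < 300 ^ 5 := pow_lt_pow_left₀ h (exp_pos _).le (by norm_num)
    have : (300 : ℝ) ^ 5 ≤ 2.718 ^ 29 := by norm_num
    linarith
  have h2 : 2040 * ((k : ℝ) + 1) ^ 2 ≤ 300 ^ k ∧ 20 * ((k : ℝ) + 1) ^ 3 ≤ 300 ^ k := by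
    induction k, hk using Nat.le_induction with
    | base => norm_num
    | succ n hn ih =>
      have h2n : (2 : ℝ) ≤ n := by exact_mod_cast hn
      rw [pow_succ (300 : ℝ)]
      push_cast
      have h1 : (n : ℝ) + 1 + 1 ≤ 2 * (n + 1) := by linarith
      have h3 : ((n : ℝ) + 1 + 1) ^ 2 ≤ (2 * (n + 1)) ^ 2 :=
        pow_le_pow_left₀ (by positivity) h1 2
      have h4 : ((n : ℝ) + 1 + 1) ^ 3 ≤ (2 * (n + 1)) ^ 3 :=
        pow_le_pow_left₀ (by positivity) h1 3
      rw [mul_pow] at h3 h4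
      have h5 : (0 : ℝ) ≤ (n + 1) ^ 2 := by positivity
      have h6 : (0 : ℝ) ≤ (n + 1) ^ 3 := by positivity
      constructor <;> linarith [ih.1, ih.2]
  have h3 : (300 : ℝ) ^ k ≤ exp (5.8 * k) := by
    calc (300 : ℝ) ^ k ≤ exp 5.8 ^ k := pow_le_pow_left₀ (by norm_num) h300 _
      _ = exp (5.8 * k) := by rw [← exp_nat_mul]; ring_nf
  exact ⟨h2.1.trans h3, h2.2.trans h3⟩

lemma growth_algebra {a b c d e m : ℝ} (hc0 : 0 ≤ c) (hs1 : 0 ≤ d) (ha0 : 0 ≤ a)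
    (hb0 : 0 ≤ b) (hm : 3 ≤ m) (he0 : 0 ≤ e) (hem : e * m ^ 2 ≤ 0.11)
    (hq2 : d * m ^ 2 ≤ 0.05 * c) (hprod : a * b * (m ^ 2 - 1) = m ^ 2 * c ^ 2 - d ^ 2) :
    (c + d) ^ 2 ≤ ((1 - e) * a) * ((1 - e) * b) := by
  have h1 : 0 < m ^ 2 - 1 := by nlinarith
  have hm9 : 9 ≤ m ^ 2 := by nlinarith
  have h3 : d ≤ 0.006 * c := by nlinarith
  have he1 : e ≤ 0.0125 := by nlinarith
  have h4 : ((1 - e) * a) * ((1 - e) * b) * (m ^ 2 - 1) =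
      (1 - e) ^ 2 * (m ^ 2 * c ^ 2 - d ^ 2) := by rw [← hprod]; ring
  refine le_of_mul_le_mul_right ?_ h1
  rw [h4]
  have h5 : (1 - 2 * e) * (m ^ 2 * c ^ 2 - d ^ 2) ≤ (1 - e) ^ 2 * (m ^ 2 * c ^ 2 - d ^ 2) := by
    apply mul_le_mul_of_nonneg_right
    · nlinarith
    · rw [← hprod]; positivity
  have hd2 : d ^ 2 ≤ 0.006 * (c * d) := by nlinarith
  have hcd : c * d ≤ 0.006 * c ^ 2 := by nlinarith
  have h7 : c * d * m ^ 2 ≤ 0.05 * c ^ 2 := by nlinarith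
  have h9 : e * m ^ 2 * c ^ 2 ≤ 0.11 * c ^ 2 := by gcongr
  have h11 : 0 ≤ c * d := by positivity
  have h12 : 0 ≤ e * d ^ 2 := by positivity
  have h10 : (c + d) ^ 2 * (m ^ 2 - 1) ≤ (c ^ 2 + 2.1 * (c * d)) * (m ^ 2 - 1) := by
    gcongr; linarith
  linarith [h5, h10, sq_nonneg c]

lemma modeForm_le {s k x : ℝ} (hs : s = 1 ∨ s = -1) (hk : 0 < k) (hx : 0 ≤ x) (A C : ℝ) :
    modeForm s k x A C ≤ 4 * (A ^ 2 * sinhc k x + C ^ 2 * sinhc (k + 2) x) := by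
  have h1 := modeForm_nonneg hs hk hx A (-C)
  have hsx : s * x ≤ x := by rcases hs with rfl | rfl <;> linarith
  have h2 := mul_nonneg (sq_nonneg A) (sub_nonneg.2 (hsx.trans (self_le_sinhc hk hx)))
  have h3 := mul_nonneg (sq_nonneg C)
    (sub_nonneg.2 (hsx.trans (self_le_sinhc (by positivity : 0 < k + 2) hx)))
  simp only [modeForm] at h1 ⊢
  linarith

lemma modeForm_growth_of_two_le {s : ℝ} (hs : s = 1 ∨ s = -1) (k : ℕ) (hk : 2 ≤ k) (A C : ℝ) :
    51 * modeForm s k 1.5 A C ≤ modeForm s k 4.4 A C := by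
  have hk2 : (2 : ℝ) ≤ k := by exact_mod_cast hk
  have hk0 : (0 : ℝ) < k := by linarith
  set m : ℝ := k + 1 with hm
  have hX := (exp_lower k hk).1
  have hX3 := (exp_lower k hk).2
  set X := exp (5.8 * k) with hXdef
  have hXp : 0 < X := exp_pos _
  have ratio : ∀ n : ℝ, (k : ℝ) ≤ n → X * sinhc n 1.5 ≤ sinhc n 4.4 := by
    intro n hn
    have hn0 : 0 < n := by linarith
    have h1 := sinh_mul_exp_le (show 2 * n * 1.5 ≤ 2 * n * 4.4 by nlinarith)
    have h2 : X ≤ exp (2 * n * 4.4 - 2 * n * 1.5) := exp_le_exp.2 (by nlinarith)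
    rw [sinhc, sinhc, ← mul_div_assoc]
    gcongr
    have h3 : 0 ≤ sinh (2 * n * 1.5) := sinh_nonneg_iff.2 (by positivity)
    nlinarith
  have hα := ratio k le_rfl
  have hβ := ratio (k + 2) (by linarith)
  have hα' := self_le_sinhc hk0 (show (0 : ℝ) ≤ 1.5 by norm_num)
  have hβ' := self_le_sinhc (show (0 : ℝ) < k + 2 by positivity) (show (0 : ℝ) ≤ 1.5 by norm_num)
  have hprod := sinhc_mul_sinhc hk0 4.4
  have hs1 : (0 : ℝ) ≤ sinhc 1 4.4 := (by norm_num : (0:ℝ) ≤ 4.4).trans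
    (self_le_sinhc one_pos (by norm_num))
  have hq : X * sinhc 1 4.4 ≤ m * sinhc m 4.4 := by
    have h1 := sinh_mul_exp_le (show 2 * 1 * 4.4 ≤ 2 * m * 4.4 by nlinarith)
    have h2 : X ≤ exp (2 * m * 4.4 - 2 * 1 * 4.4) := exp_le_exp.2 (by nlinarith)
    have h3 : 0 ≤ sinh (2 * 1 * (4.4 : ℝ)) := sinh_nonneg_iff.2 (by norm_num)
    have e : m * sinhc m 4.4 = sinh (2 * m * 4.4) / 2 := by
      have : m ≠ 0 := by positivity
      rw [sinhc]
      generalize sinh (2 * m * 4.4) = S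
      field_simp
    rw [e, sinhc, ← mul_div_assoc, mul_one]
    have : X * sinh (2 * 1 * 4.4) ≤ sinh (2 * m * 4.4) := by nlinarith
    norm_num at this ⊢
    linarith
  -- upper bound at `1.5`
  have hup := modeForm_le hs hk0 (show (0 : ℝ) ≤ 1.5 by norm_num) A C
  set a := sinhc k 4.4
  set b := sinhc (k + 2) 4.4
  set c := sinhc m 4.4
  set d := sinhc 1 4.4
  have ha : X * 1.5 ≤ a := (mul_le_mul_of_nonneg_left hα' hXp.le).trans hα
  have hb : X * 1.5 ≤ b := (mul_le_mul_of_nonneg_left hβ' hXp.le).trans hβ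
  set Y := X⁻¹ with hY
  have hYX : Y * X = 1 := inv_mul_cancel₀ hXp.ne'
  have hYp : 0 < Y := inv_pos.2 hXp
  have hYm : 2040 * m ^ 2 * Y ≤ 1 := by
    rw [← hYX, mul_comm Y]; exact mul_le_mul_of_nonneg_right hX hYp.le
  have hm3 : 3 ≤ m := by linarith
  have hα2 : sinhc k 1.5 ≤ Y * a := by
    calc _ = Y * (X * sinhc k 1.5) := by rw [← mul_assoc, hYX, one_mul]
      _ ≤ _ := by gcongr
  have hβ2 : sinhc (k + 2) 1.5 ≤ Y * b := by
    calc _ = Y * (X * sinhc (k + 2) 1.5) := by rw [← mul_assoc, hYX, one_mul]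
      _ ≤ _ := by gcongr
  have hd2 : d ≤ Y * (m * c) := by
    calc _ = Y * (X * d) := by rw [← mul_assoc, hYX, one_mul]
      _ ≤ _ := by gcongr
  have ha2 : 4.4 ≤ 3 * (Y * a) := by
    have : Y * (X * 1.5) ≤ Y * a := by gcongr
    rw [← mul_assoc, hYX] at this; linarith
  have hb2 : 4.4 ≤ 3 * (Y * b) := by
    have : Y * (X * 1.5) ≤ Y * b := by gcongr
    rw [← mul_assoc, hYX] at this; linarith
  set e := 207 * Y with he
  have hc0 : 0 ≤ c := (by norm_num : (0:ℝ) ≤ 4.4).trans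
    (self_le_sinhc (by positivity) (by norm_num))
  have ha0 : 0 ≤ a := (by positivity : 0 ≤ X * 1.5).trans ha
  have hb0 : 0 ≤ b := (by positivity : 0 ≤ X * 1.5).trans hb
  have hem : e * m ^ 2 ≤ 0.11 := by rw [he]; linarith
  have hq2 : d * m ^ 2 ≤ 0.05 * c := by
    have h1 : d * m ^ 2 ≤ Y * (m * c) * m ^ 2 := by gcongr
    have h2 : Y * (m * c) * m ^ 2 = (m ^ 3 * Y) * c := by ring
    have h3 : m ^ 3 * Y ≤ 0.05 := by
      have : 20 * m ^ 3 * Y ≤ X * Y := mul_le_mul_of_nonneg_right hX3 hYp.le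
      rw [mul_comm X, hYX] at this
      linarith
    have h4 := mul_le_mul_of_nonneg_right h3 hc0
    linarith
  have hprod' : a * b * (m ^ 2 - 1) = m ^ 2 * c ^ 2 - d ^ 2 := by
    rw [← hprod, hm]; ring
  have key := growth_algebra hc0 hs1 ha0 hb0 hm3 (by positivity) hem hq2 hprod'
  have he1 : e ≤ 0.0125 := by
    have : e * 9 ≤ e * m ^ 2 := mul_le_mul_of_nonneg_left (by nlinarith) (by positivity)
    linarith
  have hcd := mul_nonneg hc0 hs1
  have hB : (c + s * d) ^ 2 ≤ ((1 - e) * a) * ((1 - e) * b) := by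
    refine le_trans ?_ key
    rcases hs with rfl | rfl <;> linarith
  have hQ := quadForm_nonneg (mul_nonneg (by linarith) ha0) (mul_nonneg (by linarith) hb0) hB A C
  have hs' : -1 ≤ s := by rcases hs with rfl | rfl <;> norm_num
  have hlow : A ^ 2 * (a + s * 4.4) + 2 * (A * C) * (c + s * d) + C ^ 2 * (b + s * 4.4)
      = modeForm s k 4.4 A C := rfl
  rw [← hlow]
  have h1 : A ^ 2 * sinhc k 1.5 ≤ A ^ 2 * (Y * a) := by gcongr
  have h2 : C ^ 2 * sinhc (k + 2) 1.5 ≤ C ^ 2 * (Y * b) := by gcongr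
  have h3 : 0 ≤ A ^ 2 * (3 * (Y * a) + s * 4.4) := mul_nonneg (sq_nonneg _) (by linarith)
  have h4 : 0 ≤ C ^ 2 * (3 * (Y * b) + s * 4.4) := mul_nonneg (sq_nonneg _) (by linarith)
  rw [he] at hQ
  linarith

lemma exp_eight_point_eight : (6500 : ℝ) ≤ exp 8.8 := by
  have h1 : exp 8.8 ^ 5 = exp 1 ^ 44 := by
    rw [← exp_nat_mul, ← exp_nat_mul]; norm_num
  have h2 : (2.718 : ℝ) ^ 44 ≤ exp 1 ^ 44 :=
    pow_le_pow_left₀ (by norm_num) (by linarith [exp_one_gt_d9]) _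
  by_contra! h
  have h3 : exp 8.8 ^ 5 < 6500 ^ 5 := pow_lt_pow_left₀ h (exp_pos _).le (by norm_num)
  have : (6500 : ℝ) ^ 5 ≤ 2.718 ^ 44 := by norm_num
  linarith

lemma exp_three_le : exp 3 ≤ 20.1 := by
  have h1 : exp 3 = exp 1 ^ 3 := by rw [← exp_nat_mul]; norm_num
  rw [h1]
  calc exp 1 ^ 3 ≤ 2.7183 ^ 3 :=
        pow_le_pow_left₀ (exp_pos _).le (by linarith [exp_one_lt_d9]) _
    _ ≤ _ := by norm_num

lemma quartic_margin {X : ℝ} (hX : 6500 ≤ X) :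
    (X ^ 2 / 8 + X / 4 + 300) ^ 2 ≤ (X / 4 - 340) * (X ^ 3 / 12 - 35000) := by
  have hX0 : 0 ≤ X := by linarith
  have hX2 : 6500 * X ≤ X ^ 2 := by nlinarith
  have hX3 : 6500 * X ^ 2 ≤ X ^ 3 := by
    have := mul_le_mul_of_nonneg_right hX (sq_nonneg X)
    linarith
  have hX4 : 6500 * X ^ 3 ≤ X ^ 4 := by
    have := mul_le_mul_of_nonneg_right hX (pow_nonneg hX0 3)
    linarith
  ring_nf
  linarith

lemma modeForm_growth_one {s : ℝ} (hs : s = 1 ∨ s = -1) (A C : ℝ) :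
    51 * modeForm s 1 1.5 A C ≤ modeForm s 1 4.4 A C := by
  have hX := exp_eight_point_eight
  have hE := exp_three_le
  have hE1 : 1 ≤ exp 3 := one_le_exp (by norm_num)
  generalize hXd : exp 8.8 = X at *
  generalize hEd : exp 3 = E at *
  have x1 : 0 < exp (-8.8) := exp_pos _
  have x1' : exp (-8.8) ≤ 1 := exp_le_one_iff.2 (by norm_num)
  have x2 : exp 17.6 = X ^ 2 := by rw [← hXd, ← exp_nat_mul]; norm_num
  have x3 : exp 26.4 = X ^ 3 := by rw [← hXd, ← exp_nat_mul]; norm_num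
  have y2 : exp (-17.6) ≤ 1 := exp_le_one_iff.2 (by norm_num)
  have y3 : exp (-26.4) ≤ 1 := exp_le_one_iff.2 (by norm_num)
  have y2' : 0 < exp (-17.6) := exp_pos _
  have z1 : 0 < exp (-3) := exp_pos _
  have z1' : exp (-3) ≤ 1 := exp_le_one_iff.2 (by norm_num)
  have z2' : exp (-6) ≤ 1 := exp_le_one_iff.2 (by norm_num)
  have z2 : 0 < exp (-6) := exp_pos _
  have z3 : 0 < exp (-9) := exp_pos _
  have e2 : exp 6 = E ^ 2 := by rw [← hEd, ← exp_nat_mul]; norm_num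
  have e3 : exp 9 = E ^ 3 := by rw [← hEd, ← exp_nat_mul]; norm_num
  have e2' : E ^ 2 ≤ 20.1 ^ 2 := pow_le_pow_left₀ (by positivity) hE _
  have e3' : E ^ 3 ≤ 20.1 ^ 3 := pow_le_pow_left₀ (by positivity) hE _
  have e2l : 1 ≤ E ^ 2 := one_le_pow₀ hE1
  have u1 : sinhc 1 4.4 = (X - exp (-8.8)) / 4 := by
    rw [sinhc, sinh_eq, show (2 : ℝ) * 1 * 4.4 = 8.8 by norm_num, hXd]; ring
  have u2 : sinhc 2 4.4 = (X ^ 2 - exp (-17.6)) / 8 := by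
    rw [sinhc, sinh_eq, show (2 : ℝ) * 2 * 4.4 = 17.6 by norm_num, x2]; ring
  have u3 : sinhc 3 4.4 = (X ^ 3 - exp (-26.4)) / 12 := by
    rw [sinhc, sinh_eq, show (2 : ℝ) * 3 * 4.4 = 26.4 by norm_num, x3]; ring
  have w1 : sinhc 1 1.5 = (E - exp (-3)) / 4 := by
    rw [sinhc, sinh_eq, show (2 : ℝ) * 1 * 1.5 = 3 by norm_num, hEd]; ring
  have w2 : sinhc 2 1.5 = (E ^ 2 - exp (-6)) / 8 := by
    rw [sinhc, sinh_eq, show (2 : ℝ) * 2 * 1.5 = 6 by norm_num, e2]; ring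
  have w3 : sinhc 3 1.5 = (E ^ 3 - exp (-9)) / 12 := by
    rw [sinhc, sinh_eq, show (2 : ℝ) * 3 * 1.5 = 9 by norm_num, e3]; ring
  have hP : X / 4 - 340 ≤ (sinhc 1 4.4 + s * 4.4) - 51 * (sinhc 1 1.5 + s * 1.5) := by
    rw [u1, w1]
    rcases hs with rfl | rfl <;> linarith
  have hR : X ^ 3 / 12 - 35000 ≤ (sinhc 3 4.4 + s * 4.4) - 51 * (sinhc 3 1.5 + s * 1.5) := by
    rw [u3, w3]
    rcases hs with rfl | rfl <;> linarith
  have hX2 : 6500 * X ≤ X ^ 2 := by nlinarith only [hX]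
  have hBu : (sinhc 2 4.4 + s * sinhc 1 4.4) - 51 * (sinhc 2 1.5 + s * sinhc 1 1.5) ≤
      X ^ 2 / 8 + X / 4 + 300 := by
    rw [u1, w1, u2, w2]
    rcases hs with rfl | rfl <;> linarith
  have hBl : 0 ≤ (sinhc 2 4.4 + s * sinhc 1 4.4) - 51 * (sinhc 2 1.5 + s * sinhc 1 1.5) := by
    rw [u1, w1, u2, w2]
    rcases hs with rfl | rfl <;> linarith
  have hfin := quartic_margin hX
  set P := (sinhc 1 4.4 + s * 4.4) - 51 * (sinhc 1 1.5 + s * 1.5) with hPd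
  set R := (sinhc 3 4.4 + s * 4.4) - 51 * (sinhc 3 1.5 + s * 1.5) with hRd
  set B := (sinhc 2 4.4 + s * sinhc 1 4.4) - 51 * (sinhc 2 1.5 + s * sinhc 1 1.5) with hBd
  have hP0 : 0 ≤ X / 4 - 340 := by linarith only [hX]
  have hR0 : 0 ≤ X ^ 3 / 12 - 35000 := by
    have := pow_le_pow_left₀ (by norm_num) hX 3
    linarith only [this]
  have hB2 : B ^ 2 ≤ P * R := by
    calc B ^ 2 ≤ (X ^ 2 / 8 + X / 4 + 300) ^ 2 := pow_le_pow_left₀ hBl hBu 2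
      _ ≤ _ := hfin
      _ ≤ P * R := mul_le_mul hP hR hR0 (hP0.trans hP)
  have hQ := quadForm_nonneg (hP0.trans hP) (hR0.trans hR) hB2 A C
  have t2 : (1 : ℝ) + 1 = 2 := by norm_num
  have t3 : (1 : ℝ) + 2 = 3 := by norm_num
  simp only [modeForm, t2, t3]
  rw [hPd, hRd, hBd] at hQ
  linarith only [hQ]

lemma modeForm_growth {s : ℝ} (hs : s = 1 ∨ s = -1) (k : ℕ) (hk : 1 ≤ k) (A C : ℝ) :
    51 * modeForm s k 1.5 A C ≤ modeForm s k 4.4 A C := by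
  rcases hk.eq_or_lt with rfl | hk
  · simpa using modeForm_growth_one hs A C
  · exact modeForm_growth_of_two_le hs k hk A C

/-- Growth of solutions of the homogeneous mode equation. -/
lemma homogeneous_growth (k : ℕ) (hk : 1 ≤ k) (A B C D : ℝ) (h : ℝ → ℝ)
    (hh : ∀ t, h t = (A * cosh (k * t) + C * cosh ((k + 2) * t)) +
      (B * sinh (k * t) + D * sinh ((k + 2) * t))) :
    50 * ∫ t in (-1.5)..1.5, h t ^ 2 ≤
      (∫ t in (-4.4)..(-1.5), h t ^ 2) + ∫ t in (1.5)..4.4, h t ^ 2 := by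
  have hk0 : (0 : ℝ) < k := by exact_mod_cast hk
  have hc : Continuous h := by
    have : h = fun t => _ := funext hh
    rw [this]; fun_prop
  have hi : ∀ a b, IntervalIntegrable (fun t => h t ^ 2) volume a b := fun a b =>
    (hc.pow 2).intervalIntegrable _ _
  have sym : ∀ a b : ℝ, (∫ t in (-b)..(-a), h t ^ 2) + ∫ t in a..b, h t ^ 2 =
      (modeForm 1 k b A C - modeForm 1 k a A C) +
        (modeForm (-1) k b B D - modeForm (-1) k a B D) := by
    intro a b
    rw [← intervalIntegral.integral_comp_neg (fun t => h t ^ 2),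
      ← integral_cosh_form hk0, ← integral_sinh_form hk0,
      ← intervalIntegral.integral_add, ← intervalIntegral.integral_add]
    · congr 1
      ext t
      simp only [hh, mul_neg, cosh_neg, sinh_neg]
      ring
    all_goals exact (by fun_prop : Continuous _).intervalIntegrable _ _
  have h1 := sym 0 1.5
  have h2 := sym 1.5 4.4
  rw [neg_zero, integral_add_adjacent_intervals (hi _ _) (hi _ _)] at h1
  simp only [modeForm_zero] at h1
  rw [h1, h2]
  have g1 := modeForm_growth (Or.inl rfl : (1 : ℝ) = 1 ∨ _) k hk A C
  have g2 := modeForm_growth (Or.inr rfl : (-1 : ℝ) = 1 ∨ _) k hk B D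
  linarith

/-- A first order linear equation has a solution on `[-ρ, ρ]` bounded by the `L¹` norm of the
right-hand side, uniformly in the coefficient. -/
lemma exists_firstOrder_solution (a : ℝ) {f : ℝ → ℝ} (hf : Continuous f) {ρ : ℝ} :
    ∃ y : ℝ → ℝ, (∀ t, HasDerivAt y (a * y t + f t) t) ∧
      ∀ t ∈ Set.Icc (-ρ) ρ, |y t| ≤ ∫ s in (-ρ)..ρ, |f s| := by
  have hc : Continuous fun s => exp (-(a * s)) * f s := by fun_prop
  have hder : ∀ b t, HasDerivAt (fun t => exp (a * t) * ∫ s in b..t, exp (-(a * s)) * f s)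
      (a * (exp (a * t) * ∫ s in b..t, exp (-(a * s)) * f s) + f t) t := by
    intro b t
    have h1 := ((hasDerivAt_id t).const_mul a).exp
    have h2 := integral_hasDerivAt_right (hc.intervalIntegrable b t)
      (hc.stronglyMeasurableAtFilter _ _) hc.continuousAt
    refine (h1.mul h2).congr_deriv ?_
    simp only [id, mul_one]
    have : exp (a * t) * exp (-(a * t)) = 1 := by rw [← exp_add]; simp
    linear_combination f t * this
  have hi : ∀ b c, IntervalIntegrable (fun s => |f s|) volume b c := fun b c =>
    hf.abs.intervalIntegrable _ _
  have mono : ∀ b c, -ρ ≤ b → b ≤ c → c ≤ ρ → ∫ s in b..c, |f s| ≤ ∫ s in (-ρ)..ρ, |f s| := by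
    intro b c h1 h2 h3
    exact integral_mono_interval h1 h2 h3 (Filter.Eventually.of_forall fun _ => abs_nonneg _)
      (hi _ _)
  have bd : ∀ t s, a * (t - s) ≤ 0 → ‖exp (a * t) * (exp (-(a * s)) * f s)‖ ≤ |f s| := by
    intro t s h
    rw [← mul_assoc, ← exp_add, norm_mul, norm_of_nonneg (exp_pos _).le, norm_eq_abs]
    refine mul_le_of_le_one_left (abs_nonneg _) (exp_le_one_iff.2 ?_)
    linarith
  rcases le_total 0 a with ha | ha
  · refine ⟨_, hder ρ, fun t ht => ?_⟩
    rw [integral_symm, mul_neg, abs_neg, ← intervalIntegral.integral_const_mul]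
    refine le_trans ?_ (mono t ρ ht.1 ht.2 le_rfl)
    rw [← norm_eq_abs]
    refine norm_integral_le_of_norm_le ht.2 (Filter.Eventually.of_forall fun s hs => ?_) (hi _ _)
    exact bd t s (mul_nonpos_of_nonneg_of_nonpos ha (by linarith [hs.1]))
  · refine ⟨_, hder (-ρ), fun t ht => ?_⟩
    rw [← intervalIntegral.integral_const_mul]
    refine le_trans ?_ (mono (-ρ) t le_rfl ht.1 ht.2)
    rw [← norm_eq_abs]
    refine norm_integral_le_of_norm_le ht.1 (Filter.Eventually.of_forall fun s hs => ?_) (hi _ _)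
    exact bd t s (mul_nonpos_of_nonpos_of_nonneg ha (by linarith [hs.2]))

lemma eq_exp_of_hasDerivAt {a : ℝ} {y : ℝ → ℝ} (h : ∀ t, HasDerivAt y (a * y t) t) :
    ∃ c, ∀ t, y t = c * exp (a * t) := by
  refine ⟨y 0, fun t => ?_⟩
  have h1 : ∀ t, HasDerivAt (fun t => y t * exp (-(a * t))) 0 t := by
    intro t
    have h2 := ((hasDerivAt_id t).const_mul a).neg.exp
    refine ((h t).mul h2).congr_deriv ?_
    simp only [id, Pi.neg_apply]
    ring
  have h2 := is_const_of_deriv_eq_zero (fun t => (h1 t).differentiableAt)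
    (fun t => (h1 t).deriv) t 0
  simp only [mul_zero, neg_zero, exp_zero, mul_one] at h2
  rw [← h2, mul_assoc, ← exp_add]
  simp

lemma eq_exp_add_of_hasDerivAt {a b₁ b₂ b₃ : ℝ} (c₁ c₂ c₃ : ℝ) {y : ℝ → ℝ}
    (h₁ : b₁ ≠ a) (h₂ : b₂ ≠ a) (h₃ : b₃ ≠ a)
    (h : ∀ t, HasDerivAt y
      (a * y t + (c₁ * exp (b₁ * t) + c₂ * exp (b₂ * t) + c₃ * exp (b₃ * t))) t) :
    ∃ c d₁ d₂ d₃, ∀ t, y t =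
      c * exp (a * t) + d₁ * exp (b₁ * t) + d₂ * exp (b₂ * t) + d₃ * exp (b₃ * t) := by
  have key := eq_exp_of_hasDerivAt (a := a) (y := fun t => y t - (c₁ / (b₁ - a) * exp (b₁ * t) +
    c₂ / (b₂ - a) * exp (b₂ * t) + c₃ / (b₃ - a) * exp (b₃ * t))) fun t => by
      have e : ∀ b c, HasDerivAt (fun t => c / (b - a) * exp (b * t))
          (c / (b - a) * (exp (b * t) * (b * 1))) t := fun b c =>
        (((hasDerivAt_id t).const_mul b).exp).const_mul _
      refine ((h t).sub (((e b₁ c₁).add (e b₂ c₂)).add (e b₃ c₃))).congr_deriv ?_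
      have := sub_ne_zero.2 h₁
      have := sub_ne_zero.2 h₂
      have := sub_ne_zero.2 h₃
      field_simp
      ring
  obtain ⟨c, hc⟩ := key
  exact ⟨c, c₁ / (b₁ - a), c₂ / (b₂ - a), c₃ / (b₃ - a), fun t => by linarith [hc t]⟩

lemma homogeneous_solution (k : ℕ) (hk : 1 ≤ k) {h h₁ h₂ h₃ : ℝ → ℝ}
    (d₃ : ∀ t, HasDerivAt h₃ (((k : ℝ) + 2) * h₃ t) t)
    (d₂ : ∀ t, HasDerivAt h₂ (-(k : ℝ) * h₂ t + h₃ t) t)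
    (d₁ : ∀ t, HasDerivAt h₁ (-((k : ℝ) + 2) * h₁ t + h₂ t) t)
    (d₀ : ∀ t, HasDerivAt h ((k : ℝ) * h t + h₁ t) t) :
    ∃ A B C D : ℝ, ∀ t, h t = (A * cosh (k * t) + C * cosh ((k + 2) * t)) +
      (B * sinh (k * t) + D * sinh ((k + 2) * t)) := by
  have hk0 : (0 : ℝ) < k := by exact_mod_cast hk
  obtain ⟨c₃, e₃⟩ := eq_exp_of_hasDerivAt d₃
  obtain ⟨c₂, p₂, q₂, r₂, e₂⟩ := eq_exp_add_of_hasDerivAt (a := -(k : ℝ)) (b₁ := k + 2)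
    (b₂ := k + 2) (b₃ := k + 2) c₃ 0 0 (by linarith) (by linarith) (by linarith)
    (fun t => (d₂ t).congr_deriv (by rw [e₃]; ring))
  obtain ⟨c₁, p₁, q₁, r₁, e₁⟩ := eq_exp_add_of_hasDerivAt (a := -((k : ℝ) + 2)) (b₁ := k + 2)
    (b₂ := -k) (b₃ := k + 2) (p₂ + q₂ + r₂) c₂ 0 (by linarith) (by linarith) (by linarith)
    (fun t => (d₁ t).congr_deriv (by rw [e₂]; ring))
  obtain ⟨c₀, p₀, q₀, r₀, e₀⟩ := eq_exp_add_of_hasDerivAt (a := (k : ℝ)) (b₁ := k + 2)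
    (b₂ := -k) (b₃ := -((k : ℝ) + 2)) (p₁ + r₁) q₁ c₁ (by linarith) (by linarith) (by linarith)
    (fun t => (d₀ t).congr_deriv (by rw [e₁]; ring))
  refine ⟨c₀ + q₀, c₀ - q₀, p₀ + r₀, p₀ - r₀, fun t => ?_⟩
  rw [e₀, neg_mul, neg_mul, ← cosh_add_sinh, ← cosh_add_sinh, ← cosh_add_sinh, ← cosh_add_sinh]
  simp only [cosh_neg, sinh_neg]
  ring

/-- The three-interval estimate for the radial ordinary differential equation satisfied by a
spherical mode of degree `k ≥ 1`, with an inhomogeneity. -/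
lemma mode_estimate (k : ℕ) (hk : 1 ≤ k) {v v' w w' g : ℝ → ℝ}
    (hv : ∀ t, HasDerivAt v (v' t) t)
    (hv' : ∀ t, HasDerivAt v' (w t - 2 * v' t + k * (k + 2) * v t) t)
    (hw : ∀ t, HasDerivAt w (w' t) t)
    (hw' : ∀ t, HasDerivAt w' (g t + 2 * w' t + k * (k + 2) * w t) t)
    (hg : Continuous g) :
    45 * ∫ t in (-1.5)..1.5, v t ^ 2 ≤
      (∫ t in (-4.4)..(-1.5), v t ^ 2) + (∫ t in (1.5)..4.4, v t ^ 2) +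
        1050 * 8.8 ^ 8 * ∫ t in (-4.4)..4.4, g t ^ 2 := by
  have cont : ∀ {y y' : ℝ → ℝ}, (∀ t, HasDerivAt y (y' t) t) → Continuous y := fun h =>
    continuous_iff_continuousAt.2 fun t => (h t).continuousAt
  obtain ⟨y₃, dy₃, b₃⟩ := exists_firstOrder_solution ((k : ℝ) + 2) hg (ρ := 4.4)
  obtain ⟨y₂, dy₂, b₂⟩ := exists_firstOrder_solution (-(k : ℝ)) (cont dy₃) (ρ := 4.4)
  obtain ⟨y₁, dy₁, b₁⟩ := exists_firstOrder_solution (-((k : ℝ) + 2)) (cont dy₂) (ρ := 4.4)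
  obtain ⟨p, dp, b₀⟩ := exists_firstOrder_solution (k : ℝ) (cont dy₁) (ρ := 4.4)
  obtain ⟨A, B, C, D, hh⟩ := homogeneous_solution k hk
    (h := fun t => v t - p t) (h₁ := fun t => v' t - k * v t - y₁ t) (h₂ := fun t => w t - y₂ t)
    (h₃ := fun t => w' t + k * w t - y₃ t)
    (fun t => (((hw' t).add ((hw t).const_mul (k : ℝ))).sub (dy₃ t)).congr_deriv (by ring))
    (fun t => ((hw t).sub (dy₂ t)).congr_deriv (by ring))
    (fun t => (((hv' t).sub ((hv t).const_mul (k : ℝ))).sub (dy₁ t)).congr_deriv (by ring))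
    (fun t => ((hv t).sub (dp t)).congr_deriv (by ring))
  have growth := homogeneous_growth k hk A B C D _ hh
  have step : ∀ {f y : ℝ → ℝ} {M : ℝ}, Continuous f → (∀ t ∈ Set.Icc (-4.4) 4.4, |f t| ≤ M) →
      (∀ t ∈ Set.Icc (-4.4) 4.4, |y t| ≤ ∫ s in (-4.4)..4.4, |f s|) →
      ∀ t ∈ Set.Icc (-4.4) 4.4, |y t| ≤ 8.8 * M := by
    intro f y M hf h1 h2 t ht
    refine (h2 t ht).trans ?_
    calc ∫ s in (-4.4)..4.4, |f s| ≤ ∫ s in (-4.4)..4.4, M :=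
          integral_mono_on (by norm_num) (hf.abs.intervalIntegrable _ _) (by simp) h1
      _ = 8.8 * M := by rw [intervalIntegral.integral_const]; norm_num
  set I := ∫ s in (-4.4)..4.4, |g s| with hI
  have hp := step (cont dy₁) (step (cont dy₂) (step (cont dy₃) b₃ b₂) b₁) b₀
  have hI2 : I ^ 2 ≤ 8.8 * ∫ t in (-4.4)..4.4, g t ^ 2 := by
    have h0 : 0 ≤ ∫ t in (-4.4)..4.4, (|g t| - I / 8.8) ^ 2 :=
      integral_nonneg (by norm_num) fun t _ => by positivity
    have h1 : ∫ t in (-4.4)..4.4, (|g t| - I / 8.8) ^ 2 =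
        ∫ t in (-4.4)..4.4, (g t ^ 2 - 2 * (I / 8.8) * |g t| + (I / 8.8) ^ 2) := by
      congr 1; ext t; rw [← sq_abs (g t)]; ring
    have i1 : IntervalIntegrable (fun t => g t ^ 2) volume (-4.4) 4.4 :=
      (hg.pow 2).intervalIntegrable _ _
    have i2 : IntervalIntegrable (fun t => 2 * (I / 8.8) * |g t|) volume (-4.4) 4.4 :=
      (hg.abs.const_mul _).intervalIntegrable _ _
    rw [h1, intervalIntegral.integral_add (i1.sub i2) (by simp),
      intervalIntegral.integral_sub i1 i2, intervalIntegral.integral_const_mul, ← hI,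
      intervalIntegral.integral_const] at h0
    norm_num at h0 ⊢
    nlinarith
  have hv0 := cont hv
  have hp0 := cont dp
  have ii : ∀ {f : ℝ → ℝ}, Continuous f → ∀ a b, IntervalIntegrable (fun t => f t ^ 2) volume a b :=
    fun hf a b => (hf.pow 2).intervalIntegrable _ _
  have hh0 : Continuous fun t => v t - p t := hv0.sub hp0
  have comp : ∀ {f₁ f₂ f₃ : ℝ → ℝ}, Continuous f₁ → Continuous f₂ → Continuous f₃ →
      (∀ t, f₁ t ^ 2 ≤ 1.05 * f₂ t ^ 2 + 21 * f₃ t ^ 2) → ∀ a b, a ≤ b →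
      ∫ t in a..b, f₁ t ^ 2 ≤ 1.05 * (∫ t in a..b, f₂ t ^ 2) + 21 * ∫ t in a..b, f₃ t ^ 2 := by
    intro f₁ f₂ f₃ c₁ c₂ c₃ h a b hab
    rw [← intervalIntegral.integral_const_mul, ← intervalIntegral.integral_const_mul,
      ← intervalIntegral.integral_add ((ii c₂ a b).const_mul _) ((ii c₃ a b).const_mul _)]
    exact integral_mono_on hab (ii c₁ a b) (((ii c₂ a b).const_mul _).add ((ii c₃ a b).const_mul _))
      fun t _ => h t
  have e1 := comp hv0 hh0 hp0 (fun t => by nlinarith [sq_nonneg (v t - p t - 20 * p t)])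
    (-1.5) 1.5 (by norm_num)
  have e2 := fun a b hab => comp hh0 hv0 hp0
    (fun t => by nlinarith [sq_nonneg (v t + 20 * p t)]) a b hab
  have e3 := e2 (-4.4) (-1.5) (by norm_num)
  have e4 := e2 1.5 4.4 (by norm_num)
  have split : (∫ t in (-4.4)..(-1.5), p t ^ 2) + (∫ t in (-1.5)..1.5, p t ^ 2) +
      (∫ t in (1.5)..4.4, p t ^ 2) = ∫ t in (-4.4)..4.4, p t ^ 2 := by
    rw [integral_add_adjacent_intervals (ii hp0 _ _) (ii hp0 _ _),
      integral_add_adjacent_intervals (ii hp0 _ _) (ii hp0 _ _)]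
  have pn : ∀ a b : ℝ, a ≤ b → 0 ≤ ∫ t in a..b, p t ^ 2 := fun a b hab =>
    integral_nonneg hab fun t _ => sq_nonneg _
  have n1 := pn (-4.4) (-1.5) (by norm_num)
  have n2 := pn (-1.5) 1.5 (by norm_num)
  have n3 := pn 1.5 4.4 (by norm_num)
  have vn : ∀ a b : ℝ, a ≤ b → 0 ≤ ∫ t in a..b, v t ^ 2 := fun a b hab =>
    integral_nonneg hab fun t _ => sq_nonneg _
  have m1 := vn (-4.4) (-1.5) (by norm_num)
  have m2 := vn (-1.5) 1.5 (by norm_num)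
  have m3 := vn 1.5 4.4 (by norm_num)
  have hpI : ∫ t in (-4.4)..4.4, p t ^ 2 ≤ 8.8 ^ 7 * I ^ 2 := by
    calc ∫ t in (-4.4)..4.4, p t ^ 2 ≤ ∫ t in (-4.4)..4.4, (8.8 * (8.8 * (8.8 * I))) ^ 2 := by
          refine integral_mono_on (by norm_num) (ii hp0 _ _) (by simp) fun t ht => ?_
          rw [← sq_abs (p t)]
          exact pow_le_pow_left₀ (abs_nonneg _) (hp t ht) 2
      _ = 8.8 ^ 7 * I ^ 2 := by
          rw [intervalIntegral.integral_const, smul_eq_mul]; ring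
  linarith

end LinearODE

open scoped ContDiff InnerProductSpace

local notation "E4" => EuclideanSpace ℝ (Fin 4)
local notation "S3" => sphere (0 : EuclideanSpace ℝ (Fin 4)) 1
local notation "Poly" => MvPolynomial (Fin 4) ℝ

/-- The surface measure of the unit sphere. -/
def surf : Measure S3 := (volume : Measure E4).toSphere

instance : IsFiniteMeasure surf := by unfold surf; infer_instance

/-- The isometry of the sphere induced by a linear isometry. -/
def sphereIso (A : E4 ≃ₗᵢ[ℝ] E4) : S3 ≃ᵢ S3 where
  toFun θ := ⟨A θ, by simp⟩
  invFun θ := ⟨A.symm θ, by simp⟩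
  left_inv θ := by ext1; simp
  right_inv θ := by ext1; simp
  isometry_toFun := by
    intro x y
    exact A.isometry x y

open scoped Pointwise in
lemma surf_map_sphereIso (A : E4 ≃ₗᵢ[ℝ] E4) : surf.map (sphereIso A) = surf := by
  ext s hs
  have hm : Measurable (sphereIso A) := (sphereIso A).continuous.measurable
  rw [Measure.map_apply hm hs, surf, Measure.toSphere_apply' _ hs,
    Measure.toSphere_apply' _ (hm hs)]
  congr 1
  have : Set.Ioo (0 : ℝ) 1 • (Subtype.val '' (sphereIso A ⁻¹' s)) =
      A.toMeasurableEquiv ⁻¹' (Set.Ioo (0 : ℝ) 1 • (Subtype.val '' s)) := by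
    ext x
    simp only [Set.mem_smul, Set.mem_image, Set.mem_preimage, Subtype.exists, exists_and_right,
      exists_eq_right]
    constructor
    · rintro ⟨r, hr, y, ⟨hy, hys⟩, rfl⟩
      exact ⟨r, hr, A y, ⟨by simpa using hy, hys⟩, by simp⟩
    · rintro ⟨r, hr, y, ⟨hy, hys⟩, h⟩
      refine ⟨r, hr, A.symm y, ⟨by simpa using hy, ?_⟩, ?_⟩
      · convert hys using 1
        exact Subtype.ext (A.apply_symm_apply y)
      · rw [← map_smul, h]; simp
  rw [this]
  exact A.measurePreserving.measure_preimage_equiv (f := A.toMeasurableEquiv) _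

lemma hausdorff_map_sphereIso (A : E4 ≃ₗᵢ[ℝ] E4) :
    (μH[3] : Measure S3).map (sphereIso A) = μH[3] :=
  (sphereIso A).map_hausdorffMeasure 3

open Quaternion in
/-- Left multiplication by a unit quaternion, as an isometry of `ℝ⁴`. -/
def quatIso (q : sphere (0 : ℍ[ℝ]) 1) : E4 ≃ₗᵢ[ℝ] E4 :=
  (Quaternion.linearIsometryEquivTuple.symm.trans
    { toFun := fun x => q * x
      invFun := fun x => (q⁻¹ : sphere (0 : ℍ[ℝ]) 1) * x
      map_add' := fun x y => mul_add _ _ _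
      map_smul' := fun c x => by simp
      left_inv := fun x => by
        simp [inv_mul_cancel_left₀ (ne_zero_of_mem_unit_sphere q)]
      right_inv := fun x => by
        simp [mul_inv_cancel_left₀ (ne_zero_of_mem_unit_sphere q)]
      norm_map' := fun x => by simp }).trans Quaternion.linearIsometryEquivTuple

open Quaternion in
/-- Measures on the unit sphere invariant under isometries are proportional. -/
lemma eq_smul_surf (ν : Measure S3) [IsFiniteMeasure ν]
    (hν : ∀ A : E4 ≃ₗᵢ[ℝ] E4, ν.map (sphereIso A) = ν) : ∃ c : NNReal, ν = c • surf := by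
  let : MeasurableSpace ℍ[ℝ] := borel _
  have : BorelSpace ℍ[ℝ] := ⟨rfl⟩
  have : CompactSpace (sphere (0 : ℍ[ℝ]) 1) := isCompact_iff_compactSpace.1 (isCompact_sphere _ _)
  let e := Quaternion.linearIsometryEquivTuple
  let φ : S3 ≃ₜ sphere (0 : ℍ[ℝ]) 1 :=
    { toFun := fun θ => ⟨e.symm θ, by simp⟩
      invFun := fun θ => ⟨e θ, by simp⟩
      left_inv := fun θ => by ext1; simp
      right_inv := fun θ => by ext1; simp
      continuous_toFun := by fun_prop
      continuous_invFun := by fun_prop }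
  have inv : ∀ μ : Measure S3, (∀ A : E4 ≃ₗᵢ[ℝ] E4, μ.map (sphereIso A) = μ) →
      (μ.map φ).IsMulLeftInvariant := by
    intro μ hμ
    refine ⟨fun q => ?_⟩
    conv_rhs => rw [← hμ (quatIso q)]
    rw [Measure.map_map (by fun_prop) φ.continuous.measurable,
      Measure.map_map φ.continuous.measurable (sphereIso _).continuous.measurable]
    congr 1
  have := inv surf surf_map_sphereIso
  have := inv ν hν
  have : IsFiniteMeasure (surf.map φ) := Measure.isFiniteMeasure_map _ _
  have : IsFiniteMeasure (ν.map φ) := Measure.isFiniteMeasure_map _ _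
  have : (surf.map φ).IsHaarMeasure := by
    refine Measure.isHaarMeasure_of_isCompact_nonempty_interior _ Set.univ isCompact_univ
      (by simp) ?_ (measure_ne_top _ _)
    rw [Measure.map_apply φ.continuous.measurable .univ, Set.preimage_univ]
    exact Measure.measure_univ_ne_zero.2 (Measure.toSphere_ne_zero _)
  have h := Measure.isMulInvariant_eq_smul_of_compactSpace (ν.map φ) (surf.map φ)
  refine ⟨Measure.haarScalarFactor (ν.map φ) (surf.map φ),
    φ.toMeasurableEquiv.map_measurableEquiv_injective ?_⟩
  refine Eq.trans h ?_
  exact (Measure.map_smul _ _ _).symm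

/-- Hopf coordinates on the unit sphere. -/
def hopf (p : Fin 3 → ℝ) : E4 :=
  !₂[Real.cos (p 0) * Real.cos (p 1), Real.cos (p 0) * Real.sin (p 1),
    Real.sin (p 0) * Real.cos (p 2), Real.sin (p 0) * Real.sin (p 2)]

lemma hopf_contDiff : ContDiff ℝ 1 hopf := by
  rw [contDiff_euclidean]
  intro i
  fin_cases i <;> simp [hopf] <;> fun_prop

lemma sphere_subset_hopf : S3 ⊆ hopf '' closedBall 0 4 := by
  intro x hx
  have hx1 : x 0 ^ 2 + x 1 ^ 2 + x 2 ^ 2 + x 3 ^ 2 = 1 := by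
    have h := EuclideanSpace.real_norm_sq_eq x
    rw [mem_sphere_zero_iff_norm.1 hx, Fin.sum_univ_four] at h
    linarith
  set z : ℂ := ⟨x 0, x 1⟩ with hz
  set w : ℂ := ⟨x 2, x 3⟩ with hw
  have hzw : ‖z‖ ^ 2 + ‖w‖ ^ 2 = 1 := by
    rw [Complex.sq_norm, Complex.sq_norm, Complex.normSq_apply, Complex.normSq_apply]
    simp only [hz, hw]
    linarith
  set q : ℂ := ⟨‖z‖, ‖w‖⟩ with hq
  have hqn : ‖q‖ = 1 := by
    have : ‖q‖ ^ 2 = 1 := by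
      rw [Complex.sq_norm, Complex.normSq_apply]; simp only [hq]; linarith
    nlinarith [norm_nonneg q]
  have bd : ∀ u : ℂ, |Complex.arg u| ≤ 4 := fun u =>
    (Complex.abs_arg_le_pi u).trans Real.pi_lt_four.le
  refine ⟨![q.arg, z.arg, w.arg], ?_, ?_⟩
  · rw [mem_closedBall_zero_iff, pi_norm_le_iff_of_nonneg (by norm_num)]
    intro i
    fin_cases i <;> simpa using bd _
  · have c1 : Real.cos q.arg = ‖z‖ := by
      have := Complex.norm_mul_cos_arg q; rw [hqn, one_mul] at this; exact this
    have c2 : Real.sin q.arg = ‖w‖ := by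
      have := Complex.norm_mul_sin_arg q; rw [hqn, one_mul] at this; exact this
    ext i
    fin_cases i
    · simp [hopf, c1, c2]; rfl
    · simp [hopf, c1, c2]; rfl
    · simp [hopf, c1, c2]; rfl
    · simp [hopf, c1, c2]; rfl

lemma hausdorff_sphere_lt_top : μH[3] (S3 : Set E4) < ⊤ := by
  obtain ⟨C, hC⟩ := (hopf_contDiff.locallyLipschitz.locallyLipschitzOn
    (s := closedBall 0 4)).exists_lipschitzOnWith_of_compact (isCompact_closedBall _ _)
  have h3 : (μH[3] : Measure (Fin 3 → ℝ)) = volume := by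
    have := hausdorffMeasure_pi_real (ι := Fin 3)
    simpa using this
  refine (measure_mono sphere_subset_hopf).trans_lt
    ((hC.hausdorffMeasure_image_le (by norm_num)).trans_lt ?_)
  rw [h3]
  exact ENNReal.mul_lt_top (by simp) measure_closedBall_lt_top

lemma hausdorff_sphere_pos : 0 < μH[3] (S3 : Set E4) := by
  have h3 : (μH[3] : Measure (Fin 3 → ℝ)) = volume := by
    have := hausdorffMeasure_pi_real (ι := Fin 3)
    simpa using this
  let P : E4 → Fin 3 → ℝ := fun x i => x i.castSucc
  have hP : LipschitzWith 1 P := by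
    refine LipschitzWith.of_dist_le_mul fun x y => ?_
    rw [NNReal.coe_one, one_mul, dist_pi_le_iff dist_nonneg]
    intro i
    rw [dist_eq_norm, dist_eq_norm]
    exact PiLp.norm_apply_le (x - y) i.castSucc
  have hsub : closedBall 0 (1 / 2) ⊆ P '' S3 := by
    intro p hp
    have hb : ∀ i, p i ^ 2 ≤ 1 / 4 := by
      intro i
      have := (norm_le_pi_norm p i).trans (mem_closedBall_zero_iff.1 hp)
      rw [← sq_abs, ← Real.norm_eq_abs]
      nlinarith [norm_nonneg (p i)]
    refine ⟨!₂[p 0, p 1, p 2, √(1 - p 0 ^ 2 - p 1 ^ 2 - p 2 ^ 2)], ?_, ?_⟩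
    · rw [mem_sphere_zero_iff_norm, ← sq_eq_sq₀ (norm_nonneg _) zero_le_one,
        EuclideanSpace.real_norm_sq_eq, Fin.sum_univ_four]
      have := Real.sq_sqrt (show 0 ≤ 1 - p 0 ^ 2 - p 1 ^ 2 - p 2 ^ 2 by
        linarith [hb 0, hb 1, hb 2])
      simp [this]
    · ext i
      fin_cases i <;> simp [P]
  have h := (measure_mono hsub).trans (hP.hausdorffMeasure_image_le (d := 3) (by norm_num) S3)
  rw [h3] at h
  have hpos : 0 < volume (closedBall (0 : Fin 3 → ℝ) (1 / 2)) :=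
    measure_closedBall_pos _ _ (by norm_num)
  simpa using hpos.trans_le h

/-- Surface measure is a multiple of Hausdorff measure on the unit sphere. -/
lemma exists_hausdorff_eq_smul_surf :
    ∃ c : NNReal, c ≠ 0 ∧ (μH[3] : Measure S3) = c • surf := by
  have huniv : (μH[3] : Measure S3) Set.univ = μH[3] (S3 : Set E4) := by
    rw [← isometry_subtype_coe.hausdorffMeasure_image (Or.inl (by norm_num)), Set.image_univ,
      Subtype.range_coe]
  have : IsFiniteMeasure (μH[3] : Measure S3) := ⟨by rw [huniv]; exact hausdorff_sphere_lt_top⟩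
  obtain ⟨c, hc⟩ := eq_smul_surf μH[3] hausdorff_map_sphereIso
  refine ⟨c, ?_, hc⟩
  rintro rfl
  rw [zero_smul] at hc
  rw [hc] at huniv
  exact hausdorff_sphere_pos.ne huniv

open scoped Pointwise in
/-- Integration over the sphere of radius `r` in terms of the surface measure. -/
lemma exists_setIntegral_sphere_eq :
    ∃ c : ℝ, 0 < c ∧ ∀ {V : Type} [NormedAddCommGroup V] [NormedSpace ℝ V] (r : ℝ), 0 < r →
      ∀ g : E4 → V, ∫ y in sphere (0 : E4) r, g y ∂μH[3] =
        (c * r ^ 3) • ∫ θ, g (r • (θ : E4)) ∂surf := by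
  obtain ⟨c, hc, h⟩ := exists_hausdorff_eq_smul_surf
  refine ⟨c, by positivity, fun {V} _ _ r hr g => ?_⟩
  have e1 : ∫ θ, g (r • (θ : E4)) ∂(μH[3] : Measure S3) = (c : ℝ) • ∫ θ, g (r • (θ : E4)) ∂surf := by
    rw [h, integral_smul_nnreal_measure]; rfl
  have hs : MeasurableSet (S3 : Set E4) := isClosed_sphere.measurableSet
  have e2 : ∫ θ, g (r • (θ : E4)) ∂(μH[3] : Measure S3) = ∫ y in S3, g (r • y) ∂μH[3] := by
    have h2 := isometry_subtype_coe.map_hausdorffMeasure (X := S3) (d := 3)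
      (Or.inl (by norm_num))
    rw [Subtype.range_coe] at h2
    rw [← h2, (MeasurableEmbedding.subtype_coe hs).integral_map]
  have hme : MeasurableEmbedding fun y : E4 => r • y :=
    (Homeomorph.smulOfNeZero r hr.ne').measurableEmbedding
  have e3 : (μH[3] : Measure E4) =
      ENNReal.ofReal (r ^ 3) • (μH[3] : Measure E4).map (fun y => r • y) := by
    ext s hsm
    rw [Measure.smul_apply, hme.map_apply]
    have h1 : s = r • ((fun y : E4 => r • y) ⁻¹' s) := by
      rw [Set.preimage_smul₀ hr.ne', smul_inv_smul₀ hr.ne']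
    conv_lhs => rw [h1, Measure.hausdorffMeasure_smul₀ (by norm_num) hr.ne']
    rw [ENNReal.smul_def, show ((3 : ℝ)) = ((3 : ℕ) : ℝ) by norm_num, NNReal.rpow_natCast]
    congr 1
    rw [ENNReal.ofReal_pow hr.le, ENNReal.coe_pow, ← Real.enorm_of_nonneg hr.le]
    rfl
  have hpre : (fun y : E4 => r • y) ⁻¹' sphere 0 r = S3 := by
    ext y
    simp only [Set.mem_preimage, mem_sphere_zero_iff_norm, norm_smul, Real.norm_of_nonneg hr.le]
    constructor
    · intro h
      exact mul_left_cancel₀ hr.ne' (by linarith)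
    · intro h; rw [h, mul_one]
  conv_lhs => rw [e3]
  rw [Measure.restrict_smul, hme.restrict_map, hpre, integral_smul_measure, hme.integral_map, ← e2,
    e1, smul_smul, ENNReal.toReal_ofReal (by positivity), mul_comm]

lemma surf_univ_pos : 0 < surf.real Set.univ := by
  have h : surf Set.univ ≠ 0 := Measure.measure_univ_ne_zero.2 (Measure.toSphere_ne_zero _)
  exact ENNReal.toReal_pos h (measure_ne_top _ _)

/-- The spherical average in terms of the surface measure on the unit sphere. -/
lemma sphereAvg_eq {V : Type} [NormedAddCommGroup V] [NormedSpace ℝ V] {r : ℝ} (hr : 0 < r)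
    (g : E4 → V) :
    sphereAvg r g = (surf.real Set.univ)⁻¹ • ∫ θ, g (r • (θ : E4)) ∂surf := by
  obtain ⟨c, hc, h⟩ := exists_setIntegral_sphere_eq
  have h1 := h (V := ℝ) r hr (fun _ => 1)
  simp only [integral_const, smul_eq_mul, mul_one, measureReal_restrict_apply_univ] at h1
  rw [sphereAvg, h r hr g, smul_smul]
  congr 1
  change ((μH[3] : Measure E4).real _)⁻¹ * _ = _
  rw [h1]
  have := surf_univ_pos
  field_simp

lemma integral_surf_eq_zero {V : Type} [NormedAddCommGroup V] [NormedSpace ℝ V] {r : ℝ}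
    (hr : 0 < r) {g : E4 → V} (hg : ∫ y in sphere (0 : E4) r, g y ∂μH[3] = 0) :
    ∫ θ, g (r • (θ : E4)) ∂surf = 0 := by
  obtain ⟨c, hc, h⟩ := exists_setIntegral_sphere_eq
  rw [h r hr g] at hg
  exact (smul_eq_zero.1 hg).resolve_left (by positivity)

/-- Integrals over the unit sphere are invariant under linear isometries. -/
lemma integral_comp_isometry (A : E4 ≃ₗᵢ[ℝ] E4) {V : Type} [NormedAddCommGroup V]
    [NormedSpace ℝ V] (f : E4 → V) :
    ∫ θ, f (A (θ : E4)) ∂surf = ∫ θ, f (θ : E4) ∂surf := by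
  conv_rhs => rw [← surf_map_sphereIso A]
  have h : MeasurableEmbedding (sphereIso A) :=
    (sphereIso A).toHomeomorph.measurableEmbedding
  rw [h.integral_map]
  rfl

/-- The closed annulus with logarithmic radii `a` and `b`. -/
def ann (a b : ℝ) : Set E4 := {x | Real.exp a ≤ ‖x‖ ∧ ‖x‖ ≤ Real.exp b}

lemma ann_isCompact (a b : ℝ) : IsCompact (ann a b) := by
  refine (isCompact_closedBall (0 : E4) (Real.exp b)).of_isClosed_subset ?_ ?_
  · exact (isClosed_le continuous_const continuous_norm).inter
      (isClosed_le continuous_norm continuous_const)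
  · intro x hx
    simpa using hx.2

lemma exp_smul_mem_ann {a b t : ℝ} (θ : S3) :
    Real.exp t • (θ : E4) ∈ ann a b ↔ t ∈ Set.Icc a b := by
  simp [ann, norm_smul]

/-- Integration in logarithmic polar coordinates. -/
lemma integral_polar {F : E4 → ℝ} (hF : Integrable F) :
    ∫ x, F x = ∫ t : ℝ, Real.exp (4 * t) * ∫ θ, F (Real.exp t • (θ : E4)) ∂surf := by
  have hd : Module.finrank ℝ E4 - 1 = 3 := by simp
  have mp := (volume : Measure E4).measurePreserving_homeomorphUnitSphereProd
  rw [hd] at mp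
  have hs : MeasurableSet ({0}ᶜ : Set E4) := (measurableSet_singleton _).compl
  let G : S3 × Set.Ioi (0 : ℝ) → ℝ := fun p => F ((p.2 : ℝ) • (p.1 : E4))
  have hG : ∀ x : ({0}ᶜ : Set E4), G (homeomorphUnitSphereProd E4 x) = F x := by
    intro x
    have hx : ‖(x : E4)‖ ≠ 0 := norm_ne_zero_iff.2 x.2
    simp [G, smul_smul, mul_inv_cancel₀ hx]
  have hGi : Integrable G (surf.prod (Measure.volumeIoiPow 3)) := by
    have := (mp.integrable_comp_emb (Homeomorph.measurableEmbedding _) (g := G)).1 (by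
      have h : G ∘ homeomorphUnitSphereProd E4 = fun x : ({0}ᶜ : Set E4) => F x := funext hG
      rw [h]
      exact (MeasurableEmbedding.subtype_coe hs).integrable_map_iff.1
        (by rw [map_comap_subtype_coe hs]; exact hF.restrict))
    exact this
  have h1 : ∫ x, F x = ∫ r, ∫ θ, G (θ, r) ∂surf ∂(Measure.volumeIoiPow 3) := by
    rw [← integral_prod_symm _ hGi]
    have h2 := mp.integral_comp (Homeomorph.measurableEmbedding _) G
    refine Eq.trans ?_ h2
    simp_rw [hG]
    rw [integral_subtype_comap hs (fun x => F x), restrict_compl_singleton]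
  rw [h1]
  let H : ℝ → ℝ := fun r => ∫ θ, F (r • (θ : E4)) ∂surf
  have h3 : ∫ r, ∫ θ, G (θ, r) ∂surf ∂(Measure.volumeIoiPow 3) =
      ∫ r in Set.Ioi (0 : ℝ), r ^ 3 * H r := by
    simp only [Measure.volumeIoiPow, ENNReal.ofReal]
    rw [integral_withDensity_eq_integral_smul (by fun_prop)]
    rw [← integral_subtype_comap measurableSet_Ioi (fun r : ℝ => r ^ 3 * H r)]
    refine integral_congr_ae (ae_of_all _ fun r => ?_)
    have hr : (0 : ℝ) < r := r.2
    simp only [NNReal.smul_def, smul_eq_mul, H, G]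
    rw [Real.coe_toNNReal _ (by positivity)]
  rw [h3, ← Real.range_exp, ← Set.image_univ, integral_image_eq_integral_abs_deriv_smul
    MeasurableSet.univ (fun x _ => (Real.hasDerivAt_exp x).hasDerivWithinAt)
    Real.exp_injective.injOn, setIntegral_univ]
  refine integral_congr_ae (ae_of_all _ fun t => ?_)
  simp only [Real.abs_exp, smul_eq_mul, H]
  rw [← mul_assoc]
  congr 1
  rw [← Real.exp_nat_mul, ← Real.exp_add]
  congr 1
  push_cast; ring

lemma integral_ann {F : E4 → ℝ} {a b : ℝ} (hab : a ≤ b) (hF : ContinuousOn F (ann a b)) :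
    ∫ x in ann a b, F x =
      ∫ t in a..b, Real.exp (4 * t) * ∫ θ, F (Real.exp t • (θ : E4)) ∂surf := by
  have hm := (ann_isCompact a b).measurableSet
  rw [← integral_indicator hm, integral_polar
    ((integrable_indicator_iff hm).2 (hF.integrableOn_compact (ann_isCompact a b))),
    intervalIntegral.integral_of_le hab, ← integral_Icc_eq_integral_Ioc,
    ← integral_indicator measurableSet_Icc]
  refine integral_congr_ae (ae_of_all _ fun t => ?_)
  simp only [Set.indicator, exp_smul_mem_ann]
  split_ifs <;> simp

lemma integral_ann_div {F : E4 → ℝ} {a b : ℝ} (hab : a ≤ b) (hF : ContinuousOn F (ann a b)) :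
    ∫ x in ann a b, F x / ‖x‖ ^ 4 =
      ∫ t in a..b, ∫ θ, F (Real.exp t • (θ : E4)) ∂surf := by
  rw [integral_ann hab]
  · congr 1; ext t
    rw [← integral_const_mul]
    congr 1; ext θ
    have : ‖(θ : E4)‖ = 1 := by simp
    rw [norm_smul, this, mul_one, Real.norm_of_nonneg (Real.exp_pos _).le, ← Real.exp_nat_mul]
    push_cast
    field_simp
  · refine hF.div (by fun_prop) fun x hx => ?_
    have := (Real.exp_pos a).trans_le hx.1
    positivity

/-- Integrals over concentric spheres depend continuously on the radius. -/
lemma continuousOn_sphere_integral {V : Type} [NormedAddCommGroup V] [NormedSpace ℝ V]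
    {F : E4 → V} {a b : ℝ} (hF : ContinuousOn F (ann a b)) :
    ContinuousOn (fun t => ∫ θ, F (Real.exp t • (θ : E4)) ∂surf) (Set.Icc a b) := by
  have : CompactSpace S3 := isCompact_iff_compactSpace.1 (isCompact_sphere _ _)
  have h := continuousOn_integral_of_compact_support (μ := surf)
    (f := fun (t : ℝ) (θ : S3) => F (Real.exp t • (θ : E4))) (s := Set.Icc a b) (k := Set.univ)
    isCompact_univ ?_ (by simp)
  · exact h
  · exact hF.comp (by fun_prop) fun p hp => (exp_smul_mem_ann p.2).2 hp.1

instance : CompactSpace S3 := isCompact_iff_compactSpace.1 (isCompact_sphere _ _)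

/-- Left multiplication by the imaginary quaternion units on `ℝ⁴`. -/
def J (a : Fin 3) : E4 →L[ℝ] E4 :=
  LinearMap.toContinuousLinearMap
    { toFun := fun x => ![!₂[-x 1, x 0, -x 3, x 2], !₂[-x 2, x 3, x 0, -x 1],
        !₂[-x 3, -x 2, x 1, x 0]] a
      map_add' := fun x y => by
        fin_cases a <;> ext i <;> fin_cases i <;> simp <;> ring
      map_smul' := fun c x => by
        fin_cases a <;> ext i <;> fin_cases i <;> simp }

lemma J_zero (x : E4) : J 0 x = !₂[-x 1, x 0, -x 3, x 2] := rfl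
lemma J_one (x : E4) : J 1 x = !₂[-x 2, x 3, x 0, -x 1] := rfl
lemma J_two (x : E4) : J 2 x = !₂[-x 3, -x 2, x 1, x 0] := rfl

lemma J_J (a : Fin 3) (x : E4) : J a (J a x) = -x := by
  fin_cases a <;> ext i <;> fin_cases i <;> simp [J_zero, J_one, J_two]

/-- The one-parameter group of rotations generated by `J a`. -/
def rot (a : Fin 3) (s : ℝ) : E4 ≃ₗᵢ[ℝ] E4 :=
  LinearIsometry.toLinearIsometryEquiv
    { toLinearMap := (Real.cos s • ContinuousLinearMap.id ℝ E4 + Real.sin s • J a : E4 →L[ℝ] E4)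
      norm_map' := fun x => by
        rw [← sq_eq_sq₀ (norm_nonneg _) (norm_nonneg _), EuclideanSpace.real_norm_sq_eq,
          EuclideanSpace.real_norm_sq_eq, Fin.sum_univ_four, Fin.sum_univ_four]
        have := Real.sin_sq_add_cos_sq s
        fin_cases a <;> simp [J_zero, J_one, J_two] <;>
        linear_combination (x 0 ^ 2 + x 1 ^ 2 + x 2 ^ 2 + x 3 ^ 2) * this } rfl

/-- Derivative along the rotation field `J a`. -/
def XD (a : Fin 3) (f : E4 → ℝ) (x : E4) : ℝ := fderiv ℝ f x (J a x)

/-- Derivative along the Euler field. -/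
def Eul (f : E4 → ℝ) (x : E4) : ℝ := fderiv ℝ f x x

lemma contDiff_XD (a : Fin 3) {f : E4 → ℝ} (hf : ContDiff ℝ ∞ f) : ContDiff ℝ ∞ (XD a f) :=
  (hf.fderiv_right (m := ∞) (by simp)).clm_apply (J a).contDiff

lemma contDiff_Eul {f : E4 → ℝ} (hf : ContDiff ℝ ∞ f) : ContDiff ℝ ∞ (Eul f) :=
  (hf.fderiv_right (m := ∞) (by simp)).clm_apply contDiff_id

lemma lap_apply {V : Type*} [NormedAddCommGroup V] [NormedSpace ℝ V] (f : E4 → V) (x : E4) :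
    lap f x = ∑ i : Fin 4, fderiv ℝ (fderiv ℝ f) x (EuclideanSpace.single i 1)
      (EuclideanSpace.single i 1) := by
  simp [lap, iteratedFDeriv_two_apply]

lemma contDiff_lap {f : E4 → ℝ} (hf : ContDiff ℝ ∞ f) : ContDiff ℝ ∞ (lap f) := by
  have h : lap f = fun x => ∑ i : Fin 4, fderiv ℝ (fderiv ℝ f) x (EuclideanSpace.single i 1)
      (EuclideanSpace.single i 1) := funext (lap_apply f)
  rw [h]
  refine ContDiff.sum fun i _ => ?_
  exact (((hf.fderiv_right (m := ∞) (by simp)).fderiv_right (m := ∞) (by simp)).clm_apply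
    contDiff_const).clm_apply contDiff_const

lemma XD_XD (a : Fin 3) {f : E4 → ℝ} (hf : ContDiff ℝ ∞ f) (x : E4) :
    XD a (XD a f) x = fderiv ℝ (fderiv ℝ f) x (J a x) (J a x) - fderiv ℝ f x x := by
  have h1 : DifferentiableAt ℝ (fderiv ℝ f) x :=
    (hf.fderiv_right (m := ∞) (by simp)).differentiable (by simp) x
  have h2 := (h1.hasFDerivAt.clm_apply (J a).hasFDerivAt).fderiv
  have h3 : XD a f = fun y => fderiv ℝ f y (J a y) := rfl
  rw [XD, h3, h2]
  simp [J_J]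
  ring

lemma Eul_Eul {f : E4 → ℝ} (hf : ContDiff ℝ ∞ f) (x : E4) :
    Eul (Eul f) x = fderiv ℝ (fderiv ℝ f) x x x + fderiv ℝ f x x := by
  have h1 : DifferentiableAt ℝ (fderiv ℝ f) x :=
    (hf.fderiv_right (m := ∞) (by simp)).differentiable (by simp) x
  have h2 := (h1.hasFDerivAt.clm_apply (hasFDerivAt_id x)).fderiv
  have h3 : Eul f = fun y => fderiv ℝ f y (id y) := rfl
  rw [Eul, h3, h2]
  simp [add_comm]

lemma eq_sum_single (x : E4) : x = ∑ i : Fin 4, x i • EuclideanSpace.single i (1 : ℝ) := by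
  ext j
  simp [Finset.sum_apply, Pi.single_apply]

lemma bilin_expand (B : E4 →L[ℝ] E4 →L[ℝ] ℝ) (x y : E4) :
    B x y = ∑ i : Fin 4, ∑ j : Fin 4, x i * y j *
      B (EuclideanSpace.single i 1) (EuclideanSpace.single j 1) := by
  conv_lhs => rw [eq_sum_single x, eq_sum_single y]
  simp only [map_sum, _root_.sum_apply, map_smul, _root_.smul_apply,
    smul_eq_mul, Finset.mul_sum]
  rw [Finset.sum_comm]
  refine Finset.sum_congr rfl fun i _ => Finset.sum_congr rfl fun j _ => ?_
  ring

/-- The Laplacian in terms of the Euler field and the rotation fields. -/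
lemma norm_sq_mul_lap {f : E4 → ℝ} (hf : ContDiff ℝ ∞ f) (x : E4) :
    ‖x‖ ^ 2 * lap f x = Eul (Eul f) x + 2 * Eul f x + ∑ a, XD a (XD a f) x := by
  rw [Eul_Eul hf]
  simp only [XD_XD _ hf, Fin.sum_univ_three, lap_apply, Eul]
  rw [EuclideanSpace.real_norm_sq_eq]
  set B := fderiv ℝ (fderiv ℝ f) x
  rw [bilin_expand B x x, bilin_expand B (J 0 x) (J 0 x), bilin_expand B (J 1 x) (J 1 x),
    bilin_expand B (J 2 x) (J 2 x)]
  simp only [Fin.sum_univ_four, J_zero, J_one, J_two]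
  simp
  ring

/-- Differentiation under the integral over the sphere. -/
lemma hasDerivAt_integral_surf {Φ Φ' : ℝ → S3 → ℝ} (hΦ : Continuous fun p : ℝ × S3 => Φ p.1 p.2)
    (hΦ' : Continuous fun p : ℝ × S3 => Φ' p.1 p.2)
    (h : ∀ s θ, HasDerivAt (fun s => Φ s θ) (Φ' s θ) s) (s : ℝ) :
    HasDerivAt (fun s => ∫ θ, Φ s θ ∂surf) (∫ θ, Φ' s θ ∂surf) s := by
  obtain ⟨C, hC⟩ := ((isCompact_closedBall s 1).prod (isCompact_univ (X := S3))).exists_bound_of_continuousOn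
    hΦ'.continuousOn
  have hc : ∀ r, Continuous (Φ r) := fun r => hΦ.comp (by fun_prop : Continuous fun θ : S3 => (r, θ))
  have hc' : ∀ r, Continuous (Φ' r) :=
    fun r => hΦ'.comp (by fun_prop : Continuous fun θ : S3 => (r, θ))
  refine (hasDerivAt_integral_of_dominated_loc_of_deriv_le (bound := fun _ => C)
    (closedBall_mem_nhds s one_pos)
    (Filter.Eventually.of_forall fun r => (hc r).aestronglyMeasurable)
    ((hc s).integrable_of_hasCompactSupport (HasCompactSupport.of_compactSpace _))
    (hc' s).aestronglyMeasurable
    (ae_of_all _ fun θ r hr => hC (r, θ) ⟨hr, trivial⟩) (integrable_const _)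
    (ae_of_all _ fun θ r _ => h r θ)).2

lemma integrable_surf {f : S3 → ℝ} (hf : Continuous f) : Integrable f surf :=
  hf.integrable_of_hasCompactSupport (HasCompactSupport.of_compactSpace _)

lemma integral_XD (a : Fin 3) {f : E4 → ℝ} (hf : ContDiff ℝ ∞ f) :
    ∫ θ, XD a f (θ : S3) ∂surf = 0 := by
  have hd : Differentiable ℝ f := hf.differentiable (by simp)
  have hfd : Continuous (fderiv ℝ f) := hf.continuous_fderiv (by simp)
  have h := hasDerivAt_integral_surf
    (Φ := fun s θ => f (Real.cos s • (θ : E4) + Real.sin s • J a θ))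
    (Φ' := fun s θ => fderiv ℝ f (Real.cos s • (θ : E4) + Real.sin s • J a θ)
      ((-Real.sin s) • (θ : E4) + Real.cos s • J a θ))
    (hf.continuous.comp (by fun_prop))
    (Continuous.clm_apply (hfd.comp (by fun_prop)) (by fun_prop)) (by
      intro s θ
      exact (hd _).hasFDerivAt.comp_hasDerivAt s
        (((Real.hasDerivAt_cos s).smul_const (θ : E4)).add
          ((Real.hasDerivAt_sin s).smul_const (J a θ)))) 0
  have hc : (fun s => ∫ θ, f (Real.cos s • (θ : E4) + Real.sin s • J a θ) ∂surf) =
      fun _ => ∫ θ, f (θ : E4) ∂surf :=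
    funext fun s => integral_comp_isometry (rot a s) f
  rw [hc] at h
  have := h.unique (hasDerivAt_const _ _)
  simpa [XD] using this

lemma integral_XD_mul (a : Fin 3) {f g : E4 → ℝ} (hf : ContDiff ℝ ∞ f) (hg : ContDiff ℝ ∞ g) :
    ∫ θ, XD a f (θ : S3) * g θ ∂surf = -∫ θ, f (θ : S3) * XD a g θ ∂surf := by
  have h := integral_XD a (hf.mul hg)
  have h1 : ∀ x, XD a (fun y => f y * g y) x = XD a f x * g x + f x * XD a g x := by
    intro x
    have := ((hf.differentiable (by simp) x).hasFDerivAt.mul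
      (hg.differentiable (by simp) x).hasFDerivAt).fderiv
    have h3 : (fun y => f y * g y) = f * g := rfl
    rw [XD, h3, this]
    simp [XD]; ring
  have cf := hf.continuous
  have cg := hg.continuous
  have cXf := (contDiff_XD a hf).continuous
  have cXg := (contDiff_XD a hg).continuous
  change ∫ θ, XD a (fun y => f y * g y) (θ : S3) ∂surf = 0 at h
  simp_rw [h1] at h
  rw [integral_add (integrable_surf (by fun_prop)) (integrable_surf (by fun_prop))] at h
  linarith

/-- The spherical Laplacian. -/
def SL (f : E4 → ℝ) (x : E4) : ℝ := ∑ a, XD a (XD a f) x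

lemma contDiff_SL {f : E4 → ℝ} (hf : ContDiff ℝ ∞ f) : ContDiff ℝ ∞ (SL f) :=
  ContDiff.sum fun a _ => contDiff_XD a (contDiff_XD a hf)

lemma integral_SL_mul {f g : E4 → ℝ} (hf : ContDiff ℝ ∞ f) (hg : ContDiff ℝ ∞ g) :
    ∫ θ, SL f (θ : S3) * g θ ∂surf = ∫ θ, f (θ : S3) * SL g θ ∂surf := by
  simp only [SL, Finset.sum_mul, Finset.mul_sum]
  rw [integral_finsetSum, integral_finsetSum]
  · refine Finset.sum_congr rfl fun a _ => ?_
    rw [integral_XD_mul a (contDiff_XD a hf) hg, integral_XD_mul a hf (contDiff_XD a hg), neg_neg]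
  · intro a _
    have := hf.continuous
    have := (contDiff_XD a (contDiff_XD a hg)).continuous
    exact integrable_surf (by fun_prop)
  · intro a _
    have := hg.continuous
    have := (contDiff_XD a (contDiff_XD a hf)).continuous
    exact integrable_surf (by fun_prop)

/-- The coefficient of `f` along `Y` on the sphere of logarithmic radius `t`. -/
def mode (Y f : E4 → ℝ) (t : ℝ) : ℝ := ∫ θ, f (Real.exp t • (θ : E4)) * Y (θ : S3) ∂surf

lemma mode_hasDerivAt {Y f : E4 → ℝ} (hY : ContDiff ℝ ∞ Y) (hf : ContDiff ℝ ∞ f) (t : ℝ) :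
    HasDerivAt (mode Y f) (mode Y (Eul f) t) t := by
  have hd : Differentiable ℝ f := hf.differentiable (by simp)
  have hfc := hf.continuous
  have hYc := hY.continuous
  have hE := (contDiff_Eul hf).continuous
  refine hasDerivAt_integral_surf (Φ := fun t θ => f (Real.exp t • (θ : E4)) * Y θ)
    (Φ' := fun t θ => Eul f (Real.exp t • (θ : E4)) * Y θ) (by fun_prop) (by fun_prop) ?_ t
  intro s θ
  exact ((hd _).hasFDerivAt.comp_hasDerivAt s
    ((Real.hasDerivAt_exp s).smul_const (θ : E4))).mul_const _

lemma XD_comp_smul (a : Fin 3) (f : E4 → ℝ) (r : ℝ) (x : E4) :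
    XD a (fun y => f (r • y)) x = XD a f (r • x) := by
  rw [XD, fderiv_comp_smul]
  simp [XD]

lemma SL_comp_smul (f : E4 → ℝ) (r : ℝ) (x : E4) :
    SL (fun y => f (r • y)) x = SL f (r • x) := by
  have h : ∀ a, XD a (fun y => f (r • y)) = fun y => XD a f (r • y) :=
    fun a => funext (XD_comp_smul a f r)
  simp only [SL, h, XD_comp_smul]

lemma mode_SL {Y f : E4 → ℝ} (hY : ContDiff ℝ ∞ Y) (hf : ContDiff ℝ ∞ f) {l : ℝ}
    (hl : ∀ θ : S3, SL Y θ = -l * Y θ) (t : ℝ) : mode Y (SL f) t = -l * mode Y f t := by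
  have h := integral_SL_mul (f := fun y => f (Real.exp t • y)) (g := Y)
    (hf.comp (contDiff_const_smul _)) hY
  simp only [SL_comp_smul, hl] at h
  rw [mode, h, mode, ← integral_const_mul]
  congr 1; ext θ; ring

lemma mode_Eul_hasDerivAt {Y f : E4 → ℝ} (hY : ContDiff ℝ ∞ Y) (hf : ContDiff ℝ ∞ f) {l : ℝ}
    (hl : ∀ θ : S3, SL Y θ = -l * Y θ) (t : ℝ) :
    HasDerivAt (mode Y (Eul f))
      (Real.exp (2 * t) * mode Y (lap f) t - 2 * mode Y (Eul f) t + l * mode Y f t) t := by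
  have h := mode_hasDerivAt hY (contDiff_Eul hf) t
  convert h using 1
  have h1 := mode_SL hY hf hl t
  have h2 : mode Y (Eul (Eul f)) t = Real.exp (2 * t) * mode Y (lap f) t -
      2 * mode Y (Eul f) t - mode Y (SL f) t := by
    have c0 := hY.continuous
    have c1 := (contDiff_lap hf).continuous
    have c2 := (contDiff_Eul hf).continuous
    have c3 := (contDiff_SL hf).continuous
    rw [mode, mode, mode, mode, ← integral_const_mul, ← integral_const_mul,
      ← integral_sub (integrable_surf (by fun_prop)) (integrable_surf (by fun_prop)),
      ← integral_sub (integrable_surf (by fun_prop)) (integrable_surf (by fun_prop))]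
    congr 1; ext θ
    have := norm_sq_mul_lap hf (Real.exp t • (θ : E4))
    have hθ : ‖Real.exp t • (θ : E4)‖ ^ 2 = Real.exp (2 * t) := by
      rw [norm_smul, show ‖(θ : E4)‖ = 1 by simp, mul_one, Real.norm_of_nonneg (Real.exp_pos _).le,
        ← Real.exp_nat_mul]
      norm_num
    rw [hθ] at this
    simp only [SL]
    linear_combination (-Y θ) * this
  rw [h2, h1]; ring

lemma continuous_mode {Y f : E4 → ℝ} (hY : ContDiff ℝ ∞ Y) (hf : ContDiff ℝ ∞ f) :
    Continuous (mode Y f) :=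
  continuous_iff_continuousAt.2 fun t => (mode_hasDerivAt hY hf t).continuousAt

/-- The three-annulus estimate for a single spherical mode. -/
lemma mode_estimate_of_contDiff {Y f : E4 → ℝ} (hY : ContDiff ℝ ∞ Y) (hf : ContDiff ℝ ∞ f)
    {k : ℕ} (hk : 1 ≤ k) (hl : ∀ θ : S3, SL Y θ = -(k * (k + 2) : ℝ) * Y θ) :
    45 * ∫ t in (-1.5)..1.5, mode Y f t ^ 2 ≤
      (∫ t in (-4.4)..(-1.5), mode Y f t ^ 2) + (∫ t in (1.5)..4.4, mode Y f t ^ 2) +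
      1050 * 8.8 ^ 8 * ∫ t in (-4.4)..4.4, (Real.exp (4 * t) * mode Y (lap (lap f)) t) ^ 2 := by
  have hf1 := contDiff_lap hf
  have e2 : ∀ t, HasDerivAt (fun t => Real.exp (2 * t)) (Real.exp (2 * t) * 2) t := fun t => by
    simpa using ((hasDerivAt_id t).const_mul 2).exp
  refine mode_estimate k hk (v := mode Y f) (v' := mode Y (Eul f))
    (w := fun t => Real.exp (2 * t) * mode Y (lap f) t)
    (w' := fun t => Real.exp (2 * t) * (2 * mode Y (lap f) t + mode Y (Eul (lap f)) t))
    (mode_hasDerivAt hY hf) (mode_Eul_hasDerivAt hY hf hl) ?_ ?_ ?_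
  · intro t
    exact ((e2 t).mul (mode_hasDerivAt hY hf1 t)).congr_deriv (by ring)
  · intro t
    refine ((e2 t).mul (((mode_hasDerivAt hY hf1 t).const_mul 2).add
      (mode_Eul_hasDerivAt hY hf1 hl t))).congr_deriv ?_
    rw [show 4 * t = 2 * t + 2 * t by ring, Real.exp_add, Pi.add_apply]
    ring
  · exact (by fun_prop : Continuous fun t : ℝ => Real.exp (4 * t)).mul
      (continuous_mode hY (contDiff_lap hf1))

/-- The polynomial function on `ℝ⁴` attached to a polynomial. -/
def ev (p : Poly) (x : E4) : ℝ := MvPolynomial.eval x.ofLp p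

lemma hasFDerivAt_ev (p : Poly) (x : E4) :
    HasFDerivAt (ev p) (∑ i, ev (MvPolynomial.pderiv i p) x •
      (EuclideanSpace.proj i : E4 →L[ℝ] ℝ)) x := by
  induction p using MvPolynomial.induction_on with
  | C c =>
    have : ev (MvPolynomial.C c) = fun _ => c := by ext y; simp [ev]
    rw [this]
    refine (hasFDerivAt_const c x).congr_fderiv ?_
    simp [ev]
  | add p q hp hq =>
    have : ev (p + q) = ev p + ev q := by ext y; simp [ev]
    rw [this]
    refine (hp.add hq).congr_fderiv ?_
    simp [ev, add_smul, Finset.sum_add_distrib]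
  | mul_X p j hp =>
    have : ev (p * MvPolynomial.X j) = fun y => ev p y * EuclideanSpace.proj (𝕜 := ℝ) j y := by
      ext y; simp [ev]
    rw [this]
    refine (hp.mul (EuclideanSpace.proj (𝕜 := ℝ) j).hasFDerivAt).congr_fderiv ?_
    ext v
    simp [ev, Derivation.leibniz, MvPolynomial.pderiv_X, Pi.single_apply, add_mul,
      Finset.sum_add_distrib, Finset.mul_sum]
    congr 1
    · refine Eq.symm ((Finset.sum_eq_single j (fun b _ hb => ?_) (by simp)).trans ?_)
      · simp [hb.symm]
      · simp
    · exact Finset.sum_congr rfl fun i _ => by ring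

lemma fderiv_ev (p : Poly) (x v : E4) :
    fderiv ℝ (ev p) x v = ∑ i, ev (MvPolynomial.pderiv i p) x * v i := by
  rw [(hasFDerivAt_ev p x).fderiv]
  simp [_root_.sum_apply]

lemma contDiff_ev (p : Poly) : ContDiff ℝ ∞ (ev p) := by
  induction p using MvPolynomial.induction_on with
  | C c =>
    have : ev (MvPolynomial.C c) = fun _ => c := by ext y; simp [ev]
    rw [this]; exact contDiff_const
  | add p q hp hq =>
    have : ev (p + q) = ev p + ev q := by ext y; simp [ev]
    rw [this]; exact hp.add hq
  | mul_X p j hp =>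
    have : ev (p * MvPolynomial.X j) = fun y => ev p y * EuclideanSpace.proj (𝕜 := ℝ) j y := by
      ext y; simp [ev]
    rw [this]; exact hp.mul (EuclideanSpace.proj (𝕜 := ℝ) j).contDiff

/-- The Laplacian of a polynomial. -/
def lapPoly (p : Poly) : Poly := ∑ i, MvPolynomial.pderiv i (MvPolynomial.pderiv i p)

lemma lap_ev (p : Poly) (x : E4) : lap (ev p) x = ev (lapPoly p) x := by
  rw [lap_apply]
  simp only [lapPoly, ev, map_sum]
  refine Finset.sum_congr rfl fun i _ => ?_
  have hd : DifferentiableAt ℝ (fderiv ℝ (ev p)) x :=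
    ((contDiff_ev p).fderiv_right (m := ∞) (by simp)).differentiable (by simp) x
  have h : (fun y => fderiv ℝ (ev p) y (EuclideanSpace.single i 1)) =
      ev (MvPolynomial.pderiv i p) := by
    ext y
    rw [fderiv_ev]
    simp
  have h2 := fderiv_ev (MvPolynomial.pderiv i p) x (EuclideanSpace.single i 1)
  rw [← h, fderiv_clm_apply hd (by fun_prop)] at h2
  simpa [Pi.single_apply, ev] using h2

lemma Eul_ev_of_isHomogeneous {p : Poly} {d : ℕ} (hp : p.IsHomogeneous d) :
    Eul (ev p) = fun x => d * ev p x := by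
  ext x
  have h := congrArg (fun q => ev q x) hp.sum_X_mul_pderiv
  simp only [ev, map_sum, map_mul, MvPolynomial.eval_X, map_nsmul] at h
  rw [Eul, fderiv_ev]
  simp only [ev, nsmul_eq_mul] at h ⊢
  rw [← h]
  exact Finset.sum_congr rfl fun i _ => mul_comm _ _

lemma SL_ev_of_isHomogeneous {p : Poly} {d : ℕ} (hp : p.IsHomogeneous d) (θ : S3) :
    SL (ev p) θ = ev (lapPoly p) θ - (d * (d + 2) : ℝ) * ev p θ := by
  have h := norm_sq_mul_lap (contDiff_ev p) (θ : E4)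
  have h1 := Eul_ev_of_isHomogeneous hp
  have h2 : Eul (Eul (ev p)) θ = d * (d * ev p θ) := by
    rw [h1, Eul, fderiv_const_mul ((contDiff_ev p).differentiable (by simp) _)]
    have := congrFun h1 θ
    rw [Eul] at this
    simp [this]
  rw [h2, congrFun h1 θ, lap_ev, show ‖(θ : E4)‖ = 1 by simp] at h
  simp only [SL]
  linarith

lemma XD_add (a : Fin 3) {f g : E4 → ℝ} (hf : ContDiff ℝ ∞ f) (hg : ContDiff ℝ ∞ g) :
    XD a (f + g) = XD a f + XD a g := by
  ext x
  simp [XD, fderiv_add (hf.differentiable (by simp) x) (hg.differentiable (by simp) x)]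

lemma XD_smul (a : Fin 3) (c : ℝ) {f : E4 → ℝ} (hf : ContDiff ℝ ∞ f) :
    XD a (c • f) = c • XD a f := by
  ext x
  simp [XD, fderiv_const_smul (hf.differentiable (by simp) x)]

lemma SL_add {f g : E4 → ℝ} (hf : ContDiff ℝ ∞ f) (hg : ContDiff ℝ ∞ g) (x : E4) :
    SL (f + g) x = SL f x + SL g x := by
  simp [SL, XD_add _ hf hg, XD_add _ (contDiff_XD _ hf) (contDiff_XD _ hg), Finset.sum_add_distrib]

lemma SL_smul (c : ℝ) {f : E4 → ℝ} (hf : ContDiff ℝ ∞ f) (x : E4) :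
    SL (c • f) x = c * SL f x := by
  simp [SL, XD_smul _ c hf, XD_smul _ c (contDiff_XD _ hf), Finset.mul_sum]

lemma ev_add (p q : Poly) : ev (p + q) = ev p + ev q := by ext y; simp [ev]
lemma ev_smul (c : ℝ) (p : Poly) : ev (c • p) = c • ev p := by ext y; simp [ev]

/-- Polynomials of degree at most `j` which restrict to eigenfunctions of the spherical Laplacian
with eigenvalue `-j (j + 2)`. -/
def eigPoly (j : ℕ) : Submodule ℝ Poly where
  carrier := {p | p.totalDegree ≤ j ∧ ∀ θ : S3, SL (ev p) θ = -(j * (j + 2) : ℝ) * ev p θ}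
  add_mem' := by
    rintro p q ⟨hp, hp'⟩ ⟨hq, hq'⟩
    refine ⟨(MvPolynomial.totalDegree_add _ _).trans (max_le hp hq), fun θ => ?_⟩
    rw [ev_add, SL_add (contDiff_ev p) (contDiff_ev q), hp', hq', Pi.add_apply]
    ring
  zero_mem' := by
    refine ⟨by simp, fun θ => ?_⟩
    have h : ev 0 = (0 : ℝ) • ev 0 := by ext; simp [ev]
    rw [h, SL_smul _ (contDiff_ev 0)]
    simp
  smul_mem' := by
    rintro c p ⟨hp, hp'⟩
    refine ⟨(MvPolynomial.totalDegree_smul_le _ _).trans hp, fun θ => ?_⟩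
    rw [ev_smul, SL_smul c (contDiff_ev p), hp', Pi.smul_apply, smul_eq_mul]
    ring

/-- Restriction of polynomials to the unit sphere. -/
def res : Poly →ₐ[ℝ] C(S3, ℝ) :=
  MvPolynomial.aeval fun i => ⟨fun θ => (θ : E4) i, by fun_prop⟩

lemma res_apply (p : Poly) (θ : S3) : res p θ = ev p θ := by
  induction p using MvPolynomial.induction_on with
  | C c => simp [res, ev]
  | add p q hp hq => simp [ev_add, hp, hq]
  | mul_X p j hp => rw [map_mul, ContinuousMap.mul_apply, hp]; simp [res, ev]

/-- Restrictions of degree `j` spherical harmonics. -/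
def harm (j : ℕ) : Submodule ℝ C(S3, ℝ) := (eigPoly j).map res.toLinearMap

lemma exists_shift (d : ℕ) (f : C(S3, ℝ)) (hf : f ∈ ⨆ j : Fin d, harm j) :
    ∃ s : Poly, s.totalDegree ≤ d ∧ res s ∈ ⨆ j : Fin d, harm j ∧
      ∀ θ : S3, SL (ev s) θ + (d * (d + 2) : ℝ) * ev s θ = f θ := by
  induction hf using Submodule.iSup_induction' with
  | mem j x hx =>
    obtain ⟨r, ⟨hr, hr'⟩, rfl⟩ := hx
    have hj : ((j : ℕ) : ℝ) < d := by exact_mod_cast j.2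
    have hj0 : (0 : ℝ) ≤ (j : ℕ) := by positivity
    have hne : (d * (d + 2) - (j : ℕ) * ((j : ℕ) + 2) : ℝ) ≠ 0 := by nlinarith
    refine ⟨(d * (d + 2) - (j : ℕ) * ((j : ℕ) + 2) : ℝ)⁻¹ • r,
      (MvPolynomial.totalDegree_smul_le _ _).trans (hr.trans j.2.le), ?_, fun θ => ?_⟩
    · rw [map_smul]
      exact Submodule.smul_mem _ _ (Submodule.mem_iSup_of_mem j ⟨r, ⟨hr, hr'⟩, rfl⟩)
    · rw [ev_smul, SL_smul _ (contDiff_ev r), hr', Pi.smul_apply, smul_eq_mul]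
      change _ = res r θ
      rw [res_apply]
      field_simp
      ring
  | zero =>
    refine ⟨0, by simp, by simp, fun θ => ?_⟩
    have h := (eigPoly d).zero_mem.2 θ
    rw [h]; simp
  | add x y hx hy ihx ihy =>
    obtain ⟨s, hs, hs', hs''⟩ := ihx
    obtain ⟨t, ht, ht', ht''⟩ := ihy
    refine ⟨s + t, (MvPolynomial.totalDegree_add _ _).trans (max_le hs ht), ?_, fun θ => ?_⟩
    · rw [map_add]; exact Submodule.add_mem _ hs' ht'
    · rw [ev_add, SL_add (contDiff_ev s) (contDiff_ev t), Pi.add_apply, ContinuousMap.add_apply,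
        ← hs'', ← ht'']
      ring

lemma totalDegree_lapPoly {p : Poly} {d : ℕ} (hp : p.IsHomogeneous d) :
    (lapPoly p).totalDegree ≤ d - 1 := by
  have h : (lapPoly p).IsHomogeneous (d - 1 - 1) :=
    MvPolynomial.IsHomogeneous.sum _ _ _ fun i _ => hp.pderiv.pderiv
  exact h.totalDegree_le.trans (Nat.sub_le _ _)

lemma iSup_fin_mono {d e : ℕ} (h : d ≤ e) : ⨆ j : Fin d, harm j ≤ ⨆ j : Fin e, harm j :=
  iSup_le fun j => le_iSup (fun j : Fin e => harm j) (Fin.castLE h j)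

/-- Polynomials restrict to sums of spherical harmonics. -/
lemma res_mem_iSup (d : ℕ) : ∀ p : Poly, p.totalDegree ≤ d → res p ∈ ⨆ j : Fin (d + 1), harm j := by
  induction d using Nat.strong_induction_on with
  | _ d ih =>
  have hhom : ∀ e ≤ d, ∀ p : Poly, p.IsHomogeneous e → res p ∈ ⨆ j : Fin (e + 1), harm j := by
    intro e he p hp
    have hl : res (lapPoly p) ∈ ⨆ j : Fin e, harm j := by
      rcases Nat.eq_zero_or_pos e with rfl | hpos
      · have : lapPoly p = 0 := by
          obtain ⟨c, rfl⟩ : ∃ c, p = MvPolynomial.C c :=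
            ⟨_, MvPolynomial.totalDegree_eq_zero_iff_eq_C.1 (Nat.le_zero.1 hp.totalDegree_le)⟩
          simp [lapPoly]
        rw [this, map_zero]; exact Submodule.zero_mem _
      · have := ih (e - 1) (by omega) (lapPoly p) (totalDegree_lapPoly hp)
        rwa [Nat.sub_add_cancel hpos] at this
    obtain ⟨s, hs, hs', hs''⟩ := exists_shift e _ hl
    have hq : p + (-1 : ℝ) • s ∈ eigPoly e := by
      refine ⟨(MvPolynomial.totalDegree_add _ _).trans (max_le hp.totalDegree_le
        ((MvPolynomial.totalDegree_smul_le _ _).trans hs)), fun θ => ?_⟩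
      have h1 := hs'' θ
      rw [res_apply] at h1
      rw [ev_add, SL_add (contDiff_ev _) (contDiff_ev _), ev_smul, SL_smul _ (contDiff_ev s),
        SL_ev_of_isHomogeneous hp, Pi.add_apply, Pi.smul_apply, smul_eq_mul]
      linarith
    have h1 : res p = res (p + (-1 : ℝ) • s) + res s := by
      rw [← map_add]; congr 1; simp
    rw [h1]
    exact Submodule.add_mem _ (Submodule.mem_iSup_of_mem (Fin.last e) ⟨_, hq, rfl⟩)
      (iSup_fin_mono (Nat.le_succ e) hs')
  intro p hp
  rw [← MvPolynomial.sum_homogeneousComponent p, map_sum]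
  refine Submodule.sum_mem _ fun i hi => ?_
  have hi' : i ≤ d := by
    have := Finset.mem_range.1 hi
    omega
  exact iSup_fin_mono (by omega) (hhom i hi' _ (MvPolynomial.homogeneousComponent_isHomogeneous i p))

/-- The embedding of continuous functions on the sphere in `L²`. -/
def toL2 : C(S3, ℝ) →L[ℝ] Lp ℝ 2 surf := ContinuousMap.toLp 2 surf ℝ

lemma inner_toL2 (f g : C(S3, ℝ)) : ⟪toL2 f, toL2 g⟫_ℝ = ∫ θ, f θ * g θ ∂surf := by
  rw [toL2, ContinuousMap.inner_toLp]
  simp [mul_comm]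

/-- Spherical harmonics of degree `j` as a subspace of `L²`. -/
def harmL2 (j : ℕ) : Submodule ℝ (Lp ℝ 2 surf) := (harm j).map toL2.toLinearMap

lemma mem_harmL2 {j : ℕ} {x : Lp ℝ 2 surf} (hx : x ∈ harmL2 j) :
    ∃ p ∈ eigPoly j, x = toL2 (res p) := by
  obtain ⟨_, ⟨p, hp, rfl⟩, rfl⟩ := hx
  exact ⟨p, hp, rfl⟩

instance (j : ℕ) : FiniteDimensional ℝ (eigPoly j) :=
  Submodule.finiteDimensional_of_le (S₂ := MvPolynomial.restrictTotalDegree (Fin 4) ℝ j)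
    fun _ hp => (MvPolynomial.mem_restrictTotalDegree _ _ _).2 hp.1

instance (j : ℕ) : FiniteDimensional ℝ (harmL2 j) := by
  unfold harmL2 harm
  infer_instance

lemma orthogonalFamily_harmL2 :
    OrthogonalFamily ℝ (fun j => harmL2 j) fun j => (harmL2 j).subtypeₗᵢ := by
  refine OrthogonalFamily.of_pairwise fun i j hij => ?_
  refine Submodule.isOrtho_iff_inner_eq.2 ?_
  intro u hu v hv
  obtain ⟨p, hp, rfl⟩ := mem_harmL2 hu
  obtain ⟨q, hq, rfl⟩ := mem_harmL2 hv
  rw [inner_toL2]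
  simp only [res_apply]
  have h := integral_SL_mul (contDiff_ev p) (contDiff_ev q)
  simp only [hp.2, hq.2] at h
  have h1 : (-(i * (i + 2)) : ℝ) * ∫ θ, ev p (θ : S3) * ev q θ ∂surf =
      (-(j * (j + 2)) : ℝ) * ∫ θ, ev p (θ : S3) * ev q θ ∂surf := by
    rw [← integral_const_mul, ← integral_const_mul]
    calc _ = ∫ θ, (-(i * (i + 2)) : ℝ) * ev p (θ : S3) * ev q θ ∂surf := by
          congr 1; ext θ; ring
      _ = _ := h
      _ = _ := by congr 1; ext θ; ring
  have hne : ((i * (i + 2) : ℝ)) ≠ j * (j + 2) := by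
    intro he
    have hi : (0 : ℝ) ≤ i := Nat.cast_nonneg i
    have hj : (0 : ℝ) ≤ j := Nat.cast_nonneg j
    have h0 : ((i : ℝ) - j) * (i + j + 2) = 0 := by linarith
    rcases mul_eq_zero.1 h0 with h0 | h0
    · exact hij (by exact_mod_cast sub_eq_zero.1 h0)
    · linarith
  have h2 : ((i * (i + 2) : ℝ) - j * (j + 2)) * ∫ θ, ev p (θ : S3) * ev q θ ∂surf = 0 := by
    linarith
  exact (mul_eq_zero.1 h2).resolve_left (sub_ne_zero.2 hne)

lemma res_range_dense : (res.range.toSubmodule).topologicalClosure = ⊤ := by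
  have h := ContinuousMap.subalgebra_topologicalClosure_eq_top_of_separatesPoints res.range (by
    intro θ φ hne
    obtain ⟨i, hi⟩ : ∃ i, (θ : E4) i ≠ (φ : E4) i := by
      by_contra! hc
      exact hne (Subtype.ext (PiLp.ext hc))
    refine ⟨res (MvPolynomial.X i), ⟨_, ⟨MvPolynomial.X i, rfl⟩, rfl⟩, ?_⟩
    simpa [res_apply, ev] using hi)
  rw [Submodule.eq_top_iff']
  intro x
  have hx : x ∈ res.range.topologicalClosure := by rw [h]; trivial
  exact hx

lemma harmL2_dense : (⨆ j, harmL2 j).topologicalClosure = ⊤ := by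
  have h := (ContinuousMap.toLp_denseRange ℝ surf ℝ (p := 2)
    (by norm_num)).topologicalClosure_map_submodule res_range_dense
  refine top_le_iff.1 (h.ge.trans (Submodule.topologicalClosure_mono ?_))
  rintro _ ⟨_, ⟨p, rfl⟩, rfl⟩
  have h1 := res_mem_iSup _ p le_rfl
  have h2 : ∀ x ∈ ⨆ j : Fin (p.totalDegree + 1), harm j, toL2 x ∈ ⨆ j, harmL2 j := by
    intro x hx
    have : toL2.toLinearMap x ∈ (⨆ j : Fin (p.totalDegree + 1), harm j).map toL2.toLinearMap :=
      ⟨x, hx, rfl⟩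
    rw [Submodule.map_iSup] at this
    exact (iSup_le fun j : Fin (p.totalDegree + 1) => le_iSup harmL2 (j : ℕ)) this
  exact h2 _ h1

/-- A Hilbert basis adapted to a complete orthogonal family of finite-dimensional subspaces. -/
lemma exists_hilbertBasis_of_orthogonalFamily {V : Type} [NormedAddCommGroup V]
    [InnerProductSpace ℝ V] [CompleteSpace V] (H : ℕ → Submodule ℝ V)
    [∀ j, FiniteDimensional ℝ (H j)]
    (hH : OrthogonalFamily ℝ (fun j => H j) fun j => (H j).subtypeₗᵢ)
    (hd : (⨆ j, H j).topologicalClosure = ⊤) :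
    ∃ b : HilbertBasis (Σ j, Fin (Module.finrank ℝ (H j))) ℝ V, ∀ a, b a ∈ H a.1 := by
  have hv := hH.orthonormal_sigma_orthonormal
    (v_family := fun j i => stdOrthonormalBasis ℝ (H j) i)
    fun j => (stdOrthonormalBasis ℝ (H j)).orthonormal
  set v := fun a : (Σ j, Fin (Module.finrank ℝ (H j))) =>
    (H a.1).subtypeₗᵢ (stdOrthonormalBasis ℝ (H a.1) a.2)
  have hsp : ⊤ ≤ (Submodule.span ℝ (Set.range v)).topologicalClosure := by
    rw [← hd]
    refine Submodule.topologicalClosure_mono (iSup_le fun j x hx => ?_)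
    have h1 := (stdOrthonormalBasis ℝ (H j)).toBasis.mem_span ⟨x, hx⟩
    have h2 : x ∈ (Submodule.span ℝ (Set.range (stdOrthonormalBasis ℝ (H j)).toBasis)).map
        (H j).subtype := ⟨_, h1, rfl⟩
    rw [Submodule.map_span] at h2
    refine Submodule.span_mono ?_ h2
    rintro _ ⟨_, ⟨i, rfl⟩, rfl⟩
    refine ⟨⟨j, i⟩, ?_⟩
    rw [OrthonormalBasis.coe_toBasis]
    rfl
  refine ⟨HilbertBasis.mk hv hsp, fun a => ?_⟩
  rw [HilbertBasis.coe_mk]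
  exact (stdOrthonormalBasis ℝ (H a.1) a.2).2

/-- Existence of a complete orthonormal system of spherical harmonics on the three-sphere. -/
lemma exists_harmonics : ∃ (ι : Type) (k : ι → ℕ) (Y : ι → E4 → ℝ), Countable ι ∧
    (∀ n, ContDiff ℝ ∞ (Y n)) ∧
    (∀ n, ∀ θ : S3, SL (Y n) θ = -(k n * (k n + 2) : ℝ) * Y n θ) ∧
    (∀ n, k n = 0 → ∃ c : ℝ, ∀ θ, Y n θ = c) ∧
    ∀ f : S3 → ℝ, Continuous f →
      HasSum (fun n => (∫ θ, f θ * Y n θ ∂surf) ^ 2) (∫ θ, f θ ^ 2 ∂surf) := by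
  obtain ⟨b, hb⟩ := exists_hilbertBasis_of_orthogonalFamily harmL2 orthogonalFamily_harmL2
    harmL2_dense
  have hmem := fun a => mem_harmL2 (hb a)
  choose q hq hvq using hmem
  refine ⟨_, fun a => a.1, fun a => ev (q a), inferInstance, fun a => contDiff_ev _,
    fun a => (hq a).2, fun a ha => ?_, fun f hf => ?_⟩
  · have h0 := (hq a).1
    rw [show a.1 = 0 from ha, Nat.le_zero, MvPolynomial.totalDegree_eq_zero_iff_eq_C] at h0
    refine ⟨MvPolynomial.coeff 0 (q a), fun θ => ?_⟩
    simp only [ev]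
    rw [h0]; simp
  · have h := b.hasSum_inner_mul_inner (toL2 ⟨f, hf⟩) (toL2 ⟨f, hf⟩)
    simp only [hvq, inner_toL2, res_apply, ContinuousMap.coe_mk, ← sq] at h
    refine h.congr_fun fun a => ?_
    rw [sq]
    simp only [mul_comm (f _)]

/-- The squared `L²` norm of `f` on the sphere of logarithmic radius `t`. -/
def sphereSq (f : E4 → ℝ) (t : ℝ) : ℝ := ∫ θ : S3, f (Real.exp t • (θ : E4)) ^ 2 ∂surf

lemma sphereSq_nonneg (f : E4 → ℝ) (t : ℝ) : 0 ≤ sphereSq f t :=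
  integral_nonneg fun _ => sq_nonneg _

lemma continuous_sphereSq {f : E4 → ℝ} (hf : Continuous f) : Continuous (sphereSq f) := by
  have h := continuousOn_integral_of_compact_support (μ := surf)
    (f := fun (t : ℝ) (θ : S3) => f (Real.exp t • (θ : E4)) ^ 2) (s := Set.univ) (k := Set.univ)
    isCompact_univ (by fun_prop) (by simp)
  exact continuousOn_univ.1 h

/-- The three-annulus estimate for a function with vanishing spherical means. -/
lemma sphereSq_estimate {f : E4 → ℝ} (hf : ContDiff ℝ ∞ f)
    (h0 : ∀ t ∈ Set.Icc (-1.5 : ℝ) 1.5, ∫ θ : S3, f (Real.exp t • (θ : E4)) ∂surf = 0) :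
    45 * ∫ t in (-1.5)..1.5, sphereSq f t ≤
      (∫ t in (-4.4)..(-1.5), sphereSq f t) + (∫ t in (1.5)..4.4, sphereSq f t) +
      1050 * 8.8 ^ 8 * ∫ t in (-4.4)..4.4, Real.exp (8 * t) * sphereSq (lap (lap f)) t := by
  obtain ⟨ι, k, Y, hι, hY, hYk, hY0, hsum⟩ := exists_harmonics
  have hff := contDiff_lap (contDiff_lap hf)
  have hS : ∀ {g : E4 → ℝ}, ContDiff ℝ ∞ g → ∀ t,
      HasSum (fun n => mode (Y n) g t ^ 2) (sphereSq g t) := fun {g} hg t => by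
    have := hg.continuous
    exact hsum (fun θ => g (Real.exp t • (θ : E4))) (by fun_prop)
  have cm : ∀ {g : E4 → ℝ}, ContDiff ℝ ∞ g → ∀ n, Continuous (mode (Y n) g) :=
    fun hg n => continuous_mode (hY n) hg
  have cs := continuous_sphereSq hf.continuous
  have cs2 := continuous_sphereSq hff.continuous
  have hmain : ∀ n, 45 * ∫ t in (-1.5)..1.5, mode (Y n) f t ^ 2 ≤
      (∫ t in (-4.4)..(-1.5), mode (Y n) f t ^ 2) + (∫ t in (1.5)..4.4, mode (Y n) f t ^ 2) +
      1050 * 8.8 ^ 8 *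
        ∫ t in (-4.4)..4.4, (Real.exp (4 * t) * mode (Y n) (lap (lap f)) t) ^ 2 := by
    intro n
    rcases Nat.eq_zero_or_pos (k n) with hk | hk
    · obtain ⟨c, hc⟩ := hY0 n hk
      have h1 : ∫ t in (-1.5)..1.5, mode (Y n) f t ^ 2 = ∫ t in (-1.5 : ℝ)..1.5, (0 : ℝ) := by
        refine intervalIntegral.integral_congr fun t ht => ?_
        rw [Set.uIcc_of_le (by norm_num)] at ht
        simp only [mode, hc, integral_mul_const, h0 t ht]
        norm_num
      rw [h1, intervalIntegral.integral_zero, mul_zero]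
      have n1 : 0 ≤ ∫ t in (-4.4)..(-1.5), mode (Y n) f t ^ 2 :=
        intervalIntegral.integral_nonneg (by norm_num) fun t _ => sq_nonneg _
      have n2 : 0 ≤ ∫ t in (1.5)..4.4, mode (Y n) f t ^ 2 :=
        intervalIntegral.integral_nonneg (by norm_num) fun t _ => sq_nonneg _
      have n3 : 0 ≤ ∫ t in (-4.4)..4.4, (Real.exp (4 * t) * mode (Y n) (lap (lap f)) t) ^ 2 :=
        intervalIntegral.integral_nonneg (by norm_num) fun t _ => sq_nonneg _
      positivity
    · exact mode_estimate_of_contDiff (hY n) hf hk (hYk n)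
  have hle : ∀ {g : E4 → ℝ}, ContDiff ℝ ∞ g → ∀ (s : Finset ι) (w : ℝ → ℝ), Continuous w →
      (∀ t, 0 ≤ w t) → ∀ a b : ℝ, a ≤ b →
      ∑ n ∈ s, ∫ t in a..b, w t * mode (Y n) g t ^ 2 ≤ ∫ t in a..b, w t * sphereSq g t := by
    intro g hg s w hw hw0 a b hab
    have cg := continuous_sphereSq hg.continuous
    have hi : ∀ n, Continuous fun t => w t * mode (Y n) g t ^ 2 := fun n =>
      hw.mul ((cm hg n).pow 2)
    rw [← intervalIntegral.integral_finsetSum fun n _ => (hi n).intervalIntegrable _ _]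
    refine intervalIntegral.integral_mono_on hab
      ((continuous_finsetSum _ fun n _ => hi n).intervalIntegrable _ _)
      ((hw.mul cg).intervalIntegrable _ _) fun t _ => ?_
    rw [← Finset.mul_sum]
    exact mul_le_mul_of_nonneg_left (sum_le_hasSum s (fun _ _ => sq_nonneg _) (hS hg t)) (hw0 t)
  have hconv : HasSum (fun n => ∫ t in (-1.5)..1.5, mode (Y n) f t ^ 2)
      (∫ t in (-1.5)..1.5, sphereSq f t) := by
    refine intervalIntegral.hasSum_integral_of_dominated_convergence
      (fun n t => mode (Y n) f t ^ 2) (fun n => ((cm hf n).pow 2).aestronglyMeasurable)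
      (fun n => Filter.Eventually.of_forall fun t _ => ?_)
      (Filter.Eventually.of_forall fun t _ => (hS hf t).summable) ?_
      (Filter.Eventually.of_forall fun t _ => hS hf t)
    · rw [Real.norm_of_nonneg (sq_nonneg _)]
    · have : (fun t => ∑' n, mode (Y n) f t ^ 2) = sphereSq f := funext fun t => (hS hf t).tsum_eq
      rw [this]
      exact cs.intervalIntegrable _ _
  refine hasSum_le_of_sum_le (hconv.mul_left 45) fun s => ?_
  refine (Finset.sum_le_sum fun n _ => hmain n).trans ?_
  rw [Finset.sum_add_distrib, Finset.sum_add_distrib, ← Finset.mul_sum]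
  have e1 := hle hf s (fun _ => 1) continuous_const (fun _ => zero_le_one) (-4.4) (-1.5)
    (by norm_num)
  have e2 := hle hf s (fun _ => 1) continuous_const (fun _ => zero_le_one) 1.5 4.4 (by norm_num)
  have e3 := hle hff s (fun t => Real.exp (8 * t)) (by fun_prop) (fun _ => (Real.exp_pos _).le)
    (-4.4) 4.4 (by norm_num)
  have e4 : ∀ n t, (Real.exp (4 * t) * mode (Y n) (lap (lap f)) t) ^ 2 =
      Real.exp (8 * t) * mode (Y n) (lap (lap f)) t ^ 2 := fun n t => by
    rw [mul_pow, ← Real.exp_nat_mul]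
    congr 2
    push_cast; ring
  simp only [one_mul] at e1 e2
  simp only [e4]
  gcongr

/-- The `i`-th partial derivative. -/
def pd {V : Type*} [NormedAddCommGroup V] [NormedSpace ℝ V] (i : Fin 4) (f : E4 → V) (x : E4) : V :=
  fderiv ℝ f x (EuclideanSpace.single i 1)

/-- The squared length of the gradient. -/
def gradSq (f : E4 → ℝ) (x : E4) : ℝ := ∑ i, pd i f x ^ 2

lemma gradSq_nonneg (f : E4 → ℝ) (x : E4) : 0 ≤ gradSq f x := Finset.sum_nonneg fun _ _ => sq_nonneg _

/-- Smooth functions with compact support. -/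
def IsTest (f : E4 → ℝ) : Prop := ContDiff ℝ ∞ f ∧ HasCompactSupport f

lemma contDiff_pd {f : E4 → ℝ} (hf : ContDiff ℝ ∞ f) (i : Fin 4) : ContDiff ℝ ∞ (pd i f) :=
  (hf.fderiv_right (m := ∞) (by simp)).clm_apply contDiff_const

lemma lap_eq_sum_pd {f : E4 → ℝ} (hf : ContDiff ℝ ∞ f) (x : E4) :
    lap f x = ∑ i, pd i (pd i f) x := by
  rw [lap_apply]
  refine Finset.sum_congr rfl fun i _ => ?_
  have h1 : DifferentiableAt ℝ (fderiv ℝ f) x :=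
    (hf.fderiv_right (m := ∞) (by simp)).differentiable (by simp) x
  have h3 : pd i f = fun y => fderiv ℝ f y (EuclideanSpace.single i 1) := rfl
  rw [pd, h3, fderiv_clm_apply h1 (differentiableAt_const _)]
  simp

lemma pd_comm {f : E4 → ℝ} (hf : ContDiff ℝ ∞ f) (i j : Fin 4) (x : E4) :
    pd i (pd j f) x = pd j (pd i f) x := by
  have h1 : DifferentiableAt ℝ (fderiv ℝ f) x :=
    (hf.fderiv_right (m := ∞) (by simp)).differentiable (by simp) x
  have h3 : ∀ j, pd j f = fun y => fderiv ℝ f y (EuclideanSpace.single j 1) := fun _ => rfl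
  rw [pd, pd, h3, h3, fderiv_clm_apply h1 (differentiableAt_const _),
    fderiv_clm_apply h1 (differentiableAt_const _)]
  have := (hf.contDiffAt (x := x)).isSymmSndFDerivAt
    (by rw [minSmoothness_of_isRCLikeNormedField]; exact WithTop.coe_le_coe.2 le_top)
  simpa using this _ _

lemma lap_pd {f : E4 → ℝ} (hf : ContDiff ℝ ∞ f) (i : Fin 4) (x : E4) :
    lap (pd i f) x = pd i (lap f) x := by
  rw [lap_eq_sum_pd (contDiff_pd hf i), show lap f = fun x => ∑ j, pd j (pd j f) x from
    funext (lap_eq_sum_pd hf), pd, fderiv_fun_sum fun j _ =>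
      ((contDiff_pd (contDiff_pd hf j) j).differentiable (by simp) x), _root_.sum_apply]
  refine Finset.sum_congr rfl fun j _ => ?_
  rw [show pd j (pd i f) = pd i (pd j f) from funext (pd_comm hf j i), pd_comm (contDiff_pd hf j)]
  rfl

lemma IsTest.pd {f : E4 → ℝ} (hf : IsTest f) (i : Fin 4) : IsTest (pd i f) :=
  ⟨contDiff_pd hf.1 i, hf.2.fderiv_apply ℝ _⟩

lemma IsTest.lap {f : E4 → ℝ} (hf : IsTest f) : IsTest (lap f) := by
  refine ⟨contDiff_lap hf.1, ?_⟩
  have h : _root_.lap f = ∑ i, ThreeCircle.pd i (ThreeCircle.pd i f) := by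
    funext x; simp [lap_eq_sum_pd hf.1]
  have : ∀ s : Finset (Fin 4), HasCompactSupport
      (∑ i ∈ s, ThreeCircle.pd i (ThreeCircle.pd i f)) := by
    intro s
    induction s using Finset.induction_on with
    | empty => simpa using HasCompactSupport.zero
    | insert a s ha ih => rw [Finset.sum_insert ha]; exact ((hf.pd a).pd a).2.add ih
  rw [h]; exact this _

lemma IsTest.continuous {f : E4 → ℝ} (hf : IsTest f) : Continuous f := hf.1.continuous

lemma IsTest.integrable_mul {f w : E4 → ℝ} (hf : IsTest f) (hw : Continuous w) :
    Integrable (fun x => w x * f x) :=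
  (hw.mul hf.continuous).integrable_of_hasCompactSupport hf.2.mul_left

lemma IsTest.integrable_mul_sq {f w : E4 → ℝ} (hf : IsTest f) (hw : Continuous w) :
    Integrable (fun x => w x * f x ^ 2) := by
  have := hf.integrable_mul (hw.mul hf.continuous)
  refine this.congr (Filter.Eventually.of_forall fun x => ?_)
  simp only [Pi.mul_apply]; ring

lemma IsTest.integrable_mul_gradSq {f w : E4 → ℝ} (hf : IsTest f) (hw : Continuous w) :
    Integrable (fun x => w x * gradSq f x) := by
  simp only [gradSq, Finset.mul_sum]
  exact integrable_finsetSum _ fun i _ => (hf.pd i).integrable_mul_sq hw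

/-- A weighted Caccioppoli inequality. -/
lemma caccioppoli {χ g : E4 → ℝ} (hχ : ContDiff ℝ ∞ χ) (hg : IsTest g) {M : ℝ}
    (hM : ∀ x, gradSq χ x ≤ M) (m : ℕ) {ε : ℝ} (hε : 0 < ε) :
    ∫ x, χ x ^ (2 * m + 2) * gradSq g x ≤ ε * (∫ x, χ x ^ (2 * m + 4) * lap g x ^ 2) +
      (ε⁻¹ + 4 * (m + 1) ^ 2 * M) * ∫ x, χ x ^ (2 * m) * g x ^ 2 := by
  have hχc := hχ.continuous
  have hd : ∀ {f : E4 → ℝ} (_ : ContDiff ℝ ∞ f) x, DifferentiableAt ℝ f x :=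
    fun hf x => hf.differentiable (by simp) x
  have hder : ∀ i x, fderiv ℝ (fun x => χ x ^ (2 * m + 2) * pd i g x) x (EuclideanSpace.single i 1)
      = χ x ^ (2 * m + 2) * pd i (pd i g) x +
        (2 * m + 2) * χ x ^ (2 * m + 1) * pd i χ x * pd i g x := by
    intro i x
    rw [fderiv_fun_mul ((hd hχ x).fun_pow _) (hd (hg.pd i).1 x), fderiv_fun_pow _ (hd hχ x)]
    simp only [pd, nsmul_eq_mul, _root_.add_apply, _root_.smul_apply, smul_eq_mul]
    push_cast
    ring
  have c1 := fun i => (contDiff_pd hχ i).continuous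
  have c2 := fun i => (hg.pd i).continuous
  have c3 := fun i => ((hg.pd i).pd i).continuous
  have hI : ∀ i, ∫ x, χ x ^ (2 * m + 2) * pd i g x ^ 2 =
      -∫ x, (χ x ^ (2 * m + 2) * pd i (pd i g) x +
        (2 * m + 2) * χ x ^ (2 * m + 1) * pd i χ x * pd i g x) * g x := by
    intro i
    have := integral_mul_fderiv_eq_neg_fderiv_mul_of_integrable (μ := volume)
      (f := fun x => χ x ^ (2 * m + 2) * pd i g x) (g := g) (v := EuclideanSpace.single i 1)
      ?_ ?_ ?_ (fun x _ => ((hd hχ x).pow _).mul (hd (hg.pd i).1 x)) (fun x _ => hd hg.1 x)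
    · simp only [hder] at this
      rw [← this]
      congr 1; funext x; simp only [pd]; ring
    · simp only [hder]
      exact hg.integrable_mul (by fun_prop)
    · exact (hg.pd i).integrable_mul (by fun_prop)
    · exact hg.integrable_mul (by fun_prop)
  have e1 : ∫ x, χ x ^ (2 * m + 2) * gradSq g x =
      ∫ x, -∑ i, (χ x ^ (2 * m + 2) * pd i (pd i g) x +
        (2 * m + 2) * χ x ^ (2 * m + 1) * pd i χ x * pd i g x) * g x := by
    simp only [gradSq, Finset.mul_sum]
    rw [integral_neg, integral_finsetSum, integral_finsetSum, ← Finset.sum_neg_distrib]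
    · exact Finset.sum_congr rfl fun i _ => hI i
    · exact fun i _ => hg.integrable_mul (by fun_prop)
    · exact fun i _ => (hg.pd i).integrable_mul_sq (by fun_prop)
  have iA := hg.lap.integrable_mul_sq (w := fun x => χ x ^ (2 * m + 4)) (by fun_prop)
  have iB := hg.integrable_mul_sq (w := fun x => χ x ^ (2 * m)) (by fun_prop)
  have iC := hg.integrable_mul_gradSq (w := fun x => χ x ^ (2 * m + 2)) (by fun_prop)
  have key : ∫ x, χ x ^ (2 * m + 2) * gradSq g x ≤
      ∫ x, (ε / 2 * (χ x ^ (2 * m + 4) * lap g x ^ 2) +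
        (ε⁻¹ / 2 + 2 * (m + 1) ^ 2 * M) * (χ x ^ (2 * m) * g x ^ 2) +
        1 / 2 * (χ x ^ (2 * m + 2) * gradSq g x)) := by
    rw [e1]
    refine integral_mono (Integrable.neg (integrable_finsetSum _ fun i _ =>
      hg.integrable_mul (by fun_prop))) (((iA.const_mul _).add (iB.const_mul _)).add
      (iC.const_mul _)) fun x => ?_
    simp only
    have hp : 0 ≤ χ x ^ (2 * m) := by rw [pow_mul']; positivity
    have s1 : -∑ i, (χ x ^ (2 * m + 2) * pd i (pd i g) x +
        (2 * m + 2) * χ x ^ (2 * m + 1) * pd i χ x * pd i g x) * g x =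
        χ x ^ (2 * m) * (-(χ x ^ 2 * lap g x * g x) +
          ∑ i, -(2 * (m + 1) * χ x * pd i χ x * pd i g x * g x)) := by
      rw [lap_eq_sum_pd hg.1]
      simp only [Fin.sum_univ_four]
      ring
    have s2 : -(χ x ^ 2 * lap g x * g x) ≤ ε / 2 * (χ x ^ 4 * lap g x ^ 2) + ε⁻¹ / 2 * g x ^ 2 := by
      have : 0 ≤ ε⁻¹ / 2 * (ε * (χ x ^ 2 * lap g x) + g x) ^ 2 := by positivity
      have e : ε⁻¹ / 2 * (ε * (χ x ^ 2 * lap g x) + g x) ^ 2 =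
        ε / 2 * (χ x ^ 4 * lap g x ^ 2) + ε⁻¹ / 2 * g x ^ 2 + χ x ^ 2 * lap g x * g x := by
        field_simp; ring
      linarith
    have s3 : ∑ i, -(2 * (m + 1) * χ x * pd i χ x * pd i g x * g x) ≤
        2 * (m + 1) ^ 2 * g x ^ 2 * M + 1 / 2 * (χ x ^ 2 * gradSq g x) := by
      have : ∑ i, -(2 * (m + 1) * χ x * pd i χ x * pd i g x * g x) ≤
          ∑ i, (2 * (m + 1) ^ 2 * g x ^ 2 * pd i χ x ^ 2 + 1 / 2 * (χ x ^ 2 * pd i g x ^ 2)) := by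
        refine Finset.sum_le_sum fun i _ => ?_
        nlinarith [sq_nonneg (2 * (m + 1) * g x * pd i χ x + χ x * pd i g x)]
      rw [Finset.sum_add_distrib, ← Finset.mul_sum, ← Finset.mul_sum, ← Finset.mul_sum] at this
      refine this.trans ?_
      have h := hM x
      unfold gradSq at h ⊢
      gcongr
    rw [s1]
    have := mul_le_mul_of_nonneg_left (add_le_add s2 s3) hp
    refine this.trans (le_of_eq ?_)
    ring
  rw [integral_add (by exact (iA.const_mul _).add (iB.const_mul _)) (iC.const_mul _),
    integral_add (iA.const_mul _) (iB.const_mul _), integral_const_mul, integral_const_mul,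
    integral_const_mul] at key
  nlinarith

lemma absorb_chain {M : ℝ} (hM : 0 ≤ M) : ∃ C, 0 ≤ C ∧ ∀ τ₀ τ₁ τ₂ τ₃ τ₄ τH : ℝ, 0 ≤ τ₀ → 0 ≤ τ₁ → 0 ≤ τ₄ → 0 ≤ τH →
    τ₂ ≤ 4 * τH →
    (∀ ε > 0, τ₁ ≤ ε * τ₂ + (ε⁻¹ + 4 * M) * τ₀) →
    (∀ ε > 0, τH ≤ ε * τ₃ + (ε⁻¹ + 16 * M) * τ₁) →
    (∀ ε > 0, τ₃ ≤ ε * τ₄ + (ε⁻¹ + 36 * M) * τ₂) →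
    τ₃ + τH + τ₁ + τ₀ ≤ C * (τ₀ + τ₄) := by
  obtain ⟨A, hA⟩ : ∃ A, A = 4 * (1 + 36 * M) := ⟨_, rfl⟩
  obtain ⟨B, hB⟩ : ∃ B, B = 4 * (A + 1) + 32 * M := ⟨_, rfl⟩
  obtain ⟨D, hD⟩ : ∃ D, D = 2 * (8 * (B + 1) + 4 * M) := ⟨_, rfl⟩
  have hA0 : 0 ≤ A := by rw [hA]; positivity
  have hB0 : 0 ≤ B := by rw [hB]; positivity
  have hD0 : 0 ≤ D := by rw [hD]; positivity
  refine ⟨(1 + A) * (1 + B * (1 + D)) + 1 + (1 + D) + 1, by positivity, ?_⟩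
  intro τ₀ τ₁ τ₂ τ₃ τ₄ τH h0 h1 h4 hH h2 f1 f2 f3
  have g3 : τ₃ ≤ τ₄ + A * τH := by
    have := f3 1 one_pos
    rw [inv_one] at this
    have := mul_le_mul_of_nonneg_left h2 (by positivity : 0 ≤ 1 + 36 * M)
    rw [hA]; linarith
  have g2 : τH ≤ τ₄ + B * τ₁ := by
    have h := f2 (2 * (A + 1))⁻¹ (by positivity)
    rw [inv_inv] at h
    have h' := mul_le_mul_of_nonneg_left g3 (by positivity : 0 ≤ (2 * (A + 1))⁻¹)
    have e1 : (2 * (A + 1))⁻¹ * τ₄ ≤ 1 / 2 * τ₄ := by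
      refine mul_le_mul_of_nonneg_right ?_ h4
      rw [inv_le_comm₀ (by positivity) (by positivity)]; linarith
    have e2 : (2 * (A + 1))⁻¹ * A * τH ≤ 1 / 2 * τH := by
      refine mul_le_mul_of_nonneg_right ?_ hH
      rw [inv_mul_le_iff₀ (by positivity)]; linarith
    rw [hB]; linarith
  have g1 : τ₁ ≤ τ₄ + D * τ₀ := by
    have h := f1 (8 * (B + 1))⁻¹ (by positivity)
    rw [inv_inv] at h
    have h' := mul_le_mul_of_nonneg_left (h2.trans (mul_le_mul_of_nonneg_left g2 (by norm_num)))
      (by positivity : 0 ≤ (8 * (B + 1))⁻¹)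
    have e1 : (8 * (B + 1))⁻¹ * τ₄ ≤ 1 / 8 * τ₄ := by
      refine mul_le_mul_of_nonneg_right ?_ h4
      rw [inv_le_comm₀ (by positivity) (by positivity)]; linarith
    have e2 : (8 * (B + 1))⁻¹ * B * τ₁ ≤ 1 / 8 * τ₁ := by
      refine mul_le_mul_of_nonneg_right ?_ h1
      rw [inv_mul_le_iff₀ (by positivity)]; linarith
    rw [hD]; linarith
  have k2 := mul_le_mul_of_nonneg_left g1 hB0
  have k3 := mul_le_mul_of_nonneg_left (g2.trans (add_le_add_right k2 _))
    (by positivity : 0 ≤ 1 + A)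
  have : 0 ≤ B * D * τ₄ := by positivity
  have : 0 ≤ (1 + A) * (B * D * τ₄) := by positivity
  have : 0 ≤ (1 + A) * (B * τ₀ + τ₀) := by positivity
  have : 0 ≤ D * τ₄ := by positivity
  linarith

/-- The sum of squares of all lower-order terms. -/
def lowSq (f : E4 → ℝ) (x : E4) : ℝ :=
  gradSq (lap f) x + ∑ i, gradSq (pd i f) x + gradSq f x + f x ^ 2

/-- Interior estimate for the biharmonic operator, with a cutoff. -/
lemma interior_estimate {χ : E4 → ℝ} (hχ : ContDiff ℝ ∞ χ) {M : ℝ} (hM : ∀ x, gradSq χ x ≤ M)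
    (hχ1 : ∀ x, χ x ^ 2 ≤ 1) :
    ∃ C, 0 ≤ C ∧ ∀ f, IsTest f → ∫ x, χ x ^ 8 * lowSq f x ≤
      C * ((∫ x, f x ^ 2) + ∫ x, χ x ^ 8 * lap (lap f) x ^ 2) := by
  have hM0 : 0 ≤ M := (gradSq_nonneg χ 0).trans (hM 0)
  have hχc := hχ.continuous
  obtain ⟨C, hC, H⟩ := absorb_chain hM0
  refine ⟨C, hC, fun f hf => ?_⟩
  have p : ∀ n x, 0 ≤ χ x ^ (2 * n) := fun n x => by rw [pow_mul]; positivity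
  have p1 : ∀ n x, χ x ^ (2 * n) ≤ 1 := fun n x => by
    rw [pow_mul]; exact pow_le_one₀ (sq_nonneg _) (hχ1 x)
  have pm : ∀ m n, m ≤ n → ∀ x, χ x ^ (2 * n) ≤ χ x ^ (2 * m) := fun m n h x => by
    rw [pow_mul, pow_mul]; exact pow_le_pow_of_le_one (sq_nonneg _) (hχ1 x) h
  have cχ : ∀ n : ℕ, Continuous fun x => χ x ^ n := fun n => by fun_prop
  have i0 : Integrable fun x => f x ^ 2 := by
    simpa using hf.integrable_mul_sq (w := fun _ => 1) continuous_const
  have i1 := fun n => hf.integrable_mul_gradSq (cχ n)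
  have i2 := fun n => hf.lap.integrable_mul_sq (cχ n)
  have i3 := fun n => hf.lap.integrable_mul_gradSq (cχ n)
  have iH : ∀ n, Integrable fun x => χ x ^ n * ∑ i, gradSq (pd i f) x := fun n => by
    simp only [Finset.mul_sum]
    exact integrable_finsetSum _ fun i _ => (hf.pd i).integrable_mul_gradSq (cχ n)
  refine le_trans ?_ (H (∫ x, f x ^ 2) (∫ x, χ x ^ 2 * gradSq f x) (∫ x, χ x ^ 4 * lap f x ^ 2)
    (∫ x, χ x ^ 6 * gradSq (lap f) x) (∫ x, χ x ^ 8 * lap (lap f) x ^ 2)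
    (∫ x, χ x ^ 4 * ∑ i, gradSq (pd i f) x) ?_ ?_ ?_ ?_ ?_ ?_ ?_ ?_)
  · rw [← integral_add (i3 6) (iH 4), ← integral_add (by exact (i3 6).add (iH 4)) (i1 2),
      ← integral_add (by exact ((i3 6).add (iH 4)).add (i1 2)) i0]
    refine integral_mono_of_nonneg (Filter.Eventually.of_forall fun x => ?_)
      ((((i3 6).add (iH 4)).add (i1 2)).add i0) (Filter.Eventually.of_forall fun x => ?_)
    · have hh : 0 ≤ ∑ i, gradSq (pd i f) x := Finset.sum_nonneg fun i _ => gradSq_nonneg _ _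
      have := gradSq_nonneg (lap f) x
      have := gradSq_nonneg f x
      have := p 4 x
      simp only [lowSq, Pi.zero_apply]
      positivity
    · have hh : 0 ≤ ∑ i, gradSq (pd i f) x := Finset.sum_nonneg fun i _ => gradSq_nonneg _ _
      have q3 := mul_le_mul_of_nonneg_right (pm 3 4 (by norm_num) x) (gradSq_nonneg (lap f) x)
      have q2 := mul_le_mul_of_nonneg_right (pm 2 4 (by norm_num) x) hh
      have q1 := mul_le_mul_of_nonneg_right (pm 1 4 (by norm_num) x) (gradSq_nonneg f x)
      have q0 := mul_le_mul_of_nonneg_right (p1 4 x) (sq_nonneg (f x))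
      norm_num at q0 q1 q2 q3
      simp only [lowSq]
      linarith
  · exact integral_nonneg fun x => sq_nonneg _
  · exact integral_nonneg fun x => mul_nonneg (p 1 x) (gradSq_nonneg _ _)
  · exact integral_nonneg fun x => mul_nonneg (p 4 x) (sq_nonneg _)
  · exact integral_nonneg fun x => mul_nonneg (p 2 x) (Finset.sum_nonneg fun i _ =>
      gradSq_nonneg _ _)
  · rw [← integral_const_mul]
    refine integral_mono (i2 4) ((iH 4).const_mul 4) fun x => ?_
    simp only
    rw [mul_left_comm]
    refine mul_le_mul_of_nonneg_left ?_ (p 2 x)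
    rw [lap_eq_sum_pd hf.1]
    refine sq_sum_le_card_mul_sum_sq.trans ?_
    simp only [Finset.card_univ, Fintype.card_fin, Nat.cast_ofNat]
    refine mul_le_mul_of_nonneg_left (Finset.sum_le_sum fun i _ => ?_) (by norm_num)
    exact Finset.single_le_sum (f := fun j => pd j (pd i f) x ^ 2) (fun j _ => sq_nonneg _)
      (Finset.mem_univ i)
  · intro ε hε
    simpa using caccioppoli hχ hf hM 0 hε
  · intro ε hε
    have h := Finset.sum_le_sum fun i (_ : i ∈ Finset.univ) =>
      caccioppoli hχ (hf.pd i) hM 1 hε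
    rw [Finset.sum_add_distrib, ← Finset.mul_sum, ← Finset.mul_sum, ← integral_finsetSum,
      ← integral_finsetSum, ← integral_finsetSum] at h
    · simp only [lap_pd hf.1, ← Finset.mul_sum] at h
      norm_num at h
      exact h
    · exact fun i _ => (hf.pd i).integrable_mul_sq (cχ _)
    · exact fun i _ => (hf.pd i).lap.integrable_mul_sq (cχ _)
    · exact fun i _ => (hf.pd i).integrable_mul_gradSq (cχ _)
  · intro ε hε
    have h := caccioppoli hχ hf.lap hM 2 hε
    norm_num at h
    exact h

lemma exists_cutoff {a b : ℝ} (hab : a < b) :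
    ∃ χ : E4 → ℝ, ∃ X : ℝ → ℝ, ContDiff ℝ ∞ χ ∧ Continuous X ∧ (∀ x, 0 ≤ χ x) ∧ (∀ x, χ x ≤ 1) ∧
      (∀ x ∈ ann (-a) a, χ x = 1) ∧ (∀ x ∉ ann (-b) b, χ x = 0) ∧
      ∀ t (θ : S3), χ (Real.exp t • (θ : E4)) = X t := by
  let ψ : ℝ → ℝ := fun s =>
    Real.smoothTransition ((s - Real.exp (-b) ^ 2) / (Real.exp (-a) ^ 2 - Real.exp (-b) ^ 2)) *
    Real.smoothTransition ((Real.exp b ^ 2 - s) / (Real.exp b ^ 2 - Real.exp a ^ 2))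
  have h1 : 0 < Real.exp (-a) ^ 2 - Real.exp (-b) ^ 2 := by
    have := pow_lt_pow_left₀ (Real.exp_lt_exp.2 (neg_lt_neg hab)) (Real.exp_pos _).le two_ne_zero
    linarith
  have h2 : 0 < Real.exp b ^ 2 - Real.exp a ^ 2 := by
    have := pow_lt_pow_left₀ (Real.exp_lt_exp.2 hab) (Real.exp_pos _).le two_ne_zero
    linarith
  have hψ : ContDiff ℝ ∞ ψ := by
    refine (Real.smoothTransition.contDiff.comp ?_).mul (Real.smoothTransition.contDiff.comp ?_)
    · exact (contDiff_id.sub contDiff_const).div_const _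
    · exact (contDiff_const.sub contDiff_id).div_const _
  have hψc := hψ.continuous
  refine ⟨fun x => ψ (‖x‖ ^ 2), fun t => ψ (Real.exp t ^ 2), hψ.comp (contDiff_norm_sq ℝ),
    by fun_prop, fun x => mul_nonneg (Real.smoothTransition.nonneg _) (Real.smoothTransition.nonneg _),
    fun x => mul_le_one₀ (Real.smoothTransition.le_one _) (Real.smoothTransition.nonneg _)
      (Real.smoothTransition.le_one _), fun x hx => ?_, fun x hx => ?_, fun t θ => ?_⟩
  · have k1 := pow_le_pow_left₀ (Real.exp_pos _).le hx.1 2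
    have k2 := pow_le_pow_left₀ (norm_nonneg _) hx.2 2
    simp only [ψ]
    rw [Real.smoothTransition.one_of_one_le, Real.smoothTransition.one_of_one_le, one_mul]
    · rw [le_div_iff₀ h2]; linarith
    · rw [le_div_iff₀ h1]; linarith
  · simp only [ψ]
    rcases lt_or_ge ‖x‖ (Real.exp (-b)) with h | h
    · rw [Real.smoothTransition.zero_of_nonpos, zero_mul]
      have := pow_le_pow_left₀ (norm_nonneg _) h.le 2
      exact div_nonpos_of_nonpos_of_nonneg (by linarith) h1.le
    · have h' : Real.exp b ≤ ‖x‖ := by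
        by_contra! hc
        exact hx ⟨h, hc.le⟩
      rw [mul_comm, Real.smoothTransition.zero_of_nonpos, zero_mul]
      have := pow_le_pow_left₀ (Real.exp_pos _).le h' 2
      exact div_nonpos_of_nonpos_of_nonneg (by linarith) h2.le
  · have : ‖(θ : E4)‖ = 1 := by simp
    simp [norm_smul, this]

lemma continuous_integral_sphere {f : E4 → ℝ} (hf : Continuous f) :
    Continuous fun t => ∫ θ : S3, f (Real.exp t • (θ : E4)) ∂surf := by
  have h := continuousOn_integral_of_compact_support (μ := surf)
    (f := fun (t : ℝ) (θ : S3) => f (Real.exp t • (θ : E4))) (s := Set.univ) (k := Set.univ)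
    isCompact_univ (by fun_prop) (by simp)
  exact continuousOn_univ.1 h

lemma integral_cutoff_mul {χ g : E4 → ℝ} {X : ℝ → ℝ} {b : ℝ} (hb : 0 ≤ b) (hχ : Continuous χ)
    (hg : Continuous g) (h0 : ∀ x ∉ ann (-b) b, χ x = 0)
    (hX : ∀ t (θ : S3), χ (Real.exp t • (θ : E4)) = X t) :
    ∫ x, χ x ^ 8 * g x = ∫ t in (-b)..b,
      Real.exp (4 * t) * (X t ^ 8 * ∫ θ : S3, g (Real.exp t • (θ : E4)) ∂surf) := by
  rw [← setIntegral_eq_integral_of_forall_compl_eq_zero (s := ann (-b) b)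
    fun x hx => by simp [h0 x hx], integral_ann (by linarith) (by fun_prop)]
  simp only [hX, integral_const_mul]

lemma continuous_gradSq {f : E4 → ℝ} (hf : ContDiff ℝ ∞ f) : Continuous (gradSq f) :=
  continuous_finsetSum _ fun i _ => (contDiff_pd hf i).continuous.pow 2

lemma continuous_lowSq {f : E4 → ℝ} (hf : ContDiff ℝ ∞ f) : Continuous (lowSq f) :=
  (((continuous_gradSq (contDiff_lap hf)).add (continuous_finsetSum _ fun i _ =>
    continuous_gradSq (contDiff_pd hf i))).add (continuous_gradSq hf)).add (hf.continuous.pow 2)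

/-- The three-annulus estimate for a system with small right-hand side. -/
lemma family_estimate (K : ℕ) : ∃ C, 0 ≤ C ∧ ∃ δ, 0 < δ ∧ ∀ η, 0 ≤ η → η ≤ δ →
    ∀ f : Fin K → E4 → ℝ, (∀ k, IsTest (f k)) →
    (∀ t ∈ Set.Icc (-4.45 : ℝ) 4.45, ∑ k, sphereSq (lap (lap (f k))) t ≤
      η * ∑ k, ∫ θ : S3, lowSq (f k) (Real.exp t • (θ : E4)) ∂surf) →
    (∀ k, ∀ t ∈ Set.Icc (-1.5 : ℝ) 1.5, ∫ θ : S3, f k (Real.exp t • (θ : E4)) ∂surf = 0) →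
    45 * ∑ k, ∫ t in (-1.5)..1.5, sphereSq (f k) t ≤
      ∑ k, (∫ t in (-4.4)..(-1.5), sphereSq (f k) t) + ∑ k, (∫ t in (1.5)..4.4, sphereSq (f k) t) +
      C * η * ∑ k, ∫ x, f k x ^ 2 := by
  obtain ⟨χ, X, hχ, hXc, hχ0, hχ1, hone, hzero, hX⟩ := exists_cutoff (a := 4.4) (b := 4.45) (by norm_num)
  have hcs : HasCompactSupport (gradSq χ) := by
    have h : HasCompactSupport χ :=
      HasCompactSupport.intro (ann_isCompact _ _) fun x hx => hzero x hx
    refine h.mono' (fun x hx => ?_)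
    by_contra hc
    refine hx ?_
    have : fderiv ℝ χ x = 0 := by
      by_contra h'
      exact hc (support_fderiv_subset ℝ h')
    simp [gradSq, pd, this]
  obtain ⟨M, hM⟩ := hcs.exists_bound_of_continuous (continuous_gradSq hχ)
  have hM' : ∀ x, gradSq χ x ≤ M := fun x => (le_abs_self _).trans (hM x)
  obtain ⟨C, hC, hint⟩ := interior_estimate hχ hM' fun x => pow_le_one₀ (hχ0 x) (hχ1 x)
  refine ⟨1050 * 8.8 ^ 8 * Real.exp 17.6 * (2 * C), by positivity, (2 * (C + 1))⁻¹, by positivity,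
    fun η hη hηδ f hf hS h0 => ?_⟩
  have hX0 : ∀ t, 0 ≤ X t ^ 8 := fun t => (by decide : Even 8).pow_nonneg _
  have hX1 : ∀ t ∈ Set.Icc (-4.4 : ℝ) 4.4, X t = 1 := fun t ht => by
    have θ : S3 := ⟨EuclideanSpace.single 0 1, by simp⟩
    rw [← hX t θ]
    exact hone _ ((exp_smul_mem_ann θ).2 ht)
  set T := ∑ k, ∫ x, χ x ^ 8 * lap (lap (f k)) x ^ 2 with hT
  set τ := ∑ k, ∫ x, f k x ^ 2 with hτ
  have cl := fun k => (hf k).lap.lap.continuous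
  have cs := fun k => continuous_sphereSq (cl k)
  have cq := fun k => continuous_integral_sphere (continuous_lowSq (hf k).1)
  have eT : T = ∫ t in (-4.45)..4.45, Real.exp (4 * t) * (X t ^ 8 *
      ∑ k, sphereSq (lap (lap (f k))) t) := by
    rw [hT]
    simp only [Finset.mul_sum]
    rw [intervalIntegral.integral_finsetSum fun k _ =>
      Continuous.intervalIntegrable (by have := cs k; fun_prop) _ _]
    refine Finset.sum_congr rfl fun k _ => ?_
    rw [integral_cutoff_mul (g := fun x => lap (lap (f k)) x ^ 2) (by norm_num) hχ.continuous
      (by have := cl k; fun_prop) hzero hX]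
    rfl
  have eQ : ∑ k, ∫ x, χ x ^ 8 * lowSq (f k) x = ∫ t in (-4.45)..4.45, Real.exp (4 * t) * (X t ^ 8 *
      ∑ k, ∫ θ : S3, lowSq (f k) (Real.exp t • (θ : E4)) ∂surf) := by
    simp only [Finset.mul_sum]
    rw [intervalIntegral.integral_finsetSum fun k _ =>
      Continuous.intervalIntegrable (by have := cq k; fun_prop) _ _]
    refine Finset.sum_congr rfl fun k _ => ?_
    rw [integral_cutoff_mul (by norm_num) hχ.continuous
      (continuous_lowSq (hf k).1) hzero hX]
  have hTQ : T ≤ η * ∑ k, ∫ x, χ x ^ 8 * lowSq (f k) x := by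
    rw [eT, eQ, ← intervalIntegral.integral_const_mul]
    refine intervalIntegral.integral_mono_on (by norm_num)
      (Continuous.intervalIntegrable (by fun_prop) _ _)
      (Continuous.intervalIntegrable (by fun_prop) _ _) fun t ht => ?_
    have := mul_le_mul_of_nonneg_left (hS t ht) (mul_nonneg (Real.exp_pos (4 * t)).le (hX0 t))
    linarith
  have hQ : ∑ k, ∫ x, χ x ^ 8 * lowSq (f k) x ≤ C * (τ + T) := by
    rw [hτ, hT, ← Finset.sum_add_distrib, Finset.mul_sum]
    exact Finset.sum_le_sum fun k _ => hint (f k) (hf k)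
  have hτ0 : 0 ≤ τ := Finset.sum_nonneg fun k _ => integral_nonneg fun x => sq_nonneg _
  have hT0 : 0 ≤ T := Finset.sum_nonneg fun k _ => integral_nonneg fun x =>
    mul_nonneg ((by decide : Even 8).pow_nonneg _) (sq_nonneg _)
  have hTτ : T ≤ 2 * C * η * τ := by
    have h1 := hTQ.trans (mul_le_mul_of_nonneg_left hQ hη)
    have h2 : η * C * T ≤ 1 / 2 * T := by
      refine mul_le_mul_of_nonneg_right ?_ hT0
      refine (mul_le_mul_of_nonneg_right hηδ hC).trans ?_
      rw [inv_mul_le_iff₀ (by positivity)]; linarith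
    linarith
  have hmain := Finset.sum_le_sum fun k (_ : k ∈ Finset.univ) =>
    sphereSq_estimate (hf k).1 (h0 k)
  rw [Finset.sum_add_distrib, Finset.sum_add_distrib, ← Finset.mul_sum, ← Finset.mul_sum] at hmain
  refine hmain.trans (add_le_add_right ?_ _)
  have hlast : ∑ k, ∫ t in (-4.4)..4.4, Real.exp (8 * t) * sphereSq (lap (lap (f k))) t ≤
      Real.exp 17.6 * T := by
    have hS0 : ∀ t, 0 ≤ ∑ k, sphereSq (lap (lap (f k))) t := fun t =>
      Finset.sum_nonneg fun k _ => sphereSq_nonneg _ _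
    rw [← intervalIntegral.integral_finsetSum fun k _ =>
      Continuous.intervalIntegrable (by have := cs k; fun_prop) _ _, eT]
    simp only [← Finset.mul_sum]
    calc ∫ t in (-4.4)..4.4, Real.exp (8 * t) * ∑ k, sphereSq (lap (lap (f k))) t
        ≤ ∫ t in (-4.4)..4.4, Real.exp 17.6 * (Real.exp (4 * t) * (X t ^ 8 *
            ∑ k, sphereSq (lap (lap (f k))) t)) := by
          refine intervalIntegral.integral_mono_on (by norm_num)
            (Continuous.intervalIntegrable (by fun_prop) _ _)
            (Continuous.intervalIntegrable (by fun_prop) _ _) fun t ht => ?_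
          rw [hX1 t ht, one_pow, one_mul, ← mul_assoc, ← Real.exp_add]
          refine mul_le_mul_of_nonneg_right (Real.exp_le_exp.2 ?_) (hS0 t)
          have := ht.2
          norm_num at this ⊢
          linarith
      _ ≤ ∫ t in (-4.45)..4.45, Real.exp 17.6 * (Real.exp (4 * t) * (X t ^ 8 *
            ∑ k, sphereSq (lap (lap (f k))) t)) := by
          refine intervalIntegral.integral_mono_interval (by norm_num) (by norm_num) (by norm_num)
            (Filter.Eventually.of_forall fun t => ?_)
            (Continuous.intervalIntegrable (by fun_prop) _ _)
          have := hX0 t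
          have := hS0 t
          simp only [Pi.zero_apply]
          positivity
      _ = _ := by rw [intervalIntegral.integral_const_mul]
  have := mul_le_mul_of_nonneg_left hlast (by positivity : (0:ℝ) ≤ 1050 * 8.8 ^ 8)
  have h3 := mul_le_mul_of_nonneg_left hTτ
    (by positivity : (0:ℝ) ≤ 1050 * 8.8 ^ 8 * Real.exp 17.6)
  linarith

section Systems

section Components
variable {V : Type*} [NormedAddCommGroup V] [NormedSpace ℝ V]

lemma contDiffAt_lap {v : E4 → V} {x : E4} (hv : ContDiffAt ℝ ∞ v x) :
    ContDiffAt ℝ ∞ (lap v) x := by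
  have h : lap v = fun x => ∑ i : Fin 4, fderiv ℝ (fderiv ℝ v) x (EuclideanSpace.single i 1)
      (EuclideanSpace.single i 1) := funext (lap_apply v)
  rw [h]
  refine ContDiffAt.sum fun i _ => ?_
  exact (((hv.fderiv_right (m := ∞) (by simp)).fderiv_right (m := ∞) (by simp)).clm_apply
    contDiffAt_const).clm_apply contDiffAt_const

lemma lap_clm_comp {W : Type*} [NormedAddCommGroup W] [NormedSpace ℝ W] (A : V →L[ℝ] W)
    {v : E4 → V} {x : E4} (hv : ContDiffAt ℝ ∞ v x) : lap (fun y => A (v y)) x = A (lap v x) := by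
  have h := A.iteratedFDeriv_comp_left (i := 2) hv (WithTop.coe_le_coe.2 le_top)
  simp only [lap, map_sum]
  refine Finset.sum_congr rfl fun i _ => ?_
  exact congrArg (fun T : ContinuousMultilinearMap ℝ (fun _ : Fin 2 => E4) W =>
    T ![EuclideanSpace.single i (1 : ℝ), EuclideanSpace.single i (1 : ℝ)]) h

lemma pd_clm_comp {W : Type*} [NormedAddCommGroup W] [NormedSpace ℝ W] (A : V →L[ℝ] W)
    {v : E4 → V} {x : E4} (hv : ContDiffAt ℝ ∞ v x) (i : Fin 4) :
    pd i (fun y => A (v y)) x = A (pd i v x) := by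
  have h := (A.hasFDerivAt.comp x (hv.differentiableAt (by simp)).hasFDerivAt).fderiv
  have h' : fderiv ℝ (fun y => A (v y)) x = A.comp (fderiv ℝ v x) := h
  rw [pd, h']; rfl

lemma contDiffAt_pd {v : E4 → V} {x : E4} (hv : ContDiffAt ℝ ∞ v x) (i : Fin 4) :
    ContDiffAt ℝ ∞ (pd i v) x :=
  (hv.fderiv_right (m := ∞) (by simp)).clm_apply contDiffAt_const

lemma eventuallyEq_lap {f g : E4 → V} {x : E4} (h : f =ᶠ[nhds x] g) :
    lap f =ᶠ[nhds x] lap g := by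
  filter_upwards [h.eventuallyEq_nhds] with y hy
  simp only [lap_apply, hy.fderiv.fderiv_eq]

lemma eventuallyEq_pd {f g : E4 → V} {x : E4} (h : f =ᶠ[nhds x] g) (i : Fin 4) :
    pd i f =ᶠ[nhds x] pd i g := by
  filter_upwards [h.eventuallyEq_nhds] with y hy
  simp only [pd, hy.fderiv_eq]

lemma norm_clm_sq_le (A : E4 →L[ℝ] V) :
    ‖A‖ ^ 2 ≤ ∑ i, ‖A (EuclideanSpace.single i 1)‖ ^ 2 := by
  have h0 : 0 ≤ ∑ i, ‖A (EuclideanSpace.single i 1)‖ ^ 2 :=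
    Finset.sum_nonneg fun _ _ => sq_nonneg _
  have : ‖A‖ ≤ √(∑ i, ‖A (EuclideanSpace.single i 1)‖ ^ 2) := by
    refine A.opNorm_le_bound (Real.sqrt_nonneg _) fun x => ?_
    conv_lhs => rw [eq_sum_single x]
    rw [map_sum]
    refine (norm_sum_le _ _).trans ?_
    simp only [map_smul, norm_smul]
    refine (Real.sum_mul_le_sqrt_mul_sqrt _ _ _).trans (le_of_eq ?_)
    rw [mul_comm, EuclideanSpace.norm_eq]
  calc ‖A‖ ^ 2 ≤ √(∑ i, ‖A (EuclideanSpace.single i 1)‖ ^ 2) ^ 2 :=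
        pow_le_pow_left₀ (norm_nonneg _) this 2
    _ = _ := Real.sq_sqrt h0

end Components

variable {K : ℕ}

/-- The weighted sum of the norms of all lower-order terms. -/
def lowNorm (v : E4 → EuclideanSpace ℝ (Fin K)) (x : E4) : ℝ :=
  ‖fderiv ℝ (lap v) x‖ / ‖x‖ + ‖fderiv ℝ (fderiv ℝ v) x‖ / ‖x‖ ^ 2 + ‖fderiv ℝ v x‖ / ‖x‖ ^ 3 +
    ‖v x‖ / ‖x‖ ^ 4

lemma lowNorm_nonneg (v : E4 → EuclideanSpace ℝ (Fin K)) (x : E4) : 0 ≤ lowNorm v x := by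
  unfold lowNorm; positivity

lemma norm_sq_eq_sum (w : EuclideanSpace ℝ (Fin K)) : ‖w‖ ^ 2 = ∑ k, w k ^ 2 :=
  EuclideanSpace.real_norm_sq_eq w

section Open
variable {U : Set E4} {v : E4 → EuclideanSpace ℝ (Fin K)} {f : E4 → ℝ} {k : Fin K}

lemma pd_component (hU : IsOpen U) (hv : ∀ x ∈ U, ContDiffAt ℝ ∞ v x) (h : ∀ x ∈ U, f x = v x k)
    (i : Fin 4) : ∀ x ∈ U, pd i f x = pd i v x k := fun x hx => by
  have e : f =ᶠ[nhds x] fun y => (EuclideanSpace.proj k : _ →L[ℝ] ℝ) (v y) := by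
    filter_upwards [hU.mem_nhds hx] with y hy
    exact h y hy
  exact ((eventuallyEq_pd e i).eq_of_nhds).trans (pd_clm_comp _ (hv x hx) i)

lemma lap_component (hU : IsOpen U) (hv : ∀ x ∈ U, ContDiffAt ℝ ∞ v x)
    (h : ∀ x ∈ U, f x = v x k) : ∀ x ∈ U, lap f x = lap v x k := fun x hx => by
  have e : f =ᶠ[nhds x] fun y => (EuclideanSpace.proj k : _ →L[ℝ] ℝ) (v y) := by
    filter_upwards [hU.mem_nhds hx] with y hy
    exact h y hy
  exact ((eventuallyEq_lap e).eq_of_nhds).trans (lap_clm_comp _ (hv x hx))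

/-- The lower-order terms of a map are controlled by those of its components. -/
lemma lowNorm_le {f : Fin K → E4 → ℝ} (hU : IsOpen U) (hv : ∀ x ∈ U, ContDiffAt ℝ ∞ v x)
    (hf : ∀ k, ContDiff ℝ ∞ (f k)) (h : ∀ k, ∀ x ∈ U, f k x = v x k) {R : ℝ} (hR : 1 ≤ R) {x : E4}
    (hxU : x ∈ U) (hx : R⁻¹ ≤ ‖x‖) :
    lowNorm v x ≤ 4 * R ^ 4 * √(∑ k, lowSq (f k) x) := by
  have hR0 : 0 < R := by linarith
  have hx0 : 0 < ‖x‖ := (inv_pos.2 hR0).trans_le hx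
  have hg : ∀ (f : E4 → ℝ) x, 0 ≤ gradSq f x := gradSq_nonneg
  have hH : ∀ k, 0 ≤ ∑ i, gradSq (pd i (f k)) x := fun k => Finset.sum_nonneg fun i _ => hg _ _
  have b1 : ‖fderiv ℝ (lap v) x‖ ≤ √(∑ k, lowSq (f k) x) := by
    refine Real.le_sqrt_of_sq_le ((norm_clm_sq_le _).trans ?_)
    simp only [norm_sq_eq_sum]
    rw [Finset.sum_comm]
    refine Finset.sum_le_sum fun k _ => ?_
    have e : ∑ i, (fderiv ℝ (lap v) x (EuclideanSpace.single i 1)) k ^ 2 = gradSq (lap (f k)) x :=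
      Finset.sum_congr rfl fun i _ => by
        rw [pd_component hU (fun x hx => contDiffAt_lap (hv x hx)) (lap_component hU hv (h k)) i x hxU]; rfl
    rw [e]
    have := hg (f k) x
    have := hH k
    have := sq_nonneg (f k x)
    unfold lowSq; linarith
  have b2 : ‖fderiv ℝ (fderiv ℝ v) x‖ ≤ √(∑ k, lowSq (f k) x) := by
    refine Real.le_sqrt_of_sq_le ((norm_clm_sq_le _).trans ?_)
    refine (Finset.sum_le_sum fun i _ => norm_clm_sq_le _).trans ?_
    simp only [norm_sq_eq_sum]
    have e : ∀ i j k, fderiv ℝ (fderiv ℝ v) x (EuclideanSpace.single i 1)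
        (EuclideanSpace.single j 1) k = pd j (pd i (f k)) x := by
      intro i j k
      rw [pd_comm (hf k), pd_component hU (fun x hx => contDiffAt_pd (hv x hx) j)
        (pd_component hU hv (h k) j) i x hxU]
      have h1 : DifferentiableAt ℝ (fderiv ℝ v) x :=
        ((hv x hxU).fderiv_right (m := ∞) (by simp)).differentiableAt (by simp)
      have h3 : pd j v = fun y => fderiv ℝ v y (EuclideanSpace.single j 1) := rfl
      rw [pd, h3, fderiv_clm_apply h1 (differentiableAt_const _)]
      simp
    simp only [e]
    have e2 : ∑ i, ∑ j, ∑ k, pd j (pd i (f k)) x ^ 2 = ∑ k, ∑ i, gradSq (pd i (f k)) x := by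
      simp only [gradSq]
      rw [Finset.sum_comm (s := (Finset.univ : Finset (Fin K)))]
      exact Finset.sum_congr rfl fun i _ => Finset.sum_comm
    rw [e2]
    refine Finset.sum_le_sum fun k _ => ?_
    have := hg (f k) x
    have := hg (lap (f k)) x
    have := sq_nonneg (f k x)
    unfold lowSq; linarith
  have b3 : ‖fderiv ℝ v x‖ ≤ √(∑ k, lowSq (f k) x) := by
    refine Real.le_sqrt_of_sq_le ((norm_clm_sq_le _).trans ?_)
    simp only [norm_sq_eq_sum]
    rw [Finset.sum_comm]
    refine Finset.sum_le_sum fun k _ => ?_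
    have e : ∑ i, (fderiv ℝ v x (EuclideanSpace.single i 1)) k ^ 2 = gradSq (f k) x :=
      Finset.sum_congr rfl fun i _ => by
        rw [pd_component hU hv (h k) i x hxU]; rfl
    rw [e]
    have := hg (lap (f k)) x
    have := hH k
    have := sq_nonneg (f k x)
    unfold lowSq; linarith
  have b4 : ‖v x‖ ≤ √(∑ k, lowSq (f k) x) := by
    refine Real.le_sqrt_of_sq_le ?_
    rw [norm_sq_eq_sum]
    refine Finset.sum_le_sum fun k _ => ?_
    rw [← h k x hxU]
    have := hg (f k) x
    have := hg (lap (f k)) x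
    have := hH k
    unfold lowSq; linarith
  set W := √(∑ k, lowSq (f k) x)
  have hW : 0 ≤ W := Real.sqrt_nonneg _
  have key : ∀ n : ℕ, n ≤ 4 → ∀ a : ℝ, a ≤ W → a / ‖x‖ ^ n ≤ R ^ 4 * W := fun n hn a ha => by
    have h1 : (‖x‖ ^ n)⁻¹ ≤ R ^ 4 := by
      rw [← inv_pow]
      exact (pow_le_pow_left₀ (by positivity) ((inv_le_comm₀ hR0 hx0).1 hx) n).trans
        (pow_le_pow_right₀ hR hn)
    calc a / ‖x‖ ^ n = (‖x‖ ^ n)⁻¹ * a := by rw [div_eq_inv_mul]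
      _ ≤ (‖x‖ ^ n)⁻¹ * W := by gcongr
      _ ≤ _ := by gcongr
  have k1 := key 1 (by norm_num) _ b1
  rw [pow_one] at k1
  have k2 := key 2 (by norm_num) _ b2
  have k3 := key 3 (by norm_num) _ b3
  have k4 := key 4 (by norm_num) _ b4
  unfold lowNorm
  linarith

end Open

lemma norm_exp_smul (t : ℝ) (θ : S3) : ‖Real.exp t • (θ : E4)‖ = Real.exp t := by
  have : ‖(θ : E4)‖ = 1 := by simp
  simp [norm_smul, this]

/-- The average of `g` over the unit sphere. -/
def avg (g : S3 → ℝ) : ℝ := (surf.real Set.univ)⁻¹ * ∫ θ, g θ ∂surf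

lemma avg_sq_le {g : S3 → ℝ} (hg : Continuous g) :
    surf.real Set.univ * avg g ^ 2 ≤ ∫ θ, g θ ^ 2 ∂surf := by
  have hs := surf_univ_pos
  have h0 : 0 ≤ ∫ θ, (g θ - avg g) ^ 2 ∂surf := integral_nonneg fun _ => sq_nonneg _
  have e : ∀ θ, (g θ - avg g) ^ 2 = g θ ^ 2 - 2 * avg g * g θ + avg g ^ 2 := fun θ => by ring
  have i1 := integrable_surf (f := fun θ => g θ ^ 2) (by fun_prop)
  have i2 := integrable_surf (f := fun θ => 2 * avg g * g θ) (by fun_prop)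
  simp only [e] at h0
  rw [integral_add (by exact i1.sub i2) (integrable_const _), integral_sub i1 i2,
    integral_const_mul, integral_const, smul_eq_mul] at h0
  have e2 : ∫ θ, g θ ∂surf = surf.real Set.univ * avg g := by
    rw [avg, ← mul_assoc, mul_inv_cancel₀ hs.ne', one_mul]
  rw [e2] at h0
  linarith

lemma avg_mono {g h : S3 → ℝ} (hg : ∀ θ, 0 ≤ g θ) (hgh : ∀ θ, g θ ≤ h θ) (hh : Continuous h) :
    avg g ≤ avg h :=
  mul_le_mul_of_nonneg_left (integral_mono_of_nonneg (Filter.Eventually.of_forall hg)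
    (integrable_surf hh) (Filter.Eventually.of_forall hgh)) (inv_nonneg.2 surf_univ_pos.le)

/-- A pointwise bound by a function and its spherical mean gives an `L²` bound on the sphere. -/
lemma integral_sq_le {A g : S3 → ℝ} {c : ℝ} (hA : ∀ θ, 0 ≤ A θ) (hg : Continuous g)
    (h : ∀ θ, A θ ≤ c * (g θ + avg g)) :
    ∫ θ, A θ ^ 2 ∂surf ≤ 4 * c ^ 2 * ∫ θ, g θ ^ 2 ∂surf := by
  have i1 := integrable_surf (f := fun θ => g θ ^ 2) (by fun_prop)
  have h1 : ∫ θ, A θ ^ 2 ∂surf ≤ ∫ θ, 2 * c ^ 2 * (g θ ^ 2 + avg g ^ 2) ∂surf := by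
    refine integral_mono_of_nonneg (Filter.Eventually.of_forall fun θ => sq_nonneg _)
      ((i1.add (integrable_const _)).const_mul _) (Filter.Eventually.of_forall fun θ => ?_)
    have h2 := pow_le_pow_left₀ (hA θ) (h θ) 2
    simp only
    nlinarith [mul_nonneg (sq_nonneg c) (sq_nonneg (g θ - avg g))]
  rw [integral_const_mul, integral_add i1 (integrable_const _), integral_const, smul_eq_mul] at h1
  have := mul_le_mul_of_nonneg_left (avg_sq_le hg) (by positivity : 0 ≤ 2 * c ^ 2)
  linarith

/-- The squared `L²` norm of `v` on the sphere of logarithmic radius `t`. -/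
def sphereNormSq (v : E4 → EuclideanSpace ℝ (Fin K)) (t : ℝ) : ℝ :=
  ∫ θ : S3, ‖v (Real.exp t • (θ : E4))‖ ^ 2 ∂surf

lemma sphereNormSq_nonneg (v : E4 → EuclideanSpace ℝ (Fin K)) (t : ℝ) : 0 ≤ sphereNormSq v t :=
  integral_nonneg fun _ => sq_nonneg _

lemma sum_sphereSq {f : Fin K → E4 → ℝ} (hf : ∀ k, Continuous (f k)) (t : ℝ) :
    ∑ k, sphereSq (f k) t = ∫ θ : S3, ∑ k, f k (Real.exp t • (θ : E4)) ^ 2 ∂surf := by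
  rw [integral_finsetSum]
  · rfl
  · intro k _
    have := hf k
    exact integrable_surf (by fun_prop)

/-- The three-circle inequality on logarithmic annuli. -/
lemma annulus_estimate (K : ℕ) : ∃ η : ℝ, 0 < η ∧ ∀ v : E4 → EuclideanSpace ℝ (Fin K),
    ContDiffOn ℝ ∞ v (ann (-4.5) 4.5) →
    (∀ t ∈ Set.Icc (-4.45 : ℝ) 4.45, ∀ θ : S3, ‖lap (lap v) (Real.exp t • (θ : E4))‖ ≤
      η * (lowNorm v (Real.exp t • (θ : E4)) +
        avg fun θ => lowNorm v (Real.exp t • (θ : E4)))) →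
    (∀ t ∈ Set.Icc (-1.5 : ℝ) 1.5, ∫ θ : S3, v (Real.exp t • (θ : E4)) ∂surf = 0) →
    44.5 * ∫ t in (-1.5)..1.5, sphereNormSq v t ≤
      (∫ t in (-4.5)..(-1.5), sphereNormSq v t) + ∫ t in (1.5)..4.5, sphereNormSq v t := by
  obtain ⟨C, hC, δ, hδ, hfam⟩ := family_estimate K
  obtain ⟨ζ, Z, hζ, hZ, hζ0, hζ1, hone, hzero, hX⟩ :=
    exists_cutoff (a := 4.46) (b := 4.48) (by norm_num)
  obtain ⟨R, hRdef⟩ : ∃ R, R = Real.exp 4.5 := ⟨_, rfl⟩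
  have hR : 1 ≤ R := by rw [hRdef]; exact Real.one_le_exp (by norm_num)
  have hR0 : 0 < R := by linarith
  obtain ⟨c, hc⟩ : ∃ c, c = 4 * (4 * R ^ 4) ^ 2 := ⟨_, rfl⟩
  have hc0 : 0 < c := by rw [hc]; positivity
  obtain ⟨η, hη, hη1, hη2⟩ : ∃ η : ℝ, 0 < η ∧ c * η ^ 2 ≤ δ ∧
      C * (c * η ^ 2) * R ^ 4 ≤ 0.01 := by
    have hm : 0 < min δ (0.01 / ((C + 1) * R ^ 4)) / c := by positivity
    refine ⟨√(min δ (0.01 / ((C + 1) * R ^ 4)) / c), Real.sqrt_pos.2 hm, ?_, ?_⟩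
    · rw [Real.sq_sqrt hm.le, mul_div_cancel₀ _ hc0.ne']
      exact min_le_left _ _
    · rw [Real.sq_sqrt hm.le, mul_div_cancel₀ _ hc0.ne']
      have h1 := min_le_right δ (0.01 / ((C + 1) * R ^ 4))
      rw [le_div_iff₀ (by positivity)] at h1
      have h2 : 0 ≤ min δ (0.01 / ((C + 1) * R ^ 4)) * R ^ 4 := by positivity
      linarith
  refine ⟨η, hη, fun v hv heq h0 => ?_⟩
  set f : Fin K → E4 → ℝ := fun k x => ζ x * v x k with hfdef
  have hO : ∀ b : ℝ, IsOpen {x : E4 | Real.exp (-b) < ‖x‖ ∧ ‖x‖ < Real.exp b} := fun b =>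
    (isOpen_lt continuous_const continuous_norm).inter (isOpen_lt continuous_norm continuous_const)
  have hvat : ∀ x ∈ {x : E4 | Real.exp (-4.5) < ‖x‖ ∧ ‖x‖ < Real.exp 4.5}, ContDiffAt ℝ ∞ v x :=
    fun x hx => hv.contDiffAt (Filter.mem_of_superset ((hO 4.5).mem_nhds hx)
      fun y hy => ⟨hy.1.le, hy.2.le⟩)
  have hf : ∀ k, IsTest (f k) := fun k => by
    refine ⟨contDiff_iff_contDiffAt.2 fun x => ?_,
      HasCompactSupport.intro (ann_isCompact (-4.48) 4.48) fun x hx => by simp [hfdef, hzero x hx]⟩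
    by_cases hx : x ∈ {x : E4 | Real.exp (-4.5) < ‖x‖ ∧ ‖x‖ < Real.exp 4.5}
    · exact hζ.contDiffAt.mul ((EuclideanSpace.proj k : _ →L[ℝ] ℝ).contDiff.contDiffAt.comp x
        (hvat x hx))
    · have hx' : x ∉ ann (-4.48) 4.48 := fun h => hx
        ⟨(Real.exp_lt_exp.2 (by norm_num)).trans_le h.1, h.2.trans_lt (Real.exp_lt_exp.2 (by norm_num))⟩
      have : f k =ᶠ[nhds x] fun _ => 0 := by
        filter_upwards [(ann_isCompact (-4.48) 4.48).isClosed.isOpen_compl.mem_nhds hx'] with y hy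
        simp [hfdef, hzero y hy]
      exact contDiffAt_const.congr_of_eventuallyEq this
  obtain ⟨U, hUdef⟩ : ∃ U, U = {x : E4 | Real.exp (-4.46) < ‖x‖ ∧ ‖x‖ < Real.exp 4.46} := ⟨_, rfl⟩
  have hU : IsOpen U := hUdef ▸ hO 4.46
  have hvU : ∀ x ∈ U, ContDiffAt ℝ ∞ v x := fun x hx => by
    rw [hUdef] at hx
    exact hvat x ⟨(Real.exp_lt_exp.2 (by norm_num)).trans hx.1,
      hx.2.trans (Real.exp_lt_exp.2 (by norm_num))⟩
  have hfU : ∀ k, ∀ x ∈ U, f k x = v x k := fun k x hx => by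
    rw [hUdef] at hx
    simp [hfdef, hone x ⟨hx.1.le, hx.2.le⟩]
  have hmemU : ∀ t ∈ Set.Icc (-4.45 : ℝ) 4.45, ∀ θ : S3, Real.exp t • (θ : E4) ∈ U := by
    intro t ht θ
    rw [hUdef]
    simp only [Set.mem_ofPred_eq, norm_exp_smul, Real.exp_lt_exp]
    constructor <;> linarith [ht.1, ht.2]
  have hsys : ∀ t ∈ Set.Icc (-4.45 : ℝ) 4.45, ∑ k, sphereSq (lap (lap (f k))) t ≤
      c * η ^ 2 * ∑ k, ∫ θ : S3, lowSq (f k) (Real.exp t • (θ : E4)) ∂surf := by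
    intro t ht
    have cl := fun k => continuous_lowSq (hf k).1
    have l0 : ∀ x, 0 ≤ ∑ k, lowSq (f k) x := fun x => Finset.sum_nonneg fun k _ => by
      have h1 : 0 ≤ ∑ i, gradSq (pd i (f k)) x := Finset.sum_nonneg fun i _ => gradSq_nonneg _ _
      have h2 := gradSq_nonneg (lap (f k)) x
      have h3 := gradSq_nonneg (f k) x
      unfold lowSq; positivity
    have e1 : ∑ k, sphereSq (lap (lap (f k))) t =
        ∫ θ : S3, ‖lap (lap v) (Real.exp t • (θ : E4))‖ ^ 2 ∂surf := by
      rw [sum_sphereSq fun k => (hf k).lap.lap.continuous]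
      congr 1; funext θ
      rw [norm_sq_eq_sum]
      refine Finset.sum_congr rfl fun k _ => ?_
      rw [lap_component hU (fun x hx => contDiffAt_lap (hvU x hx))
        (lap_component hU hvU (hfU k)) _ (hmemU t ht θ)]
    have cg : Continuous fun θ : S3 => √(∑ k, lowSq (f k) (Real.exp t • (θ : E4))) :=
      Real.continuous_sqrt.comp (continuous_finsetSum _ fun k _ =>
        (cl k).comp (by fun_prop))
    have hlow : ∀ θ : S3, lowNorm v (Real.exp t • (θ : E4)) ≤
        4 * R ^ 4 * √(∑ k, lowSq (f k) (Real.exp t • (θ : E4))) := fun θ =>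
      lowNorm_le hU hvU (fun k => (hf k).1) hfU hR (hmemU t ht θ) (by
        rw [norm_exp_smul, hRdef, ← Real.exp_neg, Real.exp_le_exp]
        linarith [ht.1])
    rw [e1]
    refine (integral_sq_le (c := η * (4 * R ^ 4)) (fun θ => norm_nonneg _) cg
      fun θ => ?_).trans (le_of_eq ?_)
    · refine (heq t ht θ).trans ?_
      rw [mul_assoc, mul_add (4 * R ^ 4)]
      refine mul_le_mul_of_nonneg_left (add_le_add (hlow θ) ?_) hη.le
      refine (avg_mono (fun θ => lowNorm_nonneg _ _) hlow (by fun_prop)).trans (le_of_eq ?_)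
      rw [avg, avg, integral_const_mul]; ring
    · simp only [Real.sq_sqrt (l0 _)]
      rw [integral_finsetSum]
      · rw [hc]; ring
      · exact fun k _ => integrable_surf ((cl k).comp (by fun_prop))
  have hcv : ∀ t ∈ Set.Icc (-4.5 : ℝ) 4.5,
      Continuous fun θ : S3 => v (Real.exp t • (θ : E4)) := fun t ht =>
    hv.continuousOn.comp_continuous (by fun_prop) fun θ => (exp_smul_mem_ann θ).2 ht
  have hmean : ∀ k, ∀ t ∈ Set.Icc (-1.5 : ℝ) 1.5,
      ∫ θ : S3, f k (Real.exp t • (θ : E4)) ∂surf = 0 := by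
    intro k t ht
    have hi : Integrable (fun θ : S3 => v (Real.exp t • (θ : E4))) surf :=
      (hcv t ⟨by linarith [ht.1], by linarith [ht.2]⟩).integrable_of_hasCompactSupport
        (HasCompactSupport.of_compactSpace _)
    have h := (EuclideanSpace.proj k : EuclideanSpace ℝ (Fin K) →L[ℝ] ℝ).integral_comp_comm hi
    rw [h0 t ht, map_zero] at h
    rw [← h]
    refine integral_congr_ae (Filter.Eventually.of_forall fun θ => ?_)
    exact hfU k _ (hmemU t ⟨by linarith [ht.1], by linarith [ht.2]⟩ θ)
  have hN : ContinuousOn (sphereNormSq v) (Set.Icc (-4.5) 4.5) :=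
    continuousOn_sphere_integral (F := fun x => ‖v x‖ ^ 2) (hv.continuousOn.norm.pow 2)
  have hNi : ∀ a b, -4.5 ≤ a → a ≤ b → b ≤ 4.5 →
      IntervalIntegrable (sphereNormSq v) volume a b := fun a b ha hab hb =>
    (hN.mono (Set.Icc_subset_Icc ha hb)).intervalIntegrable_of_Icc hab
  have hsN : ∀ t ∈ Set.Icc (-4.4 : ℝ) 4.4, ∑ k, sphereSq (f k) t = sphereNormSq v t := by
    intro t ht
    rw [sum_sphereSq fun k => (hf k).continuous]
    refine integral_congr_ae (Filter.Eventually.of_forall fun θ => ?_)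
    simp only [norm_sq_eq_sum]
    refine Finset.sum_congr rfl fun k _ => ?_
    rw [hfU k _ (hmemU t ⟨by linarith [ht.1], by linarith [ht.2]⟩ θ)]
  have hsum : ∀ a b, -4.4 ≤ a → a ≤ b → b ≤ 4.4 →
      ∑ k, ∫ t in a..b, sphereSq (f k) t = ∫ t in a..b, sphereNormSq v t := by
    intro a b ha hab hb
    rw [← intervalIntegral.integral_finsetSum fun k _ =>
      (continuous_sphereSq (hf k).continuous).intervalIntegrable _ _]
    refine intervalIntegral.integral_congr fun t ht => ?_
    rw [Set.uIcc_of_le hab] at ht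
    exact hsN t ⟨ha.trans ht.1, ht.2.trans hb⟩
  have hL2 : ∑ k, ∫ x, f k x ^ 2 ≤ R ^ 4 * ∫ t in (-4.5)..4.5, sphereNormSq v t := by
    have hout : ∀ x ∉ ann (-4.5) 4.5, ζ x = 0 := fun x hx => hzero x fun h => hx
      ⟨(Real.exp_le_exp.2 (by norm_num)).trans h.1, h.2.trans (Real.exp_le_exp.2 (by norm_num))⟩
    have e : ∀ k, ∫ x, f k x ^ 2 = ∫ t in (-4.5)..4.5, Real.exp (4 * t) * sphereSq (f k) t := by
      intro k
      rw [← setIntegral_eq_integral_of_forall_compl_eq_zero (s := ann (-4.5) 4.5)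
        fun x hx => by simp [hfdef, hout x hx], integral_ann (F := fun x => f k x ^ 2)
        (by norm_num) ((hf k).continuous.pow 2).continuousOn]
      rfl
    have cs := fun k => continuous_sphereSq (hf k).continuous
    simp only [e]
    rw [← intervalIntegral.integral_finsetSum fun k _ =>
      Continuous.intervalIntegrable (by have := cs k; fun_prop) _ _,
      ← intervalIntegral.integral_const_mul]
    refine intervalIntegral.integral_mono_on (by norm_num)
      (Continuous.intervalIntegrable (by fun_prop) _ _)
      ((hNi _ _ le_rfl (by norm_num) le_rfl).const_mul _) fun t ht => ?_
    rw [← Finset.mul_sum]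
    refine mul_le_mul ?_ ?_ (Finset.sum_nonneg fun k _ => sphereSq_nonneg _ _) (by positivity)
    · rw [hRdef, ← Real.exp_nat_mul, Real.exp_le_exp]
      push_cast
      linarith [ht.2]
    · rw [sum_sphereSq fun k => (hf k).continuous]
      have := hcv t ht
      refine integral_mono_of_nonneg (Filter.Eventually.of_forall fun θ =>
        Finset.sum_nonneg fun k _ => sq_nonneg _) (integrable_surf (this.norm.pow 2))
        (Filter.Eventually.of_forall fun θ => ?_)
      simp only [norm_sq_eq_sum, hfdef, mul_pow]
      refine Finset.sum_le_sum fun k _ => mul_le_of_le_one_left (sq_nonneg _) ?_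
      exact pow_le_one₀ (hζ0 _) (hζ1 _)
  have hmain := hfam (c * η ^ 2) (by positivity) hη1 f hf hsys hmean
  rw [hsum _ _ (by norm_num) (by norm_num) (by norm_num),
    hsum _ _ (by norm_num) (by norm_num) (by norm_num),
    hsum _ _ (by norm_num) (by norm_num) (by norm_num)] at hmain
  have hpos : ∀ a b, a ≤ b → 0 ≤ ∫ t in a..b, sphereNormSq v t := fun a b hab =>
    intervalIntegral.integral_nonneg hab fun t _ => sphereNormSq_nonneg v t
  have s1 : (∫ t in (-4.5)..(-1.5), sphereNormSq v t) = (∫ t in (-4.5)..(-4.4), sphereNormSq v t) +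
      ∫ t in (-4.4)..(-1.5), sphereNormSq v t :=
    (intervalIntegral.integral_add_adjacent_intervals (hNi _ _ (by norm_num) (by norm_num)
      (by norm_num)) (hNi _ _ (by norm_num) (by norm_num) (by norm_num))).symm
  have s2 : (∫ t in (1.5)..4.5, sphereNormSq v t) = (∫ t in (1.5)..4.4, sphereNormSq v t) +
      ∫ t in (4.4)..4.5, sphereNormSq v t :=
    (intervalIntegral.integral_add_adjacent_intervals (hNi _ _ (by norm_num) (by norm_num)
      (by norm_num)) (hNi _ _ (by norm_num) (by norm_num) (by norm_num))).symm
  have s3 : (∫ t in (-4.5)..4.5, sphereNormSq v t) = (∫ t in (-4.5)..(-1.5), sphereNormSq v t) +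
      (∫ t in (-1.5)..1.5, sphereNormSq v t) + ∫ t in (1.5)..4.5, sphereNormSq v t := by
    rw [intervalIntegral.integral_add_adjacent_intervals (hNi _ _ (by norm_num) (by norm_num)
      (by norm_num)) (hNi _ _ (by norm_num) (by norm_num) (by norm_num)),
      intervalIntegral.integral_add_adjacent_intervals (hNi _ _ (by norm_num) (by norm_num)
      (by norm_num)) (hNi _ _ (by norm_num) (by norm_num) (by norm_num))]
  have p1 := hpos (-4.5) (-4.4) (by norm_num)
  have p2 := hpos 4.4 4.5 (by norm_num)
  have p3 := hpos (-4.5) (-1.5) (by norm_num)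
  have p4 := hpos (-1.5) 1.5 (by norm_num)
  have p5 := hpos 1.5 4.5 (by norm_num)
  have hb : C * (c * η ^ 2) * ∑ k, ∫ x, f k x ^ 2 ≤
      0.01 * ∫ t in (-4.5)..4.5, sphereNormSq v t := by
    calc C * (c * η ^ 2) * ∑ k, ∫ x, f k x ^ 2 ≤
        C * (c * η ^ 2) * (R ^ 4 * ∫ t in (-4.5)..4.5, sphereNormSq v t) :=
          mul_le_mul_of_nonneg_left hL2 (by positivity)
      _ = C * (c * η ^ 2) * R ^ 4 * ∫ t in (-4.5)..4.5, sphereNormSq v t := by ring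
      _ ≤ _ := mul_le_mul_of_nonneg_right hη2 (hpos _ _ (by norm_num))
  rw [s3] at hb
  linarith

section Dilation
variable {V : Type*} [NormedAddCommGroup V] [NormedSpace ℝ V]

lemma fderiv_const_smul_any (c : ℝ) (f : E4 → V) :
    fderiv ℝ (fun y => c • f y) = fun y => c • fderiv ℝ f y := by
  funext y
  rcases eq_or_ne c 0 with rfl | hc
  · simp
  · let _ := invertibleOfNonzero hc
    exact fderiv_const_smul_of_invertible c

lemma fderiv_comp_dilation (c : ℝ) (f : E4 → V) :
    fderiv ℝ (fun y => f (c • y)) = fun y => c • fderiv ℝ f (c • y) :=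
  funext fun _ => fderiv_comp_smul c

lemma fderiv_fderiv_comp_dilation (c : ℝ) (f : E4 → V) :
    fderiv ℝ (fderiv ℝ fun y => f (c • y)) = fun y => c ^ 2 • fderiv ℝ (fderiv ℝ f) (c • y) := by
  rw [fderiv_comp_dilation, fderiv_const_smul_any c fun y => fderiv ℝ f (c • y),
    fderiv_comp_dilation c (fderiv ℝ f)]
  funext y
  rw [smul_smul, sq]

lemma lap_comp_dilation (c : ℝ) (f : E4 → V) :
    lap (fun y => f (c • y)) = fun y => c ^ 2 • lap f (c • y) := by
  funext y
  simp only [lap_apply, fderiv_fderiv_comp_dilation, Finset.smul_sum]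
  rfl

lemma lap_const_smul (c : ℝ) (f : E4 → V) : lap (fun y => c • f y) = fun y => c • lap f y := by
  funext y
  simp only [lap_apply, fderiv_const_smul_any c f, fderiv_const_smul_any c (fderiv ℝ f),
    Finset.smul_sum]
  rfl

lemma lap_lap_comp_dilation (c : ℝ) (f : E4 → V) :
    lap (lap fun y => f (c • y)) = fun y => c ^ 4 • lap (lap f) (c • y) := by
  rw [lap_comp_dilation, lap_const_smul, lap_comp_dilation]
  funext y
  rw [smul_smul]
  congr 1; ring

end Dilation

lemma lowNorm_comp_dilation {c : ℝ} (hc : 0 < c) (u : E4 → EuclideanSpace ℝ (Fin K)) (x : E4) :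
    lowNorm (fun y => u (c • y)) x = c ^ 4 * lowNorm u (c • x) := by
  have h : fderiv ℝ (lap fun y => u (c • y)) x = c ^ 3 • fderiv ℝ (lap u) (c • x) := by
    rw [lap_comp_dilation, fderiv_const_smul_any, fderiv_comp_dilation]
    simp only [smul_smul]
    congr 1
  rw [lowNorm, lowNorm, h, fderiv_fderiv_comp_dilation, fderiv_comp_dilation]
  simp only [norm_smul, norm_pow, Real.norm_of_nonneg hc.le]
  rcases eq_or_ne ‖x‖ 0 with hx | hx
  · simp [hx]
  · field_simp

lemma continuousAt_lowNorm {u : E4 → EuclideanSpace ℝ (Fin K)} {x : E4}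
    (hu : ContDiffAt ℝ ∞ u x) (hx : x ≠ 0) : ContinuousAt (lowNorm u) x := by
  have h1 := ((contDiffAt_lap hu).fderiv_right (m := ∞) (by simp)).continuousAt.norm
  have h2 := ((hu.fderiv_right (m := ∞) (by simp)).fderiv_right
    (m := ∞) (by simp)).continuousAt.norm
  have h3 := (hu.fderiv_right (m := ∞) (by simp)).continuousAt.norm
  have h4 := hu.continuousAt.norm
  have hn := norm_ne_zero_iff.2 hx
  have c : ContinuousAt (fun x : E4 => ‖x‖) x := continuous_norm.continuousAt
  exact (((h1.div c hn).add (h2.div (c.pow 2) (pow_ne_zero _ hn))).add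
    (h3.div (c.pow 3) (pow_ne_zero _ hn))).add (h4.div (c.pow 4) (pow_ne_zero _ hn))

lemma norm_lower_order_le {η : ℝ} {u : E4 → EuclideanSpace ℝ (Fin K)} {x : E4}
    {A₁ : (E4 →L[ℝ] EuclideanSpace ℝ (Fin K)) →L[ℝ] EuclideanSpace ℝ (Fin K)}
    {A₂ : (E4 →L[ℝ] E4 →L[ℝ] EuclideanSpace ℝ (Fin K)) →L[ℝ] EuclideanSpace ℝ (Fin K)}
    {A₃ : (E4 →L[ℝ] EuclideanSpace ℝ (Fin K)) →L[ℝ] EuclideanSpace ℝ (Fin K)}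
    {A₄ : EuclideanSpace ℝ (Fin K) →L[ℝ] EuclideanSpace ℝ (Fin K)}
    (h₁ : ‖A₁‖ ≤ η / ‖x‖) (h₂ : ‖A₂‖ ≤ η / ‖x‖ ^ 2) (h₃ : ‖A₃‖ ≤ η / ‖x‖ ^ 3)
    (h₄ : ‖A₄‖ ≤ η / ‖x‖ ^ 4) :
    ‖A₁ (fderiv ℝ (lap u) x) + A₂ (fderiv ℝ (fderiv ℝ u) x) + A₃ (fderiv ℝ u x) + A₄ (u x)‖ ≤
      η * lowNorm u x := by
  refine (norm_add₄_le).trans ?_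
  have e₁ := A₁.le_of_opNorm_le h₁ (fderiv ℝ (lap u) x)
  have e₂ := A₂.le_of_opNorm_le h₂ (fderiv ℝ (fderiv ℝ u) x)
  have e₃ := A₃.le_of_opNorm_le h₃ (fderiv ℝ u x)
  have e₄ := A₄.le_of_opNorm_le h₄ (u x)
  refine (add_le_add (add_le_add (add_le_add e₁ e₂) e₃) e₄).trans (le_of_eq ?_)
  rw [lowNorm]; ring

/-- An approximately biharmonic map satisfies a scale-invariant differential inequality at every
point of a sphere contained in the interior of its domain. -/
lemma norm_lap_lap_le {η : ℝ} {S : Set E4} {u : E4 → EuclideanSpace ℝ (Fin K)}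
    (hu : IsApproxBiharmonicOn η S u) {r : ℝ} (hr : 0 < r)
    (hS : ∀ θ : S3, S ∈ nhds (r • (θ : E4))) (θ : S3) :
    ‖lap (lap u) (r • (θ : E4))‖ ≤
      η * (lowNorm u (r • (θ : E4)) + avg fun θ => lowNorm u (r • (θ : E4))) := by
  obtain ⟨hsm, a₁, a₂, a₃, a₄, b₁, b₂, b₃, b₄, heq, hb⟩ := hu
  have hnorm : ∀ θ : S3, ‖r • (θ : E4)‖ = r := fun θ => by
    have : ‖(θ : E4)‖ = 1 := by simp
    rw [norm_smul, this, mul_one, Real.norm_of_nonneg hr.le]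
  have hb' := fun θ : S3 => hb _ (mem_of_mem_nhds (hS θ))
  have hlow : Continuous fun θ : S3 => lowNorm u (r • (θ : E4)) :=
    continuous_iff_continuousAt.2 fun θ => ContinuousAt.comp
      (f := fun θ : S3 => r • (θ : E4)) (continuousAt_lowNorm (hsm.contDiffAt (hS θ))
      (norm_ne_zero_iff.1 ((hnorm θ).trans_ne hr.ne'))) (by fun_prop)
  rw [heq _ (mem_of_mem_nhds (hS θ)), hnorm, sphereAvg_eq hr, mul_add]
  refine (norm_add_le _ _).trans (add_le_add ?_ ?_)
  · obtain ⟨h₁, h₂, h₃, h₄⟩ := hb' θ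
    exact norm_lower_order_le (le_of_add_le_of_nonneg_left h₁ (ContinuousLinearMap.opNorm_nonneg _))
      (le_of_add_le_of_nonneg_left h₂ (ContinuousLinearMap.opNorm_nonneg _))
      (le_of_add_le_of_nonneg_left h₃ (ContinuousLinearMap.opNorm_nonneg _))
      (le_of_add_le_of_nonneg_left h₄ (ContinuousLinearMap.opNorm_nonneg _))
  · rw [norm_smul, norm_inv, Real.norm_of_nonneg surf_univ_pos.le, avg, mul_left_comm]
    refine mul_le_mul_of_nonneg_left ?_ (inv_nonneg.2 surf_univ_pos.le)
    rw [← integral_const_mul]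
    refine norm_integral_le_of_norm_le ((integrable_surf hlow).const_mul η)
      (Filter.Eventually.of_forall fun θ => ?_)
    obtain ⟨h₁, h₂, h₃, h₄⟩ := hb' θ
    exact norm_lower_order_le (le_of_add_le_of_nonneg_right h₁ (ContinuousLinearMap.opNorm_nonneg _))
      (le_of_add_le_of_nonneg_right h₂ (ContinuousLinearMap.opNorm_nonneg _))
      (le_of_add_le_of_nonneg_right h₃ (ContinuousLinearMap.opNorm_nonneg _))
      (le_of_add_le_of_nonneg_right h₄ (ContinuousLinearMap.opNorm_nonneg _))

/-- The energy of an annulus in terms of the dilated map. -/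
lemma FF_eq_integral {u : E4 → EuclideanSpace ℝ (Fin K)} (j : ℤ) {s a b : ℝ}
    (ha : a + s = -(j : ℝ) * 3) (hb : b + s = -((j : ℝ) - 1) * 3)
    (hu : ContinuousOn u (ann (a + s) (b + s))) :
    FF 3 j u = ∫ t in a..b, sphereNormSq (fun x => u (Real.exp s • x)) t := by
  have h := integral_ann_div (F := fun x => ‖u x‖ ^ 2) (by linarith : a + s ≤ b + s)
    (hu.norm.pow 2)
  have e : FF 3 j u = ∫ x in ann (a + s) (b + s), ‖u x‖ ^ 2 / ‖x‖ ^ 4 := by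
    rw [ha, hb]; rfl
  rw [e, h, ← intervalIntegral.integral_comp_add_right]
  refine intervalIntegral.integral_congr fun t _ => ?_
  simp only [sphereNormSq, smul_smul, ← Real.exp_add, add_comm]

lemma FF_nonneg (L : ℝ) (j : ℤ) (u : E4 → EuclideanSpace ℝ (Fin K)) : 0 ≤ FF L j u :=
  integral_nonneg fun _ => by positivity

/-- The quantitative convexity inequality for energies on three consecutive annuli. -/
lemma FF_convexity (K : ℕ) : ∃ η : ℝ, 0 < η ∧ ∀ l₁ l₂ : ℤ,
    ∀ u : E4 → EuclideanSpace ℝ (Fin K),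
    IsApproxBiharmonicOn η (ann (-(l₁ : ℝ) * 3) (-((l₂ : ℝ) - 1) * 3)) u →
    (∀ r : ℝ, Real.exp (-(l₁ : ℝ) * 3) ≤ r → r ≤ Real.exp (-((l₂ : ℝ) - 1) * 3) →
      ∫ x in sphere (0 : E4) r, u x ∂μH[3] = 0) →
    ∀ i : ℤ, l₂ < i → i < l₁ →
      44.5 * FF 3 i u ≤ FF 3 (i + 1) u + FF 3 (i - 1) u := by
  obtain ⟨η, hη, hmain⟩ := annulus_estimate K
  refine ⟨η, hη, fun l₁ l₂ u hu h0 i hi₂ hi₁ => ?_⟩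
  have hi₁' : (i : ℝ) + 1 ≤ l₁ := by exact_mod_cast hi₁
  have hi₂' : (l₂ : ℝ) + 1 ≤ i := by exact_mod_cast hi₂
  obtain ⟨s, hs⟩ : ∃ s : ℝ, s = -(i : ℝ) * 3 + 1.5 := ⟨_, rfl⟩
  have hsub : ∀ {a b : ℝ}, -4.5 ≤ a → b ≤ 4.5 →
      ann (a + s) (b + s) ⊆ ann (-(l₁ : ℝ) * 3) (-((l₂ : ℝ) - 1) * 3) := fun ha hb x hx =>
    ⟨(Real.exp_le_exp.2 (by linarith)).trans hx.1, hx.2.trans (Real.exp_le_exp.2 (by linarith))⟩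
  have hc : ∀ {a b : ℝ}, -4.5 ≤ a → b ≤ 4.5 → ContinuousOn u (ann (a + s) (b + s)) :=
    fun ha hb => hu.1.continuousOn.mono (hsub ha hb)
  have hexp : ∀ (t : ℝ) (θ : S3),
      Real.exp s • Real.exp t • (θ : E4) = Real.exp (t + s) • (θ : E4) := fun t θ => by
    rw [smul_smul, ← Real.exp_add, add_comm]
  rw [FF_eq_integral i (a := -1.5) (b := 1.5) (s := s) (by rw [hs]; ring) (by rw [hs]; ring)
      (hc (by norm_num) (by norm_num)),
    FF_eq_integral (i + 1) (a := -4.5) (b := -1.5) (s := s) (by rw [hs]; push_cast; ring)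
      (by rw [hs]; push_cast; ring) (hc (by norm_num) (by norm_num)),
    FF_eq_integral (i - 1) (a := 1.5) (b := 4.5) (s := s) (by rw [hs]; push_cast; ring)
      (by rw [hs]; push_cast; ring) (hc (by norm_num) (by norm_num))]
  refine hmain _ ?_ ?_ ?_
  · refine hu.1.comp (contDiff_id.const_smul _).contDiffOn fun x hx =>
      hsub le_rfl le_rfl ?_
    have : ‖Real.exp s • x‖ = Real.exp s * ‖x‖ := by
      rw [norm_smul, Real.norm_of_nonneg (Real.exp_pos _).le]
    simp only [ann, Set.mem_ofPred_eq, this, add_comm _ s, Real.exp_add]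
    exact ⟨mul_le_mul_of_nonneg_left hx.1 (Real.exp_pos _).le,
      mul_le_mul_of_nonneg_left hx.2 (Real.exp_pos _).le⟩
  · intro t ht θ
    have h := norm_lap_lap_le hu (Real.exp_pos (t + s)) (fun θ => ?_) θ
    · simp only [lap_lap_comp_dilation, lowNorm_comp_dilation (Real.exp_pos s), norm_smul,
        hexp, avg, integral_const_mul]
      rw [Real.norm_of_nonneg (by positivity)]
      have := mul_le_mul_of_nonneg_left h (by positivity : 0 ≤ Real.exp s ^ 4)
      rw [avg] at this
      linarith
    · have ho : IsOpen {x : E4 | Real.exp (-4.5 + s) < ‖x‖ ∧ ‖x‖ < Real.exp (4.5 + s)} :=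
        (isOpen_lt continuous_const continuous_norm).inter
          (isOpen_lt continuous_norm continuous_const)
      refine Filter.mem_of_superset (ho.mem_nhds ?_) fun x hx =>
        hsub (a := -4.5) (b := 4.5) le_rfl le_rfl ⟨hx.1.le, hx.2.le⟩
      simp only [Set.mem_ofPred_eq, norm_exp_smul, Real.exp_lt_exp]
      constructor <;> linarith [ht.1, ht.2]
  · intro t ht
    simp only [hexp]
    exact integral_surf_eq_zero (Real.exp_pos _) (h0 _
      (Real.exp_le_exp.2 (by linarith [ht.1])) (Real.exp_le_exp.2 (by linarith [ht.2])))

lemma three_circle_alternatives {x y z : ℝ} (hx : 0 ≤ x)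
    (h : 44.5 * x ≤ z + y) :
    (z ≤ Real.exp (-3) * x → x ≤ Real.exp (-3) * y) ∧
      (y ≤ Real.exp (-3) * x → x ≤ Real.exp (-3) * z) ∧
      (x ≤ Real.exp (-3) * y ∨ x ≤ Real.exp (-3) * z) := by
  have he := exp_three_le
  have hp := Real.exp_pos (-3)
  have hm : Real.exp (-3) * Real.exp 3 = 1 := by rw [← Real.exp_add]; simp
  have h1 : Real.exp (-3) ≤ 1 := Real.exp_le_one_iff.2 (by norm_num)
  have key : ∀ w : ℝ, 20.1 * x ≤ w → x ≤ Real.exp (-3) * w := fun w hw => by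
    have := mul_le_mul_of_nonneg_left (((mul_le_mul_of_nonneg_right he hx).trans hw)) hp.le
    rwa [← mul_assoc, hm, one_mul] at this
  have h2 := mul_le_mul_of_nonneg_right h1 hx
  refine ⟨fun hz => key _ (by linarith), fun hy => key _ (by linarith), ?_⟩
  rcases le_total (20.1 * x) y with hy | hy
  · exact Or.inl (key _ hy)
  · exact Or.inr (key _ (by linarith))

end Systems

end ThreeCircle

/-- Three circle lemma for approximate biharmonic functions (with `L = 3`): there is an
`η₀ > 0` such that any `η₀`-approximate biharmonic function on
`Σ = {e^{-l₁L} ≤ |x| ≤ e^{-(l₂-1)L}}` with vanishing spherical means satisfies, for every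
`l₂ < i < l₁`, the three alternatives (a), (b), (c). -/
theorem three_circle_approx_biharmonic (K : ℕ) :
    ∃ η₀ : ℝ, 0 < η₀ ∧
      ∀ l₁ l₂ : ℤ, l₂ < l₁ →
      ∀ u : EuclideanSpace ℝ (Fin 4) → EuclideanSpace ℝ (Fin K),
        IsApproxBiharmonicOn η₀
          {x : EuclideanSpace ℝ (Fin 4) |
            Real.exp (-(l₁ : ℝ) * 3) ≤ ‖x‖ ∧ ‖x‖ ≤ Real.exp (-((l₂ : ℝ) - 1) * 3)} u →
        (∀ r : ℝ, Real.exp (-(l₁ : ℝ) * 3) ≤ r → r ≤ Real.exp (-((l₂ : ℝ) - 1) * 3) →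
          ∫ x in Metric.sphere (0 : EuclideanSpace ℝ (Fin 4)) r, u x ∂(μH[3]) = 0) →
        ∀ i : ℤ, l₂ < i → i < l₁ →
          ((FF 3 (i + 1) u ≤ Real.exp (-3) * FF 3 i u →
              FF 3 i u ≤ Real.exp (-3) * FF 3 (i - 1) u) ∧
           (FF 3 (i - 1) u ≤ Real.exp (-3) * FF 3 i u →
              FF 3 i u ≤ Real.exp (-3) * FF 3 (i + 1) u) ∧
           (FF 3 i u ≤ Real.exp (-3) * FF 3 (i - 1) u ∨
              FF 3 i u ≤ Real.exp (-3) * FF 3 (i + 1) u)) := by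
  obtain ⟨η, hη, h⟩ := ThreeCircle.FF_convexity K
  refine ⟨η, hη, fun l₁ l₂ _ u hu h0 i hi₂ hi₁ => ?_⟩
  exact ThreeCircle.three_circle_alternatives (ThreeCircle.FF_nonneg 3 i u)
    (h l₁ l₂ u hu h0 i hi₂ hi₁)
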